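/- Let h ≥ 2 be an integer, let ℓ be a prime ideal of O_K, and let N_{h,ℓ}(x) denote the set of h-full ideals of O_K with norm at most x that are coprime to ℓ. Then |N_{h,ℓ}(x)| = (κ γ_h / (1 + N(ℓ)^{−1}/(1 − N(ℓ)^{−1/h}))) · x^{1/h} + O_h(R_{N_h}(x)), where the implied constant depends only on h and K (uniformly in ℓ), γ_h = ∏_p (1 + (N(p) − N(p)^{1/h})/(N(p)²(N(p)^{1/h} − 1))) (product over all prime ideals p), and R_{N_h}(x) = x^{(1/h)(1 − 2/(n_K+1))} if h/(h+1) < 1 − 2/(n_K+1); R_{N_h}(x) = x^{1/(h+1)} log x if h/(h+1) = 1 − 2/(n_K+1); R_{N_h}(x) = x^{1/(h+1)} if h/(h+1) > 1 − 2/(n_K+1). -/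

import Mathlib

open Filter Topology
open scoped BigOperators

noncomputable section

variable (K : Type) [Field K] [NumberField K]

/-- `m` is an `h`-full ideal: every prime ideal dividing `m` divides it to order at least `h`. -/
def IsHFull (h : ℕ) (m : Ideal (NumberField.RingOfIntegers K)) : Prop :=
  m ≠ 0 ∧ ∀ p : Ideal (NumberField.RingOfIntegers K), p.IsPrime → p ∣ m → p ^ h ∣ m

/-- The residue `κ` of the Dedekind zeta function of `K` at `s = 1`. -/
def kappa : ℝ :=
  (2 ^ NumberField.InfinitePlace.nrRealPlaces K *
      (2 * Real.pi) ^ NumberField.InfinitePlace.nrComplexPlaces K *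
      (NumberField.classNumber K) * NumberField.Units.regulator K) /
    ((NumberField.Units.torsionOrder K) * Real.sqrt |(NumberField.discr K : ℝ)|)

/-- The constant `γ_h`, an infinite product over the (nonzero) prime ideals of `O_K`. -/
def gammaH (h : ℕ) : ℝ :=
  ∏' p : {p : Ideal (NumberField.RingOfIntegers K) // p.IsPrime ∧ p ≠ ⊥},
    (1 + ((Ideal.absNorm p.1 : ℝ) - (Ideal.absNorm p.1 : ℝ) ^ ((1 : ℝ)/h)) /
      ((Ideal.absNorm p.1 : ℝ) ^ 2 * ((Ideal.absNorm p.1 : ℝ) ^ ((1 : ℝ)/h) - 1)))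

/-- The error term `R_{N_h}` for the distribution of `h`-full ideals. -/
def RNh (h : ℕ) (x : ℝ) : ℝ :=
  if (h : ℝ)/(h + 1) < 1 - 2/((Module.finrank ℚ K : ℝ) + 1) then
    x ^ (((1 : ℝ)/h) * (1 - 2/((Module.finrank ℚ K : ℝ) + 1)))
  else if (h : ℝ)/(h + 1) = 1 - 2/((Module.finrank ℚ K : ℝ) + 1) then
    x ^ ((1 : ℝ)/(h + 1)) * Real.log x
  else x ^ ((1 : ℝ)/(h + 1))


open Filter Topology
open scoped BigOperators

noncomputable section HFB

namespace HF

open MeasureTheory Set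
open scoped ContDiff

/-- smoothness of a function that is smooth near its topological support -/
lemma smooth_of_tsupport {W F : Type*} [NormedAddCommGroup W] [NormedSpace ℝ W]
    [NormedAddCommGroup F] [NormedSpace ℝ F] {f : W → F}
    (h : ∀ x ∈ tsupport f, ContDiffAt ℝ ∞ f x) : ContDiff ℝ ∞ f := by
  rw [contDiff_iff_contDiffAt]
  intro x
  by_cases hx : x ∈ tsupport f
  · exact h x hx
  · have : f =ᶠ[𝓝 x] fun _ => 0 := notMem_tsupport_iff_eventuallyEq.mp hx
    exact contDiffAt_const.congr_of_eventuallyEq this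

section
variable {Z E : Type*} [NormedAddCommGroup Z] [NormedSpace ℝ Z]
  [NormedAddCommGroup E] [NormedSpace ℝ E]

lemma closedEmb_mk (z : Z) : IsClosedEmbedding (fun x : E => (z, x)) := by
  refine ⟨isEmbedding_prodMkRight z, ?_⟩
  have : range (fun x : E => (z, x)) = Prod.fst ⁻¹' {z} := by
    ext ⟨a, b⟩; simp [eq_comm]
  rw [this]
  exact isClosed_singleton.preimage continuous_fst

lemma slice_hcs {F : Type*} [Zero F] {A : Z × E → F} (hA : HasCompactSupport A) (z : Z) :
    HasCompactSupport (fun x => A (z, x)) :=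
  hA.comp_isClosedEmbedding (closedEmb_mk z)

/-- directional derivative along the second factor -/
def pd {F : Type*} [NormedAddCommGroup F] [NormedSpace ℝ F] (A : Z × E → F) (h : E) (w : Z × E) : F :=
  fderiv ℝ A w (0, h)

lemma pd_smooth {F : Type*} [NormedAddCommGroup F] [NormedSpace ℝ F] {A : Z × E → F}
    (hA : ContDiff ℝ ∞ A) (h : E) : ContDiff ℝ ∞ (pd A h) := by
  unfold pd
  have := hA.fderiv_right (m := ∞) (by simp)
  exact this.clm_apply contDiff_const

lemma pd_tsupport {F : Type*} [NormedAddCommGroup F] [NormedSpace ℝ F] (A : Z × E → F) (h : E) :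
    tsupport (pd A h) ⊆ tsupport A := by
  apply closure_minimal _ (isClosed_tsupport A)
  intro w hw
  by_contra hn
  apply hw
  have : fderiv ℝ A w = 0 := by
    by_contra h2
    exact hn (support_fderiv_subset ℝ h2)
  simp [pd, this]

lemma pd_hcs {F : Type*} [NormedAddCommGroup F] [NormedSpace ℝ F] {A : Z × E → F}
    (hA : HasCompactSupport A) (h : E) : HasCompactSupport (pd A h) :=
  hA.of_isClosed_subset (isClosed_tsupport _) (pd_tsupport A h)

lemma hasFDeriv_slice {F : Type*} [NormedAddCommGroup F] [NormedSpace ℝ F] {A : Z × E → F}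
    (hA : ContDiff ℝ ∞ A) (z : Z) (x h : E) :
    fderiv ℝ (fun x => A (z, x)) x h = pd A h (z, x) := by
  have h1 : HasFDerivAt (fun x : E => (z, x)) (ContinuousLinearMap.inr ℝ Z E) x :=
    hasFDerivAt_prodMk_right z x
  have h2 := ((hA.differentiable (by simp)) (z, x)).hasFDerivAt.comp x h1
  have h3 := h2.fderiv
  simp only [Function.comp_def] at h3
  rw [h3]; simp [pd]

variable [FiniteDimensional ℝ E] [MeasurableSpace E] [BorelSpace E] (μ : Measure E)
  [μ.IsAddHaarMeasure]

/-- the exponential `e^{iλp}` -/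
def ep (l : ℝ) (r : ℝ) : ℂ := Complex.exp (Complex.I * (l * r : ℝ))

lemma norm_ep (l r : ℝ) : ‖ep l r‖ = 1 := by
  unfold ep; rw [mul_comm]; exact Complex.norm_exp_ofReal_mul_I _

lemma ep_smooth {W : Type*} [NormedAddCommGroup W] [NormedSpace ℝ W] {p : W → ℝ}
    (hp : ContDiff ℝ ∞ p) (l : ℝ) : ContDiff ℝ ∞ (fun w => ep l (p w)) := by
  unfold ep
  apply ContDiff.cexp
  apply contDiff_const.mul
  exact Complex.ofRealCLM.contDiff.comp (contDiff_const.mul hp)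

lemma osc_integrable {A : E → ℂ} (hA : Continuous A) (hs : HasCompactSupport A) {p : E → ℝ}
    (hp : Continuous p) (l : ℝ) : Integrable (fun x => A x * ep l (p x)) μ := by
  apply Continuous.integrable_of_hasCompactSupport
  · unfold ep; fun_prop
  · exact hs.mul_right

lemma ibp1 {F : Z × E → ℂ} (hF : ContDiff ℝ ∞ F) (hs : HasCompactSupport F) {p : Z × E → ℝ}
    (hp : ContDiff ℝ ∞ p) (h : E) (z : Z) (l : ℝ) :
    (Complex.I * l) * ∫ x, (F (z, x) * (pd p h (z, x) : ℝ)) * ep l (p (z, x)) ∂μ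
      = - ∫ x, pd F h (z, x) * ep l (p (z, x)) ∂μ := by
  have hmk : ContDiff ℝ ∞ (fun x : E => (z, x)) := contDiff_prodMk_right z
  have hFz : ContDiff ℝ ∞ (fun x => F (z, x)) := hF.comp hmk
  have hpz : ContDiff ℝ ∞ (fun x => p (z, x)) := hp.comp hmk
  have hez := ep_smooth hpz l
  have hde : ∀ x, fderiv ℝ (fun x => ep l (p (z, x))) x h
      = (Complex.I * l) * (pd p h (z, x) : ℝ) * ep l (p (z, x)) := by
    intro x
    have h1 : HasFDerivAt (fun x => p (z, x)) (fderiv ℝ (fun x => p (z, x)) x) x :=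
      (hpz.differentiable (by simp) x).hasFDerivAt
    have h2 : HasFDerivAt (fun x => (p (z, x) : ℂ)) (Complex.ofRealCLM.comp (fderiv ℝ (fun x => p (z, x)) x)) x :=
      Complex.ofRealCLM.hasFDerivAt.comp x h1
    have h3 := ((h2.const_mul (l : ℂ)).const_mul Complex.I).cexp
    have h4 : (fun x => ep l (p (z, x))) = fun x => Complex.exp (Complex.I * ((l : ℂ) * (p (z, x) : ℂ))) := by
      funext x; simp [ep]
    rw [h4, h3.fderiv]
    have h5 := hasFDeriv_slice hp z x h
    simp [ep, h5]
    ring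
  have key := integral_mul_fderiv_eq_neg_fderiv_mul_of_integrable (μ := μ) (v := h)
    (f := fun x => F (z, x)) (g := fun x => ep l (p (z, x))) ?_ ?_ ?_
    (fun x _ => hFz.differentiable (by simp) x) (fun x _ => hez.differentiable (by simp) x)
  · simp_rw [hde, hasFDeriv_slice hF] at key
    rw [← key, ← integral_const_mul]
    congr 1; funext x; ring
  · simp_rw [hasFDeriv_slice hF]
    exact osc_integrable μ ((pd_smooth hF h).comp hmk).continuous (slice_hcs (pd_hcs hs h) z)
      hpz.continuous l
  · simp_rw [hde]
    have : Integrable (fun x => (F (z, x) * ((Complex.I * l) * (pd p h (z, x) : ℝ))) * ep l (p (z, x))) μ := by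
      apply osc_integrable μ _ _ hpz.continuous l
      · have := ((pd_smooth hp h).comp hmk).continuous
        have h2 := hFz.continuous
        simp only [Function.comp_def] at this
        fun_prop
      · exact (slice_hcs hs z).mul_right
    refine this.congr (ae_of_all _ fun x => ?_)
    simp only; ring
  · exact osc_integrable μ hFz.continuous (slice_hcs hs z) hpz.continuous l

/-- trivial bound -/
lemma osc_trivial {A : Z × E → ℂ} (hA : Continuous A) (hs : HasCompactSupport A) (p : Z × E → ℝ) :
    ∃ C : ℝ, 0 ≤ C ∧ ∀ (z : Z) (l : ℝ), ‖∫ x, A (z, x) * ep l (p (z, x)) ∂μ‖ ≤ C := by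
  obtain ⟨M, hM⟩ := hs.exists_bound_of_continuous hA
  have hM0 : 0 ≤ M := (norm_nonneg _).trans (hM 0)
  set S := Prod.snd '' (tsupport A) with hS
  have hSc : IsCompact S := hs.image continuous_snd
  refine ⟨M * (μ S).toReal, by positivity, fun z l => ?_⟩
  have h1 : ∫ x, A (z, x) * ep l (p (z, x)) ∂μ = ∫ x in S, A (z, x) * ep l (p (z, x)) ∂μ := by
    symm
    apply setIntegral_eq_integral_of_forall_compl_eq_zero
    intro x hx
    have : A (z, x) = 0 := by
      by_contra h
      exact hx ⟨(z, x), subset_tsupport _ h, rfl⟩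
    simp [this]
  rw [h1]
  have := norm_setIntegral_le_of_norm_le_const (μ := μ) (s := S) (f := fun x => A (z, x) * ep l (p (z, x))) (C := M) hSc.measure_lt_top
    (fun x _ => by rw [norm_mul, norm_ep, mul_one]; exact hM _)
  simpa [measureReal_def] using this

/-- non-stationary phase with parameters -/
lemma nonstat {p : Z × E → ℝ} (hp : ContDiff ℝ ∞ p) (L : ℕ) : ∀ {A : Z × E → ℂ},
    ContDiff ℝ ∞ A → HasCompactSupport A → (∀ w ∈ tsupport A, ∃ h : E, pd p h w ≠ 0) →
    ∃ C : ℝ, 0 ≤ C ∧ ∀ (z : Z) (l : ℝ), 0 < l →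
      ‖∫ x, A (z, x) * ep l (p (z, x)) ∂μ‖ ≤ C * (l ^ L)⁻¹ := by
  induction L with
  | zero =>
    intro A hA hs _
    obtain ⟨C, hC, h⟩ := osc_trivial μ hA.continuous hs p
    exact ⟨C, hC, fun z l _ => by simpa using h z l⟩
  | succ L ih =>
    intro A hA hs hg
    let b := Module.finBasis ℝ E
    let q : Z × E → ℝ := fun w => ∑ j, (pd p (b j) w) ^ 2
    have hq : ContDiff ℝ ∞ q := ContDiff.sum fun j _ => (pd_smooth hp (b j)).pow 2
    have hq0 : ∀ w ∈ tsupport A, q w ≠ 0 := by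
      intro w hw h0
      obtain ⟨h, hh⟩ := hg w hw
      apply hh
      have h1 : ∀ j, pd p (b j) w = 0 := by
        intro j
        have := (Finset.sum_eq_zero_iff_of_nonneg (fun j _ => sq_nonneg (pd p (b j) w))).mp h0 j (Finset.mem_univ j)
        simpa using this
      let φ : E →ₗ[ℝ] ℝ := (fderiv ℝ p w).toLinearMap.comp (LinearMap.inr ℝ Z E)
      have h2 : φ = 0 := b.ext fun j => by simpa [φ, pd] using h1 j
      have h3 : φ h = pd p h w := by simp [φ, pd]
      rw [← h3, h2]; simp
    let B : Fin (Module.finrank ℝ E) → Z × E → ℂ := fun j w => A w * ((pd p (b j) w / q w : ℝ) : ℂ)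
    have hBt : ∀ j, tsupport (B j) ⊆ tsupport A := fun j => tsupport_mul_subset_left
    have hBs : ∀ j, ContDiff ℝ ∞ (B j) := by
      intro j
      apply smooth_of_tsupport
      intro w hw
      have hw' := hBt j hw
      apply hA.contDiffAt.mul
      exact Complex.ofRealCLM.contDiff.contDiffAt.comp w
        ((pd_smooth hp (b j)).contDiffAt.div hq.contDiffAt (hq0 w hw'))
    have hBc : ∀ j, HasCompactSupport (B j) := fun j => hs.mul_right
    have hchoice : ∀ j, ∃ C : ℝ, 0 ≤ C ∧ ∀ (z : Z) (l : ℝ), 0 < l →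
      ‖∫ x, pd (B j) (b j) (z, x) * ep l (p (z, x)) ∂μ‖ ≤ C * (l ^ L)⁻¹ := by
      intro j
      apply ih (pd_smooth (hBs j) _) (pd_hcs (hBc j) _)
      intro w hw
      exact hg w (hBt j (pd_tsupport _ _ hw))
    choose C hC0 hC using hchoice
    refine ⟨∑ j, C j, Finset.sum_nonneg fun j _ => hC0 j, fun z l hl => ?_⟩
    have hmk : ContDiff ℝ ∞ (fun x : E => (z, x)) := contDiff_prodMk_right z
    have hdec : ∀ x, A (z, x) * ep l (p (z, x))
        = ∑ j, (B j (z, x) * (pd p (b j) (z, x) : ℝ)) * ep l (p (z, x)) := by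
      intro x
      rw [← Finset.sum_mul]
      congr 1
      by_cases hx : (z, x) ∈ tsupport A
      · have h1 := hq0 _ hx
        have h2 : ∀ j, B j (z, x) * (pd p (b j) (z, x) : ℝ) = A (z, x) * (((pd p (b j) (z, x)) ^ 2 / q (z, x) : ℝ) : ℂ) := by
          intro j; simp only [B]; push_cast; ring
        simp_rw [h2]
        rw [← Finset.mul_sum, ← Complex.ofReal_sum, ← Finset.sum_div]
        rw [div_self h1]; simp
      · have : A (z, x) = 0 := image_eq_zero_of_notMem_tsupport hx
        simp [B, this]
    simp_rw [hdec]
    rw [integral_finsetSum]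
    · rw [Finset.sum_mul]
      refine (norm_sum_le _ _).trans (Finset.sum_le_sum fun j _ => ?_)
      have h1 := ibp1 μ (hBs j) (hBc j) hp (b j) z l
      have h2 := congrArg norm h1
      rw [norm_neg, norm_mul, norm_mul, Complex.norm_I, one_mul, Complex.norm_real, Real.norm_of_nonneg hl.le] at h2
      have h3 := hC j z l hl
      rw [← h2] at h3
      rw [pow_succ, mul_inv, ← mul_assoc, ← div_eq_mul_inv _ l, le_div_iff₀ hl]
      linarith
    · intro j _
      apply osc_integrable μ _ _ (hp.comp hmk).continuous l
      · have h1 := ((pd_smooth hp (b j)).comp hmk).continuous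
        have h2 := ((hBs j).comp hmk).continuous
        simp only [Function.comp_def] at h1 h2
        fun_prop
      · exact (slice_hcs (hBc j) z).mul_right
end

end HF
end HFB


open Filter Topology
open scoped BigOperators

noncomputable section HFC

namespace HF

open MeasureTheory Set
open scoped ContDiff

lemma exists_shell_cutoff (E : Type*) [NormedAddCommGroup E] [NormedSpace ℝ E]
    [FiniteDimensional ℝ E] {s t : Set E} (hs : IsClosed s) (hd : s ⊆ interior t) (ht : IsCompact t) :
    ∃ f : E → ℝ, ContDiff ℝ ∞ f ∧ HasCompactSupport f ∧ (∀ x ∈ s, f x = 1) ∧ tsupport f ⊆ t := by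
  obtain ⟨f, h1, h2, -⟩ := exists_contMDiffMap_one_nhds_of_subset_interior (n := (⊤ : ℕ∞)) (modelWithCornersSelf ℝ E) hs hd
  have h3 : tsupport f ⊆ t := by
    apply closure_minimal _ ht.isClosed
    intro x hx
    by_contra h
    exact hx (h2 x h)
  refine ⟨f, f.contMDiff.contDiff, ht.of_isClosed_subset (isClosed_tsupport _) h3, ?_, h3⟩
  intro x hx
  exact (eventually_nhdsSet_iff_forall.mp h1 x hx).self_of_nhds

section
variable {Z E : Type*} [NormedAddCommGroup Z] [NormedSpace ℝ Z]
  [NormedAddCommGroup E] [NormedSpace ℝ E]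
variable [FiniteDimensional ℝ E] [MeasurableSpace E] [BorelSpace E] (μ : Measure E)
  [μ.IsAddHaarMeasure]

lemma decay_int (m : ℕ) (hm : Module.finrank ℝ E = m) :
    ∃ C : ℝ, 0 ≤ C ∧ ∀ l : ℝ, 0 < l → (Integrable (fun u : E => ((1 + l * ‖u‖) ^ (m + 1))⁻¹) μ ∧
      ∫ u : E, ((1 + l * ‖u‖) ^ (m + 1))⁻¹ ∂μ = C * (l ^ m)⁻¹) := by
  have h1 : Integrable (fun u : E => ((1 + ‖u‖) ^ (m + 1))⁻¹) μ := by
    have := integrable_one_add_norm (E := E) (μ := μ) (r := (m + 1 : ℝ)) (by rw [hm]; linarith)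
    refine this.congr (ae_of_all _ fun u => ?_)
    simp only
    rw [Real.rpow_neg (by positivity)]
    norm_cast
  refine ⟨∫ u : E, ((1 + ‖u‖) ^ (m + 1))⁻¹ ∂μ, integral_nonneg fun u => by positivity, fun l hl => ?_⟩
  have h2 : ∀ u : E, ((1 + l * ‖u‖) ^ (m + 1))⁻¹ = ((1 + ‖l • u‖) ^ (m + 1))⁻¹ := by
    intro u; rw [norm_smul, Real.norm_of_nonneg hl.le]
  simp_rw [h2]
  constructor
  · exact (integrable_comp_smul_iff μ (fun u : E => ((1 + ‖u‖) ^ (m + 1))⁻¹) hl.ne').mpr h1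
  · rw [Measure.integral_comp_smul μ (fun u : E => ((1 + ‖u‖) ^ (m + 1))⁻¹) l, hm,
      abs_of_pos (by positivity), smul_eq_mul, mul_comm]

lemma tt {A : Z × E → ℂ} (hA : ContDiff ℝ ∞ A) (hs : HasCompactSupport A) {p : Z × E → ℝ}
    (hp : ContDiff ℝ ∞ p) {Q : (Z × ℝ × E) × E → ℝ} (hQ : ContDiff ℝ ∞ Q)
    (hpQ : ∀ z (ρ : ℝ) ν x, p (z, x + ρ • ν) - p (z, x) = ρ * Q ((z, ρ, ν), x))
    (hnd : ∀ z (ρ : ℝ) ν x, 1 / 2 ≤ ‖ν‖ → ‖ν‖ ≤ 2 → (z, x) ∈ tsupport A →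
      (z, x + ρ • ν) ∈ tsupport A → ∃ h : E, pd Q h ((z, ρ, ν), x) ≠ 0) :
    ∃ C : ℝ, 0 ≤ C ∧ ∀ z (l : ℝ), 0 < l →
      ‖∫ x, A (z, x) * ep l (p (z, x)) ∂μ‖ ^ 2 ≤ C * (l ^ (Module.finrank ℝ E))⁻¹ := by
  set m := Module.finrank ℝ E with hm
  -- the set of x occurring
  set S := Prod.snd '' (tsupport A) with hS
  have hSc : IsCompact S := hs.image continuous_snd
  obtain ⟨R, hR⟩ := hSc.isBounded.exists_norm_le
  set R' := |R| + 1 with hR'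
  have hSR : ∀ z x, (z, x) ∈ tsupport A → ‖x‖ ≤ R' := by
    intro z x hx
    have := hR x ⟨(z, x), hx, rfl⟩
    have := le_abs_self R
    linarith
  have hR'0 : 0 < R' := by positivity
  obtain ⟨χ₁, hχ₁, hχ₁c, hχ₁1, -⟩ := exists_shell_cutoff ℝ (s := Icc (-(2 * R')) (2 * R'))
    (t := Icc (-(2 * R' + 1)) (2 * R' + 1)) isClosed_Icc (by
      rw [interior_Icc]; intro x hx; exact ⟨by linarith [hx.1], by linarith [hx.2]⟩) isCompact_Icc
  obtain ⟨χ₂, hχ₂, hχ₂c, hχ₂1, hχ₂t⟩ := exists_shell_cutoff E (s := {ν | ‖ν‖ = 1})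
    (t := {ν | 1 / 2 ≤ ‖ν‖ ∧ ‖ν‖ ≤ 2}) (isClosed_eq continuous_norm continuous_const) (by
      intro ν hν
      simp only [mem_ofPred_eq] at hν
      rw [mem_interior]
      refine ⟨{ν | 1 / 2 < ‖ν‖ ∧ ‖ν‖ < 2}, fun x hx => ⟨hx.1.le, hx.2.le⟩, ?_, ?_⟩
      · exact (isOpen_lt continuous_const continuous_norm).inter (isOpen_lt continuous_norm continuous_const)
      · simp only [mem_ofPred_eq, hν]; norm_num) (by
      apply (isCompact_closedBall (0 : E) 2).of_isClosed_subset
      · exact (isClosed_le continuous_const continuous_norm).inter (isClosed_le continuous_norm continuous_const)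
      · intro x hx; simpa using hx.2)
  -- amplitude in x, with parameters
  let a : (Z × E) × E → ℂ := fun w => A (w.1.1, w.2 + w.1.2) * (starRingEnd ℂ) (A (w.1.1, w.2))
  have hacont : ContDiff ℝ ∞ a := by
    apply ContDiff.mul
    · apply hA.comp; fun_prop
    · have : ContDiff ℝ ∞ (fun w : (Z × E) × E => A (w.1.1, w.2)) := by apply hA.comp; fun_prop
      exact Complex.conjCLE.contDiff.comp this
  have hasupp : HasCompactSupport a := by
    have hk : IsCompact ((fun w : (Z × E) × E => ((w.1.1, w.2 - w.1.2), w.1.2)) '' ((tsupport A) ×ˢ S)) := by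
      apply (hs.prod hSc).image; fun_prop
    have hk2 : IsCompact ((fun w : (Z × E) × E => ((w.1.1, w.2 - w.1.2), w.1.2)) '' ((tsupport A) ×ˢ S)) := hk
    apply HasCompactSupport.intro hk
    intro w hw
    by_contra h
    have h1 : A (w.1.1, w.2 + w.1.2) ≠ 0 := fun h' => h (by simp [a, h'])
    have h2 : A (w.1.1, w.2) ≠ 0 := fun h' => h (by simp [a, h'])
    apply hw
    refine ⟨((w.1.1, w.2), w.2 + w.1.2), ⟨subset_tsupport _ h2, ⟨_, subset_tsupport _ h1, rfl⟩⟩, ?_⟩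
    simp
  obtain ⟨C0, hC0, hb0⟩ := osc_trivial μ hacont.continuous hasupp
    (fun w => p (w.1.1, w.2 + w.1.2) - p (w.1.1, w.2))
  let aa : (Z × ℝ × E) × E → ℂ := fun w =>
    ((χ₁ w.1.2.1 * χ₂ w.1.2.2 : ℝ) : ℂ) * a ((w.1.1, w.1.2.1 • w.1.2.2), w.2)
  have haac : ContDiff ℝ ∞ aa := by
    apply ContDiff.mul
    · apply Complex.ofRealCLM.contDiff.comp
      apply ContDiff.mul
      · apply hχ₁.comp; fun_prop
      · apply hχ₂.comp; fun_prop
    · apply hacont.comp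
      have h1 : ContDiff ℝ ∞ (fun w : (Z × ℝ × E) × E => w.1.2.1) := by fun_prop
      have h2 : ContDiff ℝ ∞ (fun w : (Z × ℝ × E) × E => w.1.2.2) := by fun_prop
      exact (((contDiff_fst.comp contDiff_fst).prodMk (h1.smul h2)).prodMk contDiff_snd)
  have haat : ∀ w ∈ tsupport aa, (w.1.2.1 ∈ tsupport χ₁ ∧ w.1.2.2 ∈ tsupport χ₂) ∧
      ((w.1.1, w.2) ∈ tsupport A ∧ (w.1.1, w.2 + w.1.2.1 • w.1.2.2) ∈ tsupport A) := by
    have hcl : IsClosed {w : (Z × ℝ × E) × E | (w.1.2.1 ∈ tsupport χ₁ ∧ w.1.2.2 ∈ tsupport χ₂) ∧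
      ((w.1.1, w.2) ∈ tsupport A ∧ (w.1.1, w.2 + w.1.2.1 • w.1.2.2) ∈ tsupport A)} := by
      refine ((((isClosed_tsupport χ₁).preimage ?_).inter ((isClosed_tsupport χ₂).preimage ?_))).inter
        (((isClosed_tsupport A).preimage ?_).inter ((isClosed_tsupport A).preimage ?_)) <;> fun_prop
    intro w hw
    refine closure_minimal ?_ hcl hw
    intro w hw
    have hw : aa w ≠ 0 := hw
    refine ⟨⟨subset_tsupport _ ?_, subset_tsupport _ ?_⟩, subset_tsupport _ ?_, subset_tsupport _ ?_⟩ <;>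
    · intro h
      apply hw
      simp only [aa, a, h]
      simp
  have haas : HasCompactSupport aa := by
    have hk : IsCompact ((fun w : (ℝ × E) × (Z × E) => ((w.2.1, w.1.1, w.1.2), w.2.2)) ''
      ((tsupport χ₁ ×ˢ tsupport χ₂) ×ˢ tsupport A)) := by
      apply ((hχ₁c.isCompact.prod hχ₂c.isCompact).prod hs.isCompact).image; fun_prop
    apply hk.of_isClosed_subset (isClosed_tsupport _)
    intro w hw
    obtain ⟨⟨h1, h2⟩, h3, h4⟩ := haat w hw
    exact ⟨((w.1.2.1, w.1.2.2), (w.1.1, w.2)), ⟨⟨h1, h2⟩, h3⟩, rfl⟩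
  obtain ⟨C1, hC1, hb1⟩ := nonstat μ hQ (m + 1) haac haas (by
    intro w hw
    obtain ⟨⟨h1, h2⟩, h3, h4⟩ := haat w hw
    have h5 := hχ₂t h2
    exact hnd w.1.1 w.1.2.1 w.1.2.2 w.2 h5.1 h5.2 h3 h4)
  obtain ⟨C2, hC2, hb2⟩ := decay_int μ m hm.symm
  refine ⟨(C0 + C1) * 2 ^ (m + 1) * C2, by positivity, fun z l hl => ?_⟩
  -- inner integral
  let inn : E → ℂ := fun u => ∫ x, a ((z, u), x) * ep l (p (z, x + u) - p (z, x)) ∂μ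
  have hinn : ∀ u, ‖inn u‖ ≤ (C0 + C1) * 2 ^ (m + 1) * ((1 + l * ‖u‖) ^ (m + 1))⁻¹ := by
    intro u
    have h0 : ‖inn u‖ ≤ C0 := hb0 (z, u) l
    have ht0 : 0 ≤ l * ‖u‖ := by positivity
    rcases le_or_gt (l * ‖u‖) 1 with ht | ht
    · rw [← div_eq_mul_inv, le_div_iff₀ (by positivity)]
      gcongr
      · linarith
      · linarith
    · have hu : 0 < ‖u‖ := by
        by_contra h
        have : ‖u‖ = 0 := le_antisymm (not_lt.mp h) (norm_nonneg _)
        rw [this] at ht; linarith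
      have h1 : ‖inn u‖ ≤ C1 * ((l * ‖u‖) ^ (m + 1))⁻¹ := by
        by_cases hbig : ‖u‖ ≤ 2 * R'
        · have h3 := hb1 (z, ‖u‖, ‖u‖⁻¹ • u) (l * ‖u‖) (by positivity)
          have h4 : ‖u‖ • (‖u‖⁻¹ • u) = u := by
            rw [smul_smul, mul_inv_cancel₀ hu.ne', one_smul]
          have h5 : χ₁ ‖u‖ = 1 := hχ₁1 _ ⟨by linarith, hbig⟩
          have h6 : χ₂ (‖u‖⁻¹ • u) = 1 := hχ₂1 _ (by
            simp only [mem_ofPred_eq]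
            rw [norm_smul, norm_inv, norm_norm, inv_mul_cancel₀ hu.ne'])
          convert h3 using 2
          apply integral_congr_ae
          refine ae_of_all _ fun x => ?_
          simp only [aa, h4, h5, h6]
          have h7 := hpQ z ‖u‖ (‖u‖⁻¹ • u) x
          rw [h4] at h7
          rw [h7]
          simp only [ep]
          push_cast
          ring_nf
        · have : ∀ x, a ((z, u), x) = 0 := by
            intro x
            by_contra h
            have h1 : A (z, x + u) ≠ 0 := fun h' => h (by simp [a, h'])
            have h2 : A (z, x) ≠ 0 := fun h' => h (by simp [a, h'])
            have h3 := hSR z _ (subset_tsupport _ h1)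
            have h4 := hSR z _ (subset_tsupport _ h2)
            apply hbig
            calc ‖u‖ = ‖(x + u) - x‖ := by simp
              _ ≤ _ := norm_sub_le _ _
              _ ≤ _ := by linarith
          simp only [inn, this, zero_mul, integral_zero, norm_zero]
          positivity
      refine h1.trans ?_
      rw [← div_eq_mul_inv, ← div_eq_mul_inv, div_le_div_iff₀ (by positivity) (by positivity)]
      calc C1 * (1 + l * ‖u‖) ^ (m + 1) ≤ (C0 + C1) * (2 * (l * ‖u‖)) ^ (m + 1) := by
            gcongr
            · linarith
            · linarith
        _ = _ := by rw [mul_pow]; ring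
  let F : E → ℂ := fun x => A (z, x) * ep l (p (z, x))
  have hmk : ContDiff ℝ ∞ (fun x : E => (z, x)) := contDiff_prodMk_right z
  have hF : Continuous F := by
    have h1 := (hA.comp hmk).continuous
    have h2 := (ep_smooth (hp.comp hmk) l).continuous
    exact h1.mul h2
  have hFs : HasCompactSupport F := (slice_hcs hs z).mul_right
  have key : ((‖∫ x, F x ∂μ‖ ^ 2 : ℝ) : ℂ) = ∫ u, inn u ∂μ := by
    have h1 : ∀ x u, a ((z, u), x) * ep l (p (z, x + u) - p (z, x)) = (starRingEnd ℂ) (F x) * F (x + u) := by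
      intro x u
      simp only [a, F, ep, map_mul, ← Complex.exp_conj, Complex.conj_I, Complex.conj_ofReal]
      have : Complex.exp (Complex.I * ((l * (p (z, x + u) - p (z, x)) : ℝ) : ℂ))
        = Complex.exp (-Complex.I * ((l * p (z, x) : ℝ) : ℂ)) * Complex.exp (Complex.I * ((l * p (z, x + u) : ℝ) : ℂ)) := by
        rw [← Complex.exp_add]; congr 1; push_cast; ring
      rw [this]; ring
    have h2 : ((‖∫ x, F x ∂μ‖ ^ 2 : ℝ) : ℂ) = (∫ x, (starRingEnd ℂ) (F x) ∂μ) * ∫ x, F x ∂μ := by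
      rw [integral_conj, mul_comm, Complex.mul_conj, Complex.normSq_eq_norm_sq]
    rw [h2, ← integral_mul_const]
    simp only [inn, h1]
    have h3 : ∀ x, (starRingEnd ℂ) (F x) * ∫ y, F y ∂μ = ∫ u, (starRingEnd ℂ) (F x) * F (x + u) ∂μ := by
      intro x
      rw [integral_const_mul, integral_add_left_eq_self (μ := μ) F x]
    simp_rw [h3]
    rw [integral_integral_swap]
    apply Continuous.integrable_of_hasCompactSupport
    · simp only [Function.uncurry_def]
      exact (Complex.continuous_conj.comp (hF.comp continuous_fst)).mul (hF.comp (continuous_fst.add continuous_snd))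
    · have hk : IsCompact ((fun w : E × E => (w.1, w.2 - w.1)) '' (tsupport F ×ˢ tsupport F)) := by
        apply (hFs.isCompact.prod hFs.isCompact).image; fun_prop
      apply HasCompactSupport.intro hk
      intro w hw
      by_contra h
      have h1 : F (w.1 + w.2) ≠ 0 := fun h' => h (by simp [Function.uncurry_def, h'])
      have h2 : F (w.1) ≠ 0 := fun h' => h (by simp [Function.uncurry_def, h'])
      exact hw ⟨(w.1, w.1 + w.2), ⟨subset_tsupport _ h2, subset_tsupport _ h1⟩, by simp⟩
  have h5 : ‖∫ x, F x ∂μ‖ ^ 2 = ‖∫ u, inn u ∂μ‖ := by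
    rw [← key, Complex.norm_real, Real.norm_of_nonneg (by positivity)]
  change ‖∫ x, F x ∂μ‖ ^ 2 ≤ _
  rw [h5]
  calc ‖∫ u, inn u ∂μ‖ ≤ ∫ u, (C0 + C1) * 2 ^ (m + 1) * ((1 + l * ‖u‖) ^ (m + 1))⁻¹ ∂μ :=
        norm_integral_le_of_norm_le ((hb2 l hl).1.const_mul _) (ae_of_all _ hinn)
    _ = _ := by rw [integral_const_mul, (hb2 l hl).2]; ring
end

end HF
end HFC


open Filter Topology
open scoped BigOperators

noncomputable section HFD

namespace HF

open MeasureTheory Set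
open scoped ContDiff

/-- sum of L¹ norms of derivatives -/
def gnorm (k : ℕ) (g : ℝ → ℝ) : ℝ := ∑ j ∈ Finset.range (k + 1), ∫ y, |iteratedDeriv j g y|

lemma gnorm_nonneg (k : ℕ) (g : ℝ → ℝ) : 0 ≤ gnorm k g :=
  Finset.sum_nonneg fun _ _ => integral_nonneg fun _ => abs_nonneg _

lemma gnorm_mono {k l : ℕ} (h : k ≤ l) (g : ℝ → ℝ) : gnorm k g ≤ gnorm l g := by
  apply Finset.sum_le_sum_of_subset_of_nonneg
  · intro j; simp; omega
  · intro _ _ _; exact integral_nonneg fun _ => abs_nonneg _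

lemma gnorm_deriv (k : ℕ) (g : ℝ → ℝ) : gnorm k (deriv g) ≤ gnorm (k + 1) g := by
  unfold gnorm
  rw [Finset.sum_range_succ' _ (k + 1)]
  simp_rw [iteratedDeriv_succ']
  have : 0 ≤ ∫ y, |iteratedDeriv 0 g y| := integral_nonneg fun _ => abs_nonneg _
  linarith

section
variable {Z H : Type*} [NormedAddCommGroup Z] [NormedSpace ℝ Z]
  [NormedAddCommGroup H] [NormedSpace ℝ H]
variable [FiniteDimensional ℝ H] [MeasurableSpace H] [BorelSpace H] (μ : Measure H)
  [μ.IsAddHaarMeasure]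

/-- The oscillatory integral with radial weight. -/
def oI (c n : ℝ) (p : Z × (ℝ × H) → ℝ) (A : Z × (ℝ × H) → ℂ) (g : ℝ → ℝ) (z : Z) (l : ℝ) : ℂ :=
  ∫ y : ℝ × H, ((g (c + n * y.1) : ℝ) * A (z, y)) * ep l (p (z, y)) ∂(volume.prod μ)

lemma int_comp_affine {n : ℝ} (hn : 0 < n) (c : ℝ) (f : ℝ → ℝ) :
    ∫ s, f (c + n * s) = n⁻¹ * ∫ y, f y := by
  have h1 := Measure.integral_comp_mul_left (fun s => f (c + s)) n
  rw [h1, integral_add_left_eq_self f c, abs_of_pos (by positivity), smul_eq_mul]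

lemma oI_integrable {c n : ℝ} {p : Z × (ℝ × H) → ℝ} (hp : Continuous p) {A : Z × (ℝ × H) → ℂ}
    (hA : Continuous A) (hs : HasCompactSupport A) {g : ℝ → ℝ} (hg : Continuous g) (z : Z) (l : ℝ) :
    Integrable (fun y : ℝ × H => ((g (c + n * y.1) : ℝ) * A (z, y)) * ep l (p (z, y)))
      ((volume : Measure ℝ).prod μ) := by
  apply Continuous.integrable_of_hasCompactSupport
  · unfold ep; fun_prop
  · exact ((slice_hcs hs z).mul_left).mul_right

lemma oI_base {c n : ℝ} (hn : 0 < n) {p : Z × (ℝ × H) → ℝ} (hp : Continuous p)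
    {A : Z × (ℝ × H) → ℂ} (hA : Continuous A) (hs : HasCompactSupport A) {B : ℝ → ℝ}
    (hB : ∀ z s (l : ℝ), 1 ≤ l → ‖∫ x, A (z, (s, x)) * ep l (p (z, (s, x))) ∂μ‖ ≤ B l)
    {g : ℝ → ℝ} (hg : Continuous g) (hgs : HasCompactSupport g) (z : Z) {l : ℝ} (hl : 1 ≤ l) :
    ‖oI μ c n p A g z l‖ ≤ n⁻¹ * B l * ∫ y, |g y| := by
  unfold oI
  rw [integral_prod _ (oI_integrable μ hp hA hs hg z l)]
  have hInteg : Integrable (fun s => B l * |g (c + n * s)|) := by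
    have h1 : Integrable g := hg.integrable_of_hasCompactSupport hgs
    have h2 : Integrable (fun s => g (c + s)) := h1.comp_add_left c
    have h3 : Integrable (fun s => g (c + n * s)) := h2.comp_mul_left' hn.ne'
    exact h3.abs.const_mul _
  calc _ ≤ ∫ s, B l * |g (c + n * s)| := by
        apply norm_integral_le_of_norm_le hInteg
        refine ae_of_all _ fun s => ?_
        have : ∫ x, ((g (c + n * s) : ℝ) * A (z, (s, x))) * ep l (p (z, (s, x))) ∂μ
          = (g (c + n * s) : ℂ) * ∫ x, A (z, (s, x)) * ep l (p (z, (s, x))) ∂μ := by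
          rw [← integral_const_mul]; congr 1; funext x; ring
        simp only [this]
        rw [norm_mul, Complex.norm_real, Real.norm_eq_abs, mul_comm]
        exact mul_le_mul_of_nonneg_right (hB z s l hl) (abs_nonneg _)
    _ = _ := by
        rw [integral_const_mul, int_comp_affine hn c (fun y => |g y|)]; ring

/-- integration by parts in the radial variable -/
lemma oI_ibp {c n : ℝ} {p : Z × (ℝ × H) → ℝ} (hp : ContDiff ℝ ∞ p)
    {A : Z × (ℝ × H) → ℂ} (hA : ContDiff ℝ ∞ A) (hs : HasCompactSupport A)
    {g : ℝ → ℝ} (hg : ContDiff ℝ ∞ g) (z : Z) (l : ℝ) :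
    (Complex.I * l) * oI μ c n p (fun w => A w * (pd p ((1 : ℝ), (0 : H)) w : ℝ)) g z l
     = -(n * oI μ c n p A (deriv g) z l + oI μ c n p (pd A ((1 : ℝ), (0 : H))) g z l) := by
  let F : Z × (ℝ × H) → ℂ := fun w => (g (c + n * w.2.1) : ℝ) * A w
  have hG : ContDiff ℝ ∞ (fun w : Z × (ℝ × H) => g (c + n * w.2.1)) := by
    apply hg.comp; fun_prop
  have hF : ContDiff ℝ ∞ F := (Complex.ofRealCLM.contDiff.comp hG).mul hA
  have hFs : HasCompactSupport F := hs.mul_left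
  have h1 := ibp1 ((volume : Measure ℝ).prod μ) hF hFs hp ((1 : ℝ), (0 : H)) z l
  have hdg : Continuous (deriv g) := hg.continuous_deriv (by simp)
  have h2 : ∀ w, pd F ((1 : ℝ), (0 : H)) w = n * (((deriv g (c + n * w.2.1) : ℝ) : ℂ) * A w)
      + ((g (c + n * w.2.1) : ℝ) : ℂ) * pd A ((1 : ℝ), (0 : H)) w := by
    intro w
    have ha : HasFDerivAt A (fderiv ℝ A w) w := (hA.differentiable (by simp) w).hasFDerivAt
    have hlin : HasFDerivAt (fun w : Z × (ℝ × H) => c + n * w.2.1)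
      (n • ((ContinuousLinearMap.fst ℝ ℝ H).comp (ContinuousLinearMap.snd ℝ Z (ℝ × H)))) w := by
      have := (((ContinuousLinearMap.fst ℝ ℝ H).comp (ContinuousLinearMap.snd ℝ Z (ℝ × H))).hasFDerivAt (x := w)).const_mul n
      exact this.const_add c
    have hg1 : HasDerivAt g (deriv g (c + n * w.2.1)) (c + n * w.2.1) :=
      (hg.differentiable (by simp) _).hasDerivAt
    have hg2 := hg1.comp_hasFDerivAt w hlin
    have hg3 := Complex.ofRealCLM.hasFDerivAt.comp w hg2
    have := hg3.mul ha
    simp only [pd]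
    have h5 := this.fderiv
    simp only [Function.comp_def, Complex.ofRealCLM_apply] at h5
    have h6 : fderiv ℝ F w = _ := h5
    rw [h6]
    simp
    ring
  simp only [h2] at h1
  have h3 : ∫ y, (F (z, y) * (pd p ((1 : ℝ), (0 : H)) (z, y) : ℝ)) * ep l (p (z, y)) ∂((volume : Measure ℝ).prod μ)
     = oI μ c n p (fun w => A w * (pd p ((1 : ℝ), (0 : H)) w : ℝ)) g z l := by
    unfold oI; congr 1; funext y; simp only [F]; ring
  rw [h3] at h1
  rw [h1]
  congr 1
  unfold oI
  rw [← integral_const_mul, ← integral_add]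
  · congr 1; funext y; ring
  · exact (oI_integrable μ hp.continuous hA.continuous hs hdg z l).const_mul _
  · exact oI_integrable μ hp.continuous (pd_smooth hA _).continuous (pd_hcs hs _) hg.continuous z l

lemma oI_crit {c n : ℝ} (hn : 0 < n) {p : Z × (ℝ × H) → ℝ} (hp : ContDiff ℝ ∞ p)
    {K0 : Set (Z × (ℝ × H))} (hK0 : IsCompact K0) {r : ℝ}
    (hbase : ∀ A : Z × (ℝ × H) → ℂ, ContDiff ℝ ∞ A → tsupport A ⊆ K0 →
      ∃ C : ℝ, 0 ≤ C ∧ ∀ z s (l : ℝ), 1 ≤ l →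
        ‖∫ x, A (z, (s, x)) * ep l (p (z, (s, x))) ∂μ‖ ≤ C * l ^ (-r))
    (hps : ∀ w ∈ K0, pd p ((1 : ℝ), (0 : H)) w ≠ 0) (k : ℕ) :
    ∀ A : Z × (ℝ × H) → ℂ, ContDiff ℝ ∞ A → tsupport A ⊆ K0 →
      ∃ C : ℝ, 0 ≤ C ∧ ∀ g : ℝ → ℝ, ContDiff ℝ ∞ g → HasCompactSupport g → ∀ z (l : ℝ), 1 ≤ l →
        ‖oI μ c n p A g z l‖ ≤ C * gnorm k g * l ^ (-(k + r)) := by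
  induction k with
  | zero =>
    intro A hA hAK
    have hs : HasCompactSupport A := hK0.of_isClosed_subset (isClosed_tsupport _) hAK
    obtain ⟨C, hC, hb⟩ := hbase A hA hAK
    refine ⟨n⁻¹ * C, by positivity, fun g hg hgs z l hl => ?_⟩
    have := oI_base μ (c := c) hn hp.continuous hA.continuous hs hb hg.continuous hgs z hl
    refine this.trans (le_of_eq ?_)
    simp [gnorm]; ring
  | succ k ih =>
    intro A hA hAK
    have hs : HasCompactSupport A := hK0.of_isClosed_subset (isClosed_tsupport _) hAK
    let B : Z × (ℝ × H) → ℂ := fun w => A w * (((pd p ((1 : ℝ), (0 : H)) w)⁻¹ : ℝ) : ℂ)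
    have hBt : tsupport B ⊆ tsupport A := tsupport_mul_subset_left
    have hB : ContDiff ℝ ∞ B := by
      apply smooth_of_tsupport
      intro w hw
      apply hA.contDiffAt.mul
      exact Complex.ofRealCLM.contDiff.contDiffAt.comp w
        ((pd_smooth hp _).contDiffAt.inv (hps w (hAK (hBt hw))))
    have hBs : HasCompactSupport B := hs.mul_right
    obtain ⟨C1, hC1, h1⟩ := ih B hB (hBt.trans hAK)
    obtain ⟨C2, hC2, h2⟩ := ih (pd B ((1 : ℝ), (0 : H))) (pd_smooth hB _) ((pd_tsupport _ _).trans (hBt.trans hAK))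
    refine ⟨n * C1 + C2, by positivity, fun g hg hgs z l hl => ?_⟩
    have hl0 : 0 < l := by linarith
    have h3 := oI_ibp μ (c := c) (n := n) hp hB hBs hg z l
    have h4 : (fun w => B w * (pd p ((1 : ℝ), (0 : H)) w : ℝ)) = A := by
      funext w
      by_cases hw : w ∈ tsupport A
      · simp only [B]
        have := hps w (hAK hw)
        rw [mul_assoc, ← Complex.ofReal_mul, inv_mul_cancel₀ this]; simp
      · have : A w = 0 := image_eq_zero_of_notMem_tsupport hw
        simp [B, this]
    rw [h4] at h3
    have h5 := congrArg norm h3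
    rw [norm_neg, norm_mul, norm_mul, Complex.norm_I, one_mul, Complex.norm_real, Real.norm_of_nonneg hl0.le] at h5
    have hdg : ContDiff ℝ ∞ (deriv g) := (contDiff_infty_iff_deriv.mp hg).2
    have h6 := h1 (deriv g) hdg hgs.deriv z l hl
    have h7 := h2 g hg hgs z l hl
    have h8 : ‖(n : ℂ) * oI μ c n p B (deriv g) z l + oI μ c n p (pd B ((1 : ℝ), (0 : H))) g z l‖
      ≤ n * (C1 * gnorm (k + 1) g * l ^ (-(k + r))) + C2 * gnorm (k + 1) g * l ^ (-(k + r)) := by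
      refine (norm_add_le _ _).trans ?_
      rw [norm_mul, Complex.norm_real, Real.norm_of_nonneg hn.le]
      have := gnorm_deriv k g
      have := gnorm_mono (Nat.le_succ k) g
      have := gnorm_nonneg k g
      gcongr
      · refine h6.trans ?_; gcongr
      · refine h7.trans ?_; gcongr
    rw [← h5] at h8
    have h9 : l ^ (-((k + 1 : ℕ) + r) : ℝ) = l ^ (-(k + r)) / l := by
      rw [← Real.rpow_sub_one hl0.ne']; congr 1; push_cast; ring
    rw [h9, ← mul_div_assoc, le_div_iff₀ hl0]
    linarith
end

end HF
end HFD


open Filter Topology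
open scoped BigOperators

noncomputable section HFE

namespace HF

open MeasureTheory Set
open scoped ContDiff

/-- Auxiliary bundle: a commutative algebra with trace, involution, exponential and norm. -/
structure AD (V : Type*) [NormedCommRing V] [NormedAlgebra ℝ V] where
  Tr : V →L[ℝ] ℝ
  st : V →L[ℝ] V
  ex : V → V
  E : V → V
  Nm : V → ℝ
  Esm : ContDiff ℝ ∞ E
  exE : ∀ z, ex z = 1 + z * E z
  E0 : E 0 = 1
  exadd : ∀ x y, ex (x + y) = ex x * ex y
  Trst : ∀ v, Tr (st v) = Tr v
  stone : st 1 = 1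
  pos : ∀ v, v ≠ 0 → 0 < Tr (v * st v)
  Nmex : ∀ v y, Nm (v * ex y) = Nm v * Real.exp (Tr y)
  Nmc : Continuous Nm
  Nmunit : ∀ v, Nm v ≠ 0 → IsUnit v

namespace AD

variable {V : Type*} [NormedCommRing V] [NormedAlgebra ℝ V] (D : AD V)

lemma ex0 : D.ex 0 = 1 := by simp [D.exE]

lemma exsm : ContDiff ℝ ∞ D.ex := by
  have : D.ex = fun z => 1 + z * D.E z := funext D.exE
  rw [this]
  exact contDiff_const.add (contDiff_id.mul D.Esm)

lemma hasFDeriv_ex (x : V) : HasFDerivAt D.ex (ContinuousLinearMap.mul ℝ V (D.ex x)) x := by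
  have h0 : HasFDerivAt D.ex (ContinuousLinearMap.id ℝ V) 0 := by
    have : D.ex = fun z => 1 + z * D.E z := funext D.exE
    rw [this]
    have h1 : HasFDerivAt D.E (fderiv ℝ D.E 0) 0 := (D.Esm.differentiable (by simp) 0).hasFDerivAt
    have h2 := ((hasFDerivAt_id (𝕜 := ℝ) (0 : V)).mul h1).const_add 1
    refine h2.congr_fderiv ?_
    ext h
    simp [D.E0]
  have h1 : D.ex = fun y => D.ex x * D.ex (y - x) := by
    funext y; rw [← D.exadd]; congr 1; abel
  have h2 : HasFDerivAt (fun y => D.ex (y - x)) (ContinuousLinearMap.id ℝ V) x := by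
    have h3 : HasFDerivAt (fun y : V => y - x) (ContinuousLinearMap.id ℝ V) x :=
      (hasFDerivAt_id x).sub_const x
    have h4 : HasFDerivAt D.ex (ContinuousLinearMap.id ℝ V) (x - x) := by simpa using h0
    exact HasFDerivAt.comp (g := D.ex) (f := fun y => y - x) x h4 h3
  rw [h1]
  have := h2.const_mul (D.ex x)
  refine this.congr_fderiv ?_
  ext h; simp [D.ex0]

lemma Tr1_pos [Nontrivial V] : 0 < D.Tr 1 := by
  have := D.pos 1 one_ne_zero
  simpa [D.stone] using this

/-- dichotomy: either non-critical, or a scalar -/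
lemma crit_scalar [Nontrivial V] (a : V) (h : ∀ h : V, D.Tr h = 0 → D.Tr (a * h) = 0) :
    ∃ c : ℝ, a = c • (1 : V) := by
  have hn := D.Tr1_pos
  refine ⟨D.Tr a / D.Tr 1, ?_⟩
  set c := D.Tr a / D.Tr 1 with hc
  by_contra hne
  have h1 := D.pos (a - c • 1) (sub_ne_zero.mpr hne)
  have h2 : D.st (a - c • 1) = D.st a - c • 1 := by simp [D.stone]
  rw [h2] at h1
  have h3 : D.Tr (D.st a - c • 1) = 0 := by
    simp only [map_sub, map_smul, D.Trst, smul_eq_mul, hc]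
    field_simp; simp
  have h4 := h _ h3
  have h5 : D.Tr ((a - c • 1) * (D.st a - c • 1)) = D.Tr (a * (D.st a - c • 1)) - c * D.Tr (D.st a - c • 1) := by
    rw [sub_mul, map_sub]; simp
  rw [h5, h4, h3] at h1
  simp at h1

/-- the hyperplane -/
abbrev H : Submodule ℝ V := LinearMap.ker (D.Tr : V →ₗ[ℝ] ℝ)

lemma memH (x : D.H) : D.Tr (x : V) = 0 := x.2

lemma Tr_smooth_mul {W : Type*} [NormedAddCommGroup W] [NormedSpace ℝ W] {f : W → V}
    (hf : ContDiff ℝ ∞ f) : ContDiff ℝ ∞ (fun w => D.Tr (f w)) := D.Tr.contDiff.comp hf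

variable [FiniteDimensional ℝ V] [Nontrivial V]

/-- coordinates -/
def L : (ℝ × D.H) ≃L[ℝ] V :=
  LinearEquiv.toContinuousLinearEquiv
  { toFun := fun y => y.1 • (1 : V) + (y.2 : V)
    map_add' := by intro x y; simp [add_smul]; abel
    map_smul' := by intro c x; simp [mul_smul]
    invFun := fun v => (D.Tr v / D.Tr 1, ⟨v - (D.Tr v / D.Tr 1) • 1, by
      have := D.Tr1_pos
      simp only [LinearMap.mem_ker, ContinuousLinearMap.coe_coe, map_sub, map_smul, smul_eq_mul]
      field_simp; simp⟩)
    left_inv := by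
      intro y
      have h := D.Tr1_pos
      have h1 : D.Tr (y.1 • (1 : V) + (y.2 : V)) = y.1 * D.Tr 1 := by
        simp [D.memH y.2]
      ext
      · simp only [h1]; field_simp
      · simp only [h1]
        rw [mul_div_cancel_right₀ _ h.ne']; simp
    right_inv := by intro v; simp }

lemma L_apply (y : ℝ × D.H) : D.L y = y.1 • (1 : V) + (y.2 : V) := rfl

lemma Tr_L (y : ℝ × D.H) : D.Tr (D.L y) = y.1 * D.Tr 1 := by
  simp [L_apply, D.memH y.2]

lemma finrank_H : Module.finrank ℝ V = Module.finrank ℝ D.H + 1 := by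
  have := D.L.toLinearEquiv.finrank_eq
  rw [← this, Module.finrank_prod, Module.finrank_self]; ring

/-- phase in the chart -/
def ph (v0 : V) (w : V × (ℝ × D.H)) : ℝ := D.Tr (w.1 * (v0 * D.ex (D.L w.2)))

lemma ph_smooth (v0 : V) : ContDiff ℝ ∞ (D.ph v0) := by
  unfold ph
  apply D.Tr_smooth_mul
  apply contDiff_fst.mul
  apply contDiff_const.mul
  exact D.exsm.comp (D.L.contDiff.comp contDiff_snd)

lemma pd_ph (v0 : V) (w : V × (ℝ × D.H)) (h : ℝ × D.H) :
    pd (D.ph v0) h w = D.Tr (w.1 * (v0 * D.ex (D.L w.2)) * D.L h) := by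
  obtain ⟨om, y⟩ := w
  rw [← hasFDeriv_slice (D.ph_smooth v0)]
  have h1 : HasFDerivAt (fun y => D.ex (D.L y)) ((ContinuousLinearMap.mul ℝ V (D.ex (D.L y))).comp (D.L : (ℝ × D.H) →L[ℝ] V)) y :=
    (D.hasFDeriv_ex (D.L y)).comp y D.L.hasFDerivAt
  have h2 := D.Tr.hasFDerivAt.comp y ((h1.const_mul v0).const_mul om)
  have h3 := h2.fderiv
  simp only [Function.comp_def] at h3
  unfold ph
  rw [h3]
  simp
  congr 1; ring

/-- second difference phase -/
def qh (v0 : V) (w : ((V × ℝ) × ℝ × D.H) × D.H) : ℝ :=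
  D.Tr (w.1.1.1 * (v0 * D.ex (D.L (w.1.1.2, w.2))) * ((w.1.2.2 : V) * D.E (w.1.2.1 • (w.1.2.2 : V))))

lemma qh_smooth (v0 : V) : ContDiff ℝ ∞ (D.qh v0) := by
  unfold qh
  apply D.Tr_smooth_mul
  have hsub : ContDiff ℝ ∞ (fun x : D.H => (x : V)) := D.H.subtypeL.contDiff
  have h1 : ContDiff ℝ ∞ (fun w : ((V × ℝ) × ℝ × D.H) × D.H => (w.1.2.2 : V)) :=
    hsub.comp (by fun_prop)
  have h2 : ContDiff ℝ ∞ (fun w : ((V × ℝ) × ℝ × D.H) × D.H => w.1.2.1) := by fun_prop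
  have h3 : ContDiff ℝ ∞ (fun w : ((V × ℝ) × ℝ × D.H) × D.H => w.1.1.1) := by fun_prop
  have h4 : ContDiff ℝ ∞ (fun w : ((V × ℝ) × ℝ × D.H) × D.H => (w.1.1.2, w.2)) := by fun_prop
  have h5 := D.exsm.comp (D.L.contDiff.comp h4)
  exact (h3.mul (contDiff_const.mul h5)).mul (h1.mul (D.Esm.comp (h2.smul h1)))

lemma qh_eq (v0 om : V) (s ρ : ℝ) (ν x : D.H) :
    D.ph v0 (om, (s, x + ρ • ν)) - D.ph v0 (om, (s, x)) = ρ * D.qh v0 (((om, s), ρ, ν), x) := by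
  have h1 : D.L (s, x + ρ • ν) = D.L (s, x) + ρ • (ν : V) := by simp [L_apply]; abel
  simp only [ph, qh]
  rw [h1, D.exadd, D.exE (ρ • (ν : V)), ← map_sub, ← smul_eq_mul (a := ρ), ← map_smul]
  congr 1
  simp only [Algebra.smul_def]
  ring

lemma pd_qh (v0 om : V) (s ρ : ℝ) (ν x h : D.H) :
    pd (D.qh v0) h (((om, s), ρ, ν), x) =
      D.Tr (om * (v0 * D.ex (D.L (s, x))) * (h : V) * ((ν : V) * D.E (ρ • (ν : V)))) := by
  rw [← hasFDeriv_slice (D.qh_smooth v0)]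
  have h0 : HasFDerivAt (fun x : D.H => D.L (s, x)) ((D.L : (ℝ × D.H) →L[ℝ] V).comp (ContinuousLinearMap.inr ℝ ℝ D.H)) x :=
    D.L.hasFDerivAt.comp x (hasFDerivAt_prodMk_right s x)
  have h1 := (D.hasFDeriv_ex (D.L (s, x))).comp x h0
  have h2 := D.Tr.hasFDerivAt.comp x (((h1.const_mul v0).const_mul om).mul_const ((ν : V) * D.E (ρ • (ν : V))))
  have h3 := h2.fderiv
  simp only [Function.comp_def] at h3
  simp only [qh]
  rw [h3]
  simp [L_apply]
  congr 1; ring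

end AD

end HF
end HFE


open Filter Topology
open scoped BigOperators

noncomputable section HFF

namespace HF

open MeasureTheory Set
open scoped ContDiff

section assoc
variable {Z H : Type*} [NormedAddCommGroup Z] [NormedSpace ℝ Z] [NormedAddCommGroup H] [NormedSpace ℝ H]

/-- reassociation -/
def asc : (Z × ℝ) × H ≃ₜ Z × (ℝ × H) := Homeomorph.prodAssoc Z ℝ H

lemma asc_smooth {F : Type*} [NormedAddCommGroup F] [NormedSpace ℝ F] {p : Z × (ℝ × H) → F}
    (hp : ContDiff ℝ ∞ p) :
    ContDiff ℝ ∞ (fun w : (Z × ℝ) × H => p (w.1.1, (w.1.2, w.2))) :=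
  hp.comp (by fun_prop)

lemma asc_hcs {A : Z × (ℝ × H) → ℂ} (hs : HasCompactSupport A) :
    HasCompactSupport (fun w : (Z × ℝ) × H => A (w.1.1, (w.1.2, w.2))) :=
  hs.comp_homeomorph (Homeomorph.prodAssoc Z ℝ H)

lemma asc_tsupport {A : Z × (ℝ × H) → ℂ} {w : (Z × ℝ) × H}
    (hw : w ∈ tsupport (fun w : (Z × ℝ) × H => A (w.1.1, (w.1.2, w.2)))) :
    (w.1.1, (w.1.2, w.2)) ∈ tsupport A :=
  tsupport_comp_subset_preimage A (f := Homeomorph.prodAssoc Z ℝ H)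
    (Homeomorph.prodAssoc Z ℝ H).continuous hw

lemma pd_asc {p : Z × (ℝ × H) → ℝ} (hp : ContDiff ℝ ∞ p) (h : H) (w : (Z × ℝ) × H) :
    pd (fun w : (Z × ℝ) × H => p (w.1.1, (w.1.2, w.2))) h w
      = pd p ((0 : ℝ), h) (w.1.1, (w.1.2, w.2)) := by
  obtain ⟨⟨z, s⟩, x⟩ := w
  rw [← hasFDeriv_slice (asc_smooth hp)]
  unfold pd
  have h1 : HasFDerivAt (fun x : H => (z, (s, x)))
      ((ContinuousLinearMap.inr ℝ Z (ℝ × H)).comp (ContinuousLinearMap.inr ℝ ℝ H)) x :=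
    (hasFDerivAt_prodMk_right z (s, x)).comp x (hasFDerivAt_prodMk_right s x)
  have h2 := ((hp.differentiable (by simp) (z, (s, x))).hasFDerivAt).comp x h1
  have h3 := h2.fderiv
  simp only [Function.comp_def] at h3
  simp only
  rw [h3]
  simp

end assoc

namespace AD

variable {V : Type*} [NormedCommRing V] [NormedAlgebra ℝ V] (D : AD V)
variable [FiniteDimensional ℝ V] [Nontrivial V]

/-- the class of good neighbourhoods -/
lemma critW {om0 v0 : V} (hom : om0 ≠ 0) (hv : IsUnit v0) (hc : ∃ c : ℝ, om0 * v0 = c • (1 : V)) :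
    ∃ W ∈ 𝓝 ((om0, (0 : ℝ × D.H))), (∀ w ∈ W, pd (D.ph v0) ((1 : ℝ), (0 : D.H)) w ≠ 0) ∧
      ∀ (om : V) (s ρ : ℝ) (ν x : D.H), 1 / 2 ≤ ‖ν‖ → ‖ν‖ ≤ 2 → (om, (s, x)) ∈ W →
        (om, (s, x + ρ • ν)) ∈ W → ∃ h : D.H, pd (D.qh v0) h (((om, s), ρ, ν), x) ≠ 0 := by
  obtain ⟨c, hc⟩ := hc
  have hc0 : c ≠ 0 := by
    rintro rfl
    rw [zero_smul] at hc
    exact hom ((hv.mul_left_eq_zero).1 hc)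
  have hT := D.Tr1_pos
  -- first condition
  have h1 : ∀ᶠ w in 𝓝 ((om0, (0 : ℝ × D.H))), pd (D.ph v0) ((1 : ℝ), (0 : D.H)) w ≠ 0 := by
    have hcont : Continuous (fun w => pd (D.ph v0) ((1 : ℝ), (0 : D.H)) w) :=
      (pd_smooth (D.ph_smooth v0) _).continuous
    apply hcont.continuousAt.eventually_ne
    rw [D.pd_ph]
    simp only [map_zero, D.ex0, mul_one, hc]
    simp [L_apply, hc0, hT.ne']
  -- second condition
  have stH : ∀ ν : D.H, D.Tr (D.st (ν : V)) = 0 := fun ν => by rw [D.Trst]; exact D.memH ν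
  let F : D.H → ((V × (ℝ × D.H)) × V) → ℝ := fun ν q =>
    D.Tr (q.1.1 * (v0 * D.ex (D.L q.1.2)) * (D.st (ν : V)) * ((ν : V) * D.E q.2))
  have hF : Continuous (fun q : D.H × ((V × (ℝ × D.H)) × V) => F q.1 q.2) := by
    have e1 := D.exsm.continuous
    have e2 := D.Esm.continuous
    have e3 := D.L.continuous
    have e4 := D.st.continuous
    have e5 := D.Tr.continuous
    fun_prop
  have hK : IsCompact {ν : D.H | 1 / 2 ≤ ‖ν‖ ∧ ‖ν‖ ≤ 2} := by
    apply Metric.isCompact_of_isClosed_isBounded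
    · exact (isClosed_le continuous_const continuous_norm).inter
        (isClosed_le continuous_norm continuous_const)
    · exact (Metric.isBounded_closedBall (x := (0 : D.H)) (r := 2)).subset
        (fun ν hν => by simpa using hν.2)
  have h2 : ∀ᶠ q in 𝓝 (((om0, (0 : ℝ × D.H)), (0 : V))),
      ∀ ν ∈ {ν : D.H | 1 / 2 ≤ ‖ν‖ ∧ ‖ν‖ ≤ 2}, F ν q ≠ 0 := by
    apply hK.eventually_forall_of_forall_eventually
    intro ν hν
    have hne : F ν ((om0, (0 : ℝ × D.H)), (0 : V)) ≠ 0 := by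
      have hν0 : (ν : V) ≠ 0 := by
        intro h0
        have : ν = 0 := Subtype.ext h0
        rw [this] at hν
        have := hν.1
        norm_num at this
      have : F ν ((om0, (0 : ℝ × D.H)), (0 : V)) = c * D.Tr ((ν : V) * D.st ν) := by
        simp only [F, map_zero, D.ex0, mul_one, hc, D.E0]
        rw [smul_mul_assoc, one_mul, smul_mul_assoc, map_smul, smul_eq_mul, mul_comm (D.st _)]
      rw [this]
      exact mul_ne_zero hc0 (D.pos _ hν0).ne'
    have := hF.continuousAt.eventually_ne (x := (ν, ((om0, (0 : ℝ × D.H)), (0 : V)))) hne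
    have h3 := (continuous_swap.tendsto (((om0, (0 : ℝ × D.H)), (0 : V)), ν)).eventually this
    simpa [nhds_prod_eq] using h3
  rw [nhds_prod_eq, eventually_prod_iff] at h2
  obtain ⟨pa, hpa, pb, hpb, hab⟩ := h2
  obtain ⟨ε, hε, hball⟩ := Metric.eventually_nhds_iff.1 hpb
  have h3 : ∀ᶠ w in 𝓝 ((om0, (0 : ℝ × D.H))), ‖w.2.2‖ < ε / 2 := by
    have hcont : Continuous (fun w : V × (ℝ × D.H) => ‖w.2.2‖) := by fun_prop
    have := hcont.continuousAt (x := ((om0, (0 : ℝ × D.H))))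
    apply this.eventually_lt_const
    simpa using by positivity
  refine ⟨_, (h1.and (hpa.and h3)), fun w hw => hw.1, ?_⟩
  intro om s ρ ν x hν1 hν2 hx hx'
  refine ⟨⟨D.st ν, stH ν⟩, ?_⟩
  rw [D.pd_qh]
  refine hab hx.2.1 (hball ?_) ν ⟨hν1, hν2⟩
  have a1 := hx.2.2
  have a2 := hx'.2.2
  simp only at a1 a2
  have e : ρ • (ν : V) = (((x + ρ • ν) - x : D.H) : V) := by simp
  rw [dist_zero_right, e]
  calc ‖(((x + ρ • ν) - x : D.H) : V)‖ = ‖(x + ρ • ν) - x‖ := rfl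
    _ ≤ ‖x + ρ • ν‖ + ‖x‖ := norm_sub_le _ _
    _ < ε := by linarith

lemma locW [MeasurableSpace V] [BorelSpace V] (μ : Measure D.H) [μ.IsAddHaarMeasure] (c : ℝ)
    {om0 v0 : V} (hom : om0 ≠ 0) (hv : IsUnit v0) (k : ℕ) :
    ∃ W ∈ 𝓝 ((om0, (0 : ℝ × D.H))), ∀ A : V × (ℝ × D.H) → ℂ, ContDiff ℝ ∞ A →
      HasCompactSupport A → tsupport A ⊆ W →
      ∃ C : ℝ, 0 ≤ C ∧ ∀ g : ℝ → ℝ, ContDiff ℝ ∞ g → HasCompactSupport g → ∀ z (l : ℝ), 1 ≤ l →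
        ‖oI μ c (D.Tr 1) (D.ph v0) A g z l‖ ≤
          C * gnorm k g * l ^ (-(k + (Module.finrank ℝ D.H : ℝ) / 2)) := by
  set m := Module.finrank ℝ D.H with hm
  have hn := D.Tr1_pos
  by_cases hcr : ∀ h : V, D.Tr h = 0 → D.Tr (om0 * v0 * h) = 0
  · obtain ⟨W, hW, hW1, hW2⟩ := D.critW hom hv (D.crit_scalar _ hcr)
    refine ⟨W, hW, fun A hA hs hAW => ?_⟩
    refine oI_crit μ hn (D.ph_smooth v0) (K0 := tsupport A) hs (r := (m : ℝ) / 2) ?_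
      (fun w hw => hW1 w (hAW hw)) k A hA subset_rfl
    intro B hB hBA
    have hBs : HasCompactSupport B := hs.of_isClosed_subset (isClosed_tsupport _) hBA
    obtain ⟨C, hC, h⟩ := tt μ (asc_smooth hB) (asc_hcs hBs) (asc_smooth (D.ph_smooth v0))
      (D.qh_smooth v0) (fun z ρ ν x => D.qh_eq v0 z.1 z.2 ρ ν x) (by
        intro z ρ ν x h1 h2 h3 h4
        exact hW2 z.1 z.2 ρ ν x h1 h2 (hAW (hBA (asc_tsupport h3)))
          (hAW (hBA (asc_tsupport h4))))
    refine ⟨√C, by positivity, fun z s l hl => ?_⟩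
    have := h (z, s) l (by linarith)
    have hl0 : 0 < l := by linarith
    refine (sq_le_sq₀ (norm_nonneg _) (by positivity)).1 (this.trans_eq ?_)
    rw [mul_pow, Real.sq_sqrt hC, ← Real.rpow_natCast (l ^ (-((m : ℝ) / 2))) 2,
      ← Real.rpow_mul hl0.le, ← Real.rpow_natCast l, ← Real.rpow_neg hl0.le]
    congr 2; push_cast; ring
  · push Not at hcr
    obtain ⟨h, hh, hne⟩ := hcr
    let h' : D.H := ⟨h, hh⟩
    refine ⟨{w | pd (D.ph v0) ((0 : ℝ), h') w ≠ 0}, ?_, fun A hA hs hAW => ?_⟩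
    · have hcont : Continuous (fun w => pd (D.ph v0) ((0 : ℝ), h') w) :=
        (pd_smooth (D.ph_smooth v0) _).continuous
      apply hcont.continuousAt.eventually_ne
      rw [D.pd_ph]
      simpa [D.ex0, L_apply] using hne
    · obtain ⟨C, hC, hb⟩ := nonstat μ (asc_smooth (D.ph_smooth v0)) (k + m) (asc_smooth hA)
        (asc_hcs hs) (fun w hw => ⟨h', by
          rw [pd_asc (D.ph_smooth v0)]
          exact hAW (asc_tsupport hw)⟩)
      refine ⟨(D.Tr 1)⁻¹ * C, by positivity, fun g hg hgs z l hl => ?_⟩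
      have := oI_base μ (c := c) hn (D.ph_smooth v0).continuous hA.continuous hs
        (B := fun l => C * (l ^ (k + m))⁻¹) (fun z s l hl => hb (z, s) l (by linarith))
        hg.continuous hgs z hl
      refine this.trans ?_
      have hl0 : 0 < l := by linarith
      have e1 : (∫ y, |g y|) ≤ gnorm k g := by
        have := gnorm_mono (Nat.zero_le k) g
        simpa [gnorm] using this
      have e2 : (l ^ (k + m))⁻¹ ≤ l ^ (-(k + (m : ℝ) / 2)) := by
        rw [← Real.rpow_natCast, ← Real.rpow_neg hl0.le]
        apply Real.rpow_le_rpow_of_exponent_le hl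
        push_cast
        have : (0 : ℝ) ≤ m := by positivity
        linarith
      have e3 : 0 ≤ ∫ y, |g y| := integral_nonneg fun _ => abs_nonneg _
      calc _ ≤ (D.Tr 1)⁻¹ * (C * l ^ (-(k + (m : ℝ) / 2))) * gnorm k g := by gcongr
        _ = _ := by ring

end AD

end HF
end HFF


open Filter Topology
open scoped BigOperators

noncomputable section HFG

namespace HF

open MeasureTheory Set
open scoped ContDiff

namespace AD

variable {V : Type*} [NormedCommRing V] [NormedAlgebra ℝ V] (D : AD V)

lemma ex_unit (y : V) : IsUnit (D.ex y) := by
  apply IsUnit.of_mul_eq_one (D.ex (-y))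
  rw [← D.exadd]; simp [D.ex0]

variable [FiniteDimensional ℝ V] [Nontrivial V]

/-- Multiplication by a unit as a continuous linear equivalence -/
def mulE {v : V} (hv : IsUnit v) : V ≃L[ℝ] V :=
  LinearEquiv.toContinuousLinearEquiv
    (LinearEquiv.ofBijective (LinearMap.mul ℝ V v) (by
      constructor
      · intro a b h; exact hv.mul_left_cancel h
      · intro b
        obtain ⟨u, rfl⟩ := hv
        exact ⟨↑u⁻¹ * b, by simp⟩))

lemma mulE_coe {v : V} (hv : IsUnit v) :
    (mulE hv : V →L[ℝ] V) = ContinuousLinearMap.mul ℝ V v := by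
  ext x; rfl

lemma det_ne {v : V} (hv : IsUnit v) : (ContinuousLinearMap.mul ℝ V v).det ≠ 0 := by
  rw [← mulE_coe hv]
  exact ((mulE hv).toLinearEquiv.isUnit_det' ).ne_zero

lemma det_mul' (a b : V) : (ContinuousLinearMap.mul ℝ V (a * b)).det =
    (ContinuousLinearMap.mul ℝ V a).det * (ContinuousLinearMap.mul ℝ V b).det := by
  have : ContinuousLinearMap.mul ℝ V (a * b) =
      (ContinuousLinearMap.mul ℝ V a).comp (ContinuousLinearMap.mul ℝ V b) := by
    ext x; simp [mul_assoc]
  rw [this]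
  simp only [ContinuousLinearMap.det]
  exact LinearMap.det_comp _ _

lemma J_smooth (v0 : V) (hv : IsUnit v0) :
    ContDiff ℝ ∞ (fun y => |(ContinuousLinearMap.mul ℝ V (v0 * D.ex y)).det|) := by
  let f : V →+ ℝ :=
    { toFun := fun y => Real.log |(ContinuousLinearMap.mul ℝ V (D.ex y)).det|
      map_zero' := by
        rw [D.ex0]
        have : ContinuousLinearMap.mul ℝ V 1 = ContinuousLinearMap.id ℝ V := by ext x; simp
        rw [this]; simp [ContinuousLinearMap.det]
      map_add' := fun x y => by
        rw [D.exadd, det_mul', abs_mul, Real.log_mul]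
        · exact abs_ne_zero.2 (det_ne (D.ex_unit x))
        · exact abs_ne_zero.2 (det_ne (D.ex_unit y)) }
  have hc : Continuous f := by
    have h1 : Continuous (fun y => |(ContinuousLinearMap.mul ℝ V (D.ex y)).det|) :=
      (ContinuousLinearMap.continuous_det.comp
        ((ContinuousLinearMap.mul ℝ V).continuous.comp D.exsm.continuous)).abs
    exact h1.log (fun y => abs_ne_zero.2 (det_ne (D.ex_unit y)))
  have : (fun y => |(ContinuousLinearMap.mul ℝ V (v0 * D.ex y)).det|) =
      fun y => |(ContinuousLinearMap.mul ℝ V v0).det| * Real.exp ((f.toRealLinearMap hc) y) := by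
    funext y
    rw [det_mul', abs_mul]
    congr 1
    change _ = Real.exp (Real.log _)
    rw [Real.exp_log (abs_pos.2 (det_ne (D.ex_unit y)))]
  rw [this]
  exact contDiff_const.mul (Real.contDiff_exp.comp (ContinuousLinearMap.contDiff _))

variable [MeasurableSpace V] [BorelSpace V] (ν : Measure V) [ν.IsAddHaarMeasure]

/-- the Fourier-type integral -/
def fI (A : V × V → ℂ) (g : ℝ → ℝ) (z : V) (l : ℝ) : ℂ :=
  ∫ v, ((g (Real.log (D.Nm v)) : ℝ) * A (z, v)) * ep l (D.Tr (z * v)) ∂ν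

lemma haar_L : ∃ c : ℝ, ∀ G : V → ℂ, ∫ v, G v ∂ν =
    c * ∫ w : ℝ × D.H, G (D.L w) ∂(volume.prod (Measure.addHaar : Measure D.H)) := by
  set μ := ((volume : Measure ℝ).prod (Measure.addHaar : Measure D.H))
  have h1 : (μ.map D.L).IsAddHaarMeasure := D.L.isAddHaarMeasure_map μ
  have h2 := Measure.isAddLeftInvariant_eq_smul ν (μ.map D.L)
  obtain ⟨c, hc⟩ : ∃ c : NNReal, ν = c • μ.map D.L := ⟨_, h2⟩
  refine ⟨c, fun G => ?_⟩
  have h3 : ∫ v, G v ∂(μ.map D.L) = ∫ w, G (D.L w) ∂μ :=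
    D.L.toHomeomorph.isClosedEmbedding.measurableEmbedding.integral_map G
  rw [hc, integral_smul_nnreal_measure, h3]
  rfl

lemma locV {om0 v0 : V} (hom : om0 ≠ 0) (hv : D.Nm v0 ≠ 0) (k : ℕ) :
    ∃ W ∈ 𝓝 ((om0, v0)), ∀ A : V × V → ℂ, ContDiff ℝ ∞ A →
      tsupport A ⊆ W →
      ∃ C : ℝ, 0 ≤ C ∧ ∀ g : ℝ → ℝ, ContDiff ℝ ∞ g → HasCompactSupport g → ∀ z (l : ℝ), 1 ≤ l →
        ‖D.fI ν A g z l‖ ≤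
          C * gnorm k g * l ^ (-(k + (Module.finrank ℝ D.H : ℝ) / 2)) := by
  have hu := D.Nmunit v0 hv
  obtain ⟨W0, hW0, hW0A⟩ := D.locW (Measure.addHaar : Measure D.H) (Real.log (D.Nm v0)) hom hu k
  obtain ⟨c, hc⟩ := D.haar_L ν
  let Φ : ℝ × D.H → V := fun w => v0 * D.ex (D.L w)
  have hΦs : ContDiff ℝ ∞ Φ := contDiff_const.mul (D.exsm.comp D.L.contDiff)
  have hd : HasStrictFDerivAt Φ (((D.L).trans (mulE hu) : (ℝ × D.H) ≃L[ℝ] V) : (ℝ × D.H) →L[ℝ] V) 0 := by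
    have h1 : HasFDerivAt (fun y => D.ex (D.L y)) ((ContinuousLinearMap.mul ℝ V (D.ex (D.L 0))).comp (D.L : (ℝ × D.H) →L[ℝ] V)) 0 :=
      (D.hasFDeriv_ex (D.L 0)).comp 0 D.L.hasFDerivAt
    have h2 : HasFDerivAt Φ _ 0 := h1.const_mul v0
    have h3 := hΦs.contDiffAt.hasStrictFDerivAt' h2 (by simp)
    have heq : (((D.L).trans (mulE hu) : (ℝ × D.H) ≃L[ℝ] V) : (ℝ × D.H) →L[ℝ] V) =
        v0 • (ContinuousLinearMap.mul ℝ V (D.ex (D.L 0))).comp (D.L : (ℝ × D.H) →L[ℝ] V) := by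
      refine ContinuousLinearMap.ext fun w => ?_
      simp only [map_zero, D.ex0]
      change v0 * D.L w = v0 * (1 * D.L w)
      rw [one_mul]
    rw [heq]; exact h3
  -- radius
  have hsrc : ∀ᶠ w in 𝓝 (0 : ℝ × D.H), w ∈ (hd.toOpenPartialHomeomorph Φ).source :=
    (hd.toOpenPartialHomeomorph Φ).open_source.mem_nhds hd.mem_toOpenPartialHomeomorph_source
  have hinj0 : InjOn Φ (hd.toOpenPartialHomeomorph Φ).source :=
    (hd.toOpenPartialHomeomorph Φ).injOn
  obtain ⟨r0, hr0, hb0⟩ := Metric.nhds_basis_closedBall.mem_iff.1 hsrc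
  obtain ⟨r1, hr1, hb1⟩ := Metric.nhds_basis_closedBall.mem_iff.1 hW0
  rw [← closedBall_prod_same] at hb1
  set r := min r0 r1 with hr
  have hrpos : 0 < r := lt_min hr0 hr1
  have hinj : InjOn Φ (Metric.closedBall 0 r) := hinj0.mono
    ((Metric.closedBall_subset_closedBall (min_le_left _ _)).trans hb0)
  obtain ⟨χ, hχ, hχc, hχ1, hχt⟩ := exists_shell_cutoff (ℝ × D.H)
    (s := Metric.closedBall 0 (r / 2)) (t := Metric.closedBall 0 r) Metric.isClosed_closedBall
    ((Metric.closedBall_subset_ball (by linarith)).trans Metric.ball_subset_interior_closedBall)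
    (isCompact_closedBall _ _)
  have hΦ0 : Φ 0 = v0 := by simp [Φ, D.ex0]
  refine ⟨Metric.closedBall om0 r1 ×ˢ (Φ '' Metric.closedBall 0 (r / 2)), ?_, ?_⟩
  · apply prod_mem_nhds (Metric.closedBall_mem_nhds _ hr1)
    rw [← hΦ0, ← hd.map_nhds_eq_of_equiv]
    exact image_mem_map (Metric.closedBall_mem_nhds _ (by positivity))
  intro A hA hAt
  have hA0 : ∀ z v, A (z, v) ≠ 0 → z ∈ Metric.closedBall om0 r1 ∧ v ∈ Φ '' Metric.closedBall 0 (r / 2) :=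
    fun z v h => hAt (subset_tsupport _ h)
  let J : V → ℝ := fun y => |(ContinuousLinearMap.mul ℝ V (v0 * D.ex y)).det|
  let B : V × (ℝ × D.H) → ℂ := fun w => ((χ w.2 * J (D.L w.2) : ℝ) : ℂ) * A (w.1, Φ w.2)
  have hBs : ContDiff ℝ ∞ B := by
    have h1 : ContDiff ℝ ∞ (fun w : V × (ℝ × D.H) => χ w.2 * J (D.L w.2)) :=
      (hχ.comp contDiff_snd).mul ((D.J_smooth v0 hu).comp (D.L.contDiff.comp contDiff_snd))
    have h2 : ContDiff ℝ ∞ (fun w : V × (ℝ × D.H) => A (w.1, Φ w.2)) :=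
      hA.comp (contDiff_fst.prodMk (hΦs.comp contDiff_snd))
    exact (Complex.ofRealCLM.contDiff.comp h1).mul h2
  have hBK : tsupport B ⊆ Metric.closedBall om0 r1 ×ˢ Metric.closedBall 0 r := by
    apply closure_minimal _ (Metric.isClosed_closedBall.prod Metric.isClosed_closedBall)
    intro w hw
    have hw' : B w ≠ 0 := hw
    simp only [B] at hw'
    have h1 := right_ne_zero_of_mul hw'
    have h2 : χ w.2 ≠ 0 := by
      intro h0; apply hw'; simp [h0]
    exact ⟨(hA0 _ _ h1).1, hχt (subset_tsupport _ h2)⟩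
  have hBc : HasCompactSupport B :=
    ((isCompact_closedBall _ _).prod (isCompact_closedBall _ _)).of_isClosed_subset
      (isClosed_tsupport _) hBK
  obtain ⟨C, hC, hb⟩ := hW0A B hBs hBc (hBK.trans ((Set.prod_mono subset_rfl
    (Metric.closedBall_subset_closedBall (min_le_right _ _))).trans hb1))
  refine ⟨|c| * C, by positivity, fun g hg hgs z l hl => ?_⟩
  have key : D.fI ν A g z l = c * oI (Measure.addHaar : Measure D.H) (Real.log (D.Nm v0)) (D.Tr 1) (D.ph v0) B g z l := by
    set F : V → ℂ := fun v => ((g (Real.log (D.Nm v)) : ℝ) * A (z, v)) * ep l (D.Tr (z * v)) with hF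
    have hF0 : ∀ v, v ∉ Φ '' Metric.closedBall 0 (r / 2) → F v = 0 := by
      intro v hv
      have : A (z, v) = 0 := by
        by_contra h; exact hv (hA0 _ _ h).2
      simp [hF, this]
    set S : Set V := D.L '' Metric.closedBall 0 (r / 2) with hS
    have hSm : MeasurableSet S := ((isCompact_closedBall _ _).image D.L.continuous).measurableSet
    have hΨ : (fun y => v0 * D.ex y) '' S = Φ '' Metric.closedBall 0 (r / 2) := by
      rw [hS, image_image]
    have e1 : D.fI ν A g z l = ∫ v in (fun y => v0 * D.ex y) '' S, F v ∂ν := by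
      rw [setIntegral_eq_integral_of_forall_compl_eq_zero]
      · rfl
      · intro v hv; rw [hΨ] at hv; exact hF0 v hv
    have hSinj : InjOn (fun y => v0 * D.ex y) S := by
      rintro _ ⟨a, ha, rfl⟩ _ ⟨b, hb, rfl⟩ hab
      have hh := Metric.closedBall_subset_closedBall (x := (0 : ℝ × D.H)) (show r / 2 ≤ r by linarith)
      rw [hinj (hh ha) (hh hb) hab]
    have e2 := integral_image_eq_integral_abs_det_fderiv_smul ν hSm
      (f := fun y => v0 * D.ex y) (f' := fun y => ContinuousLinearMap.mul ℝ V (v0 * D.ex y))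
      (fun y _ => by
        have := ((D.hasFDeriv_ex y).const_mul v0).hasFDerivWithinAt (s := S)
        refine this.congr_fderiv ?_
        ext h; simp [mul_assoc]) hSinj F
    rw [e1, e2, ← integral_indicator hSm, hc]
    unfold oI
    congr 1
    apply integral_congr_ae
    refine Eventually.of_forall fun w => ?_
    have hN : Real.log (D.Nm (Φ w)) = Real.log (D.Nm v0) + D.Tr 1 * w.1 := by
      simp only [Φ]
      rw [D.Nmex, Real.log_mul hv (Real.exp_pos _).ne', Real.log_exp, D.Tr_L]; ring
    by_cases hw : w ∈ Metric.closedBall (0 : ℝ × D.H) (r / 2)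
    · have : D.L w ∈ S := ⟨w, hw, rfl⟩
      simp only [indicator_of_mem this, hF, B, hχ1 w hw]
      change (J (D.L w)) • (((g (Real.log (D.Nm (Φ w))) : ℝ) * A (z, Φ w)) * ep l (D.ph v0 (z, w))) = _
      rw [hN, Complex.real_smul]
      push_cast; ring
    · have h1 : D.L w ∉ S := by
        rintro ⟨a, ha, hab⟩
        rw [D.L.injective hab] at ha; exact hw ha
      simp only [indicator_of_notMem h1]
      symm
      by_cases h2 : χ w = 0
      · simp [B, h2]
      · have h3 : A (z, Φ w) = 0 := by
          by_contra h
          obtain ⟨a, ha, hab⟩ := (hA0 _ _ h).2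
          have hh := Metric.closedBall_subset_closedBall (x := (0 : ℝ × D.H)) (show r / 2 ≤ r by linarith)
          have := hinj (hh ha) (hχt (subset_tsupport _ h2)) hab
          exact hw (this ▸ ha)
        simp [B, h3]
  rw [key, norm_mul, Complex.norm_real, Real.norm_eq_abs, mul_assoc, mul_assoc]
  refine mul_le_mul_of_nonneg_left ?_ (abs_nonneg _)
  have := hb g hg hgs z l hl
  linarith [this]

lemma fI_integrable {A : V × V → ℂ} (hA : Continuous A) (hs : HasCompactSupport A) {g : ℝ → ℝ}
    (hg : Continuous g) (hgs : HasCompactSupport g) (z : V) (l : ℝ) :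
    Integrable (fun v => ((g (Real.log (D.Nm v)) : ℝ) * A (z, v)) * ep l (D.Tr (z * v))) ν := by
  have h1 : Integrable (fun v => A (z, v) * ep l (D.Tr (z * v))) ν := by
    apply Continuous.integrable_of_hasCompactSupport
    · have := D.Tr.continuous
      unfold ep; fun_prop
    · exact (slice_hcs hs z).mul_right
  obtain ⟨M, hM⟩ := hg.bounded_above_of_compact_support hgs
  have hm : AEStronglyMeasurable (fun v => ((g (Real.log (D.Nm v)) : ℝ) : ℂ)) ν := by
    apply Measurable.aestronglyMeasurable
    exact Complex.measurable_ofReal.comp (hg.measurable.comp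
      (Real.measurable_log.comp D.Nmc.measurable))
  have := h1.bdd_mul hm (c := M) (Eventually.of_forall fun v => by
    rw [Complex.norm_real]; exact hM _)
  simpa only [mul_assoc] using this

theorem FT {A : V × V → ℂ} (hA : ContDiff ℝ ∞ A) (hs : HasCompactSupport A)
    (hsup : ∀ w ∈ tsupport A, w.1 ≠ 0 ∧ D.Nm w.2 ≠ 0) (k : ℕ) :
    ∃ C : ℝ, 0 ≤ C ∧ ∀ g : ℝ → ℝ, ContDiff ℝ ∞ g → HasCompactSupport g → ∀ z (l : ℝ), 1 ≤ l →
      ‖D.fI ν A g z l‖ ≤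
        C * gnorm k g * l ^ (-(k + (Module.finrank ℝ D.H : ℝ) / 2)) := by
  have hloc : ∀ w ∈ tsupport A, ∃ W ∈ 𝓝 w, ∀ A : V × V → ℂ, ContDiff ℝ ∞ A → tsupport A ⊆ W →
      ∃ C : ℝ, 0 ≤ C ∧ ∀ g : ℝ → ℝ, ContDiff ℝ ∞ g → HasCompactSupport g → ∀ z (l : ℝ), 1 ≤ l →
        ‖D.fI ν A g z l‖ ≤
          C * gnorm k g * l ^ (-(k + (Module.finrank ℝ D.H : ℝ) / 2)) :=
    fun w hw => D.locV ν (hsup w hw).1 (hsup w hw).2 k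
  choose! W hW hWA using hloc
  obtain ⟨t, htK, ht⟩ := hs.elim_nhds_subcover (fun w => interior (W w))
    (fun w hw => interior_mem_nhds.2 (hW w hw))
  obtain ⟨f, hf⟩ := SmoothPartitionOfUnity.exists_isSubordinate (modelWithCornersSelf ℝ (V × V))
    (isClosed_tsupport A) (fun i : t => interior (W i)) (fun i => isOpen_interior) (by
      intro w hw
      obtain ⟨i, hi, hwi⟩ := mem_iUnion₂.1 (ht hw)
      exact mem_iUnion.2 ⟨⟨i, hi⟩, hwi⟩)
  have hfs : ∀ i, ContDiff ℝ ∞ (f i) := fun i => (f i).contMDiff.contDiff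
  let B : t → V × V → ℂ := fun i w => ((f i w : ℝ) : ℂ) * A w
  have hBs : ∀ i, ContDiff ℝ ∞ (B i) := fun i => (Complex.ofRealCLM.contDiff.comp (hfs i)).mul hA
  have hBc : ∀ i, HasCompactSupport (B i) := fun i => hs.mul_left
  have hBt : ∀ i, tsupport (B i) ⊆ W i := by
    intro i
    refine Subset.trans ?_ ((hf i).trans interior_subset)
    apply closure_mono
    intro w hw h0
    apply hw
    simp [B, h0]
  choose C hC hb using fun i : t => hWA i (htK i i.2) (B i) (hBs i) (hBt i)
  refine ⟨∑ i, C i, Finset.sum_nonneg fun i _ => hC i, fun g hg hgs z l hl => ?_⟩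
  have hsum : ∀ w, A w = ∑ i, B i w := by
    intro w
    by_cases hw : w ∈ tsupport A
    · have := f.sum_eq_one hw
      rw [finsum_eq_sum_of_fintype] at this
      simp only [B]
      rw [← Finset.sum_mul, ← Complex.ofReal_sum, this]; simp
    · have : A w = 0 := image_eq_zero_of_notMem_tsupport hw
      simp [B, this]
  have e : D.fI ν A g z l = ∑ i, D.fI ν (B i) g z l := by
    unfold fI
    rw [← integral_finsetSum _ (fun i _ => D.fI_integrable ν (hBs i).continuous (hBc i) hg.continuous hgs z l)]
    congr 1; funext v
    rw [hsum, Finset.mul_sum, Finset.sum_mul]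
  rw [e, Finset.sum_mul, Finset.sum_mul]
  exact (norm_sum_le _ _).trans (Finset.sum_le_sum fun i _ => hb i g hg hgs z l hl)

end AD

end HF
end HFG


open Filter Topology
open scoped BigOperators

noncomputable section HFH

namespace HF

open MeasureTheory Set
open scoped ContDiff

section layer
variable {S : Type*} {w : S → ℝ} {C β : ℝ}

lemma pow_int {a u T : ℝ} (hu : 0 < u) (huT : u ≤ T) :
    ∫ t in u..T, a * t ^ (-a - 1) = u ^ (-a) - T ^ (-a) := by
  have h1 : ∀ t ∈ uIcc u T, HasDerivAt (fun t => - t ^ (-a)) (a * t ^ (-a - 1)) t := by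
    intro t ht
    rw [uIcc_of_le huT] at ht
    have := (Real.hasDerivAt_rpow_const (p := -a) (Or.inl (show t ≠ 0 by linarith [ht.1]))).neg
    refine this.congr_deriv ?_; ring
  rw [intervalIntegral.integral_eq_sub_of_hasDerivAt h1]
  · ring
  · apply ContinuousOn.intervalIntegrable
    rw [uIcc_of_le huT]
    intro t ht
    apply ContinuousAt.continuousWithinAt
    exact continuousAt_const.mul (Real.continuousAt_rpow_const _ _ (Or.inl (by linarith [ht.1])))

lemma layer_core (hC : 0 ≤ C) {a T0 T : ℝ} (ha : 0 ≤ a) (hT0 : 1 ≤ T0) (hT : T0 ≤ T)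
    (s : Finset S) (hsT0 : ∀ x ∈ s, T0 ≤ w x) (hsT : ∀ x ∈ s, w x ≤ T)
    (hN : ∀ t : ℝ, 1 ≤ t → ((s.filter (fun x => w x ≤ t)).card : ℝ) ≤ C * t ^ β) :
    ∑ x ∈ s, (w x) ^ (-a) ≤ C * T ^ (β - a) + a * C * ∫ t in T0..T, t ^ (β - a - 1) := by
  have hT0' : 0 < T0 := by linarith
  have hTpos : 0 < T := by linarith
  have hInteg : ∀ c : ℝ, IntegrableOn (fun t : ℝ => t ^ c) (Ioc T0 T) := by
    intro c
    rw [← intervalIntegrable_iff_integrableOn_Ioc_of_le hT]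
    apply ContinuousOn.intervalIntegrable
    rw [uIcc_of_le hT]
    intro t ht
    exact (Real.continuousAt_rpow_const _ _ (Or.inl (by linarith [ht.1]))).continuousWithinAt
  have e1 : ∀ x ∈ s, (w x) ^ (-a) = T ^ (-a) +
      ∫ t in Ioc T0 T, (Ioc (w x) T).indicator (fun t => a * t ^ (-a - 1)) t := by
    intro x hx
    have h1 := hsT0 x hx
    have h2 := hsT x hx
    rw [setIntegral_indicator measurableSet_Ioc, Ioc_inter_Ioc, sup_eq_right.2 h1, inf_idem,
      ← intervalIntegral.integral_of_le h2, pow_int (by linarith) h2]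
    ring
  rw [Finset.sum_congr rfl e1, Finset.sum_add_distrib, Finset.sum_const, nsmul_eq_mul]
  have hi : ∀ x ∈ s, IntegrableOn ((Ioc (w x) T).indicator (fun t => a * t ^ (-a - 1))) (Ioc T0 T) :=
    fun x _ => ((hInteg _).const_mul a).indicator measurableSet_Ioc
  rw [← integral_finsetSum _ hi, intervalIntegral.integral_of_le hT, ← integral_const_mul]
  apply add_le_add
  · have h1 := hN T (by linarith)
    rw [Finset.filter_true_of_mem hsT] at h1
    calc (s.card : ℝ) * T ^ (-a) ≤ C * T ^ β * T ^ (-a) := by gcongr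
      _ = _ := by rw [mul_assoc, ← Real.rpow_add hTpos]; rfl
  · apply setIntegral_mono_on
    · exact integrable_finsetSum _ hi
    · exact (hInteg _).const_mul _
    · exact measurableSet_Ioc
    · intro t ht
      have ht0 : 0 < t := by linarith [ht.1]
      have h1 := hN t (by linarith [ht.1])
      calc ∑ x ∈ s, (Ioc (w x) T).indicator (fun t => a * t ^ (-a - 1)) t
          ≤ ∑ x ∈ s, (if w x ≤ t then a * t ^ (-a - 1) else 0) := by
            apply Finset.sum_le_sum
            intro x hx
            by_cases h : w x ≤ t
            · rw [if_pos h]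
              apply indicator_apply_le'
              · intro _; exact le_rfl
              · intro _; positivity
            · rw [if_neg h, indicator_of_notMem]
              intro h'; exact h h'.1.le
        _ = (s.filter (fun x => w x ≤ t)).card * (a * t ^ (-a - 1)) := by
            rw [← Finset.sum_filter, Finset.sum_const, nsmul_eq_mul]
        _ ≤ C * t ^ β * (a * t ^ (-a - 1)) := by gcongr
        _ = a * C * (t ^ β * t ^ (-a - 1)) := by ring
        _ = a * C * t ^ (β - a - 1) := by
            rw [← Real.rpow_add ht0]; congr 2; ring

lemma int_pow' {e T0 T : ℝ} (hT0 : 0 < T0) (hT : T0 ≤ T) (he : e ≠ 0) :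
    ∫ t in T0..T, t ^ (e - 1) = (T ^ e - T0 ^ e) / e := by
  rw [integral_rpow]
  · simp
  · right
    refine ⟨by intro h; apply he; linarith, ?_⟩
    rw [uIcc_of_le hT]; intro h; linarith [h.1]

/-- head sum, `a < β` -/
lemma layer_head (hC : 0 ≤ C) {a T : ℝ} (ha : 0 ≤ a) (hT : 1 ≤ T) (hab : a < β)
    (s : Finset S) (hsT0 : ∀ x ∈ s, 1 ≤ w x) (hsT : ∀ x ∈ s, w x ≤ T)
    (hN : ∀ t : ℝ, 1 ≤ t → ((s.filter (fun x => w x ≤ t)).card : ℝ) ≤ C * t ^ β) :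
    ∑ x ∈ s, (w x) ^ (-a) ≤ (C + a * C / (β - a)) * T ^ (β - a) := by
  refine (layer_core hC ha le_rfl hT s hsT0 hsT hN).trans ?_
  have hd : 0 < β - a := by linarith
  rw [int_pow' one_pos hT hd.ne', Real.one_rpow, add_mul]
  refine add_le_add le_rfl ?_
  have : (T ^ (β - a) - 1) / (β - a) ≤ T ^ (β - a) / (β - a) := by gcongr; linarith
  calc _ ≤ a * C * (T ^ (β - a) / (β - a)) := by gcongr
    _ = _ := by ring

/-- head sum, `a = β` -/
lemma layer_log (hC : 0 ≤ C) {a T : ℝ} (ha : 0 ≤ a) (hT : 1 ≤ T) (hab : a = β)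
    (s : Finset S) (hsT0 : ∀ x ∈ s, 1 ≤ w x) (hsT : ∀ x ∈ s, w x ≤ T)
    (hN : ∀ t : ℝ, 1 ≤ t → ((s.filter (fun x => w x ≤ t)).card : ℝ) ≤ C * t ^ β) :
    ∑ x ∈ s, (w x) ^ (-a) ≤ C + a * C * Real.log T := by
  refine (layer_core hC ha le_rfl hT s hsT0 hsT hN).trans ?_
  subst hab
  have : ∀ t : ℝ, t ^ (a - a - 1) = t⁻¹ := fun t => by
    rw [sub_self, zero_sub, Real.rpow_neg_one]
  simp_rw [this]
  rw [integral_inv_of_pos one_pos (by linarith)]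
  simp

/-- tail sum, `a > β` -/
lemma layer_tail (hC : 0 ≤ C) {a T : ℝ} (ha : 0 ≤ a) (hT : 1 ≤ T) (hab : β < a)
    (s : Finset S) (hsT0 : ∀ x ∈ s, T ≤ w x)
    (hN : ∀ t : ℝ, 1 ≤ t → ((s.filter (fun x => w x ≤ t)).card : ℝ) ≤ C * t ^ β) :
    ∑ x ∈ s, (w x) ^ (-a) ≤ (C + a * C / (a - β)) * T ^ (β - a) := by
  obtain ⟨T1, hT1, hs⟩ : ∃ T1, T ≤ T1 ∧ ∀ x ∈ s, w x ≤ T1 := by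
    refine ⟨T + ∑ x ∈ s, |w x|, by linarith [Finset.sum_nonneg fun x (_ : x ∈ s) => abs_nonneg (w x)], ?_⟩
    intro x hx
    have := Finset.single_le_sum (f := fun x => |w x|) (fun i _ => abs_nonneg _) hx
    linarith [le_abs_self (w x)]
  refine (layer_core hC ha hT hT1 s hsT0 hs hN).trans ?_
  have hd : 0 < a - β := by linarith
  have hT0 : 0 < T := by linarith
  have h1 : T1 ^ (β - a) ≤ T ^ (β - a) := Real.rpow_le_rpow_of_nonpos hT0 hT1 (by linarith)
  have h2 : 0 ≤ T1 ^ (β - a) := Real.rpow_nonneg (by linarith) _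
  rw [int_pow' (by linarith) hT1 (by linarith), add_mul]
  refine add_le_add (by gcongr) ?_
  have : (T1 ^ (β - a) - T ^ (β - a)) / (β - a) ≤ T ^ (β - a) / (a - β) := by
    rw [← neg_div_neg_eq]
    have : -(β - a) = a - β := by ring
    rw [this]; gcongr; linarith
  calc _ ≤ a * C * (T ^ (β - a) / (a - β)) := by gcongr
    _ = _ := by ring

end layer

end HF
end HFH


open Filter Topology
open scoped BigOperators

noncomputable section HFI

namespace HF

open MeasureTheory Set
open scoped ContDiff

section poisson
variable {d : Type*} [Fintype d]

/-- integer vector as real vector -/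
def iv (m : d → ℤ) : d → ℝ := fun i => (m i : ℝ)

lemma iv_norm (m : d → ℤ) : ‖iv m‖ = ‖m‖ := by
  simp only [iv, Pi.norm_def]
  congr 1

lemma finite_int (R : ℝ) : {m : d → ℤ | ‖m‖ ≤ R}.Finite := by
  have := (isCompact_closedBall (0 : d → ℤ) R).finite_of_discrete
  refine this.subset ?_
  intro m hm
  simpa using hm

/-- dual phase -/
def dualF (F : (d → ℝ) → ℂ) (n : d → ℤ) : ℂ :=
  ∫ x : d → ℝ, Complex.exp (-(2 * Real.pi * Complex.I * (∑ i, (n i : ℝ) * x i : ℝ))) * F x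

lemma mFourier_coe (n : d → ℤ) (x : d → ℝ) :
    UnitAddTorus.mFourier (-n) (fun i => (x i : UnitAddCircle)) =
      Complex.exp (-(2 * Real.pi * Complex.I * (∑ i, (n i : ℝ) * x i : ℝ))) := by
  simp only [UnitAddTorus.mFourier, ContinuousMap.coe_mk, Pi.neg_apply]
  simp_rw [fourier_coe_apply]
  rw [← Complex.exp_sum]
  congr 1
  push_cast
  rw [Finset.mul_sum, ← Finset.sum_neg_distrib]
  refine Finset.sum_congr rfl fun i _ => ?_
  simp; ring

lemma phase_per (n m : d → ℤ) (x : d → ℝ) :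
    Complex.exp (-(2 * Real.pi * Complex.I * (∑ i, (n i : ℝ) * (x + iv m) i : ℝ))) =
      Complex.exp (-(2 * Real.pi * Complex.I * (∑ i, (n i : ℝ) * x i : ℝ))) := by
  rw [← mFourier_coe, ← mFourier_coe]
  congr 1
  funext i
  simp [iv]

/-- unit cube -/
def cube (d : Type*) : Set (d → ℝ) := {x | ∀ i, x i ∈ Ioc (0 : ℝ) (0 + 1)}

lemma cube_meas : MeasurableSet (cube d) := by
  have : cube d = Set.pi univ (fun _ => Ioc (0 : ℝ) (0 + 1)) := by ext x; simp [cube]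
  rw [this]
  exact MeasurableSet.univ_pi fun _ => measurableSet_Ioc

lemma cube_norm {x : d → ℝ} (hx : x ∈ cube d) : ‖x‖ ≤ 1 := by
  rw [pi_norm_le_iff_of_nonneg zero_le_one]
  intro i
  have := hx i
  rw [Real.norm_eq_abs, abs_of_pos this.1]
  linarith [this.2]

/-- translates of the unit cube -/
def cubeT (m : d → ℤ) : Set (d → ℝ) := (fun x => x - iv m) ⁻¹' cube d

lemma cubeT_disj : Pairwise (Function.onFun Disjoint (cubeT (d := d))) := by
  intro m m' hne
  rw [Function.onFun, Set.disjoint_left]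
  intro x hx hx'
  apply hne
  funext i
  have h1 := hx i
  have h2 := hx' i
  simp only [Pi.sub_apply, iv, mem_Ioc] at h1 h2
  have a1 : (m i : ℝ) < m' i + 1 := by linarith
  have a2 : (m' i : ℝ) < m i + 1 := by linarith
  have a3 : m i < m' i + 1 := by exact_mod_cast a1
  have a4 : m' i < m i + 1 := by exact_mod_cast a2
  omega

lemma cubeT_union : (⋃ m, cubeT (d := d) m) = univ := by
  rw [eq_univ_iff_forall]
  intro x
  rw [mem_iUnion]
  refine ⟨fun i => ⌈x i⌉ - 1, fun i => ?_⟩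
  simp only [Pi.sub_apply, iv, mem_Ioc]
  push_cast
  constructor
  · linarith [Int.ceil_lt_add_one (x i)]
  · linarith [Int.le_ceil (x i)]

lemma integral_cubes {G : (d → ℝ) → ℂ} (hG : Integrable G) :
    ∫ x, G x = ∑' m : d → ℤ, ∫ x in cube d, G (x + iv m) := by
  rw [← setIntegral_univ, ← cubeT_union, integral_iUnion]
  · congr 1; funext m
    have h := (measurePreserving_add_right (volume : Measure (d → ℝ)) (iv m)).setIntegral_preimage_emb
      (MeasurableEquiv.addRight (iv m)).measurableEmbedding G (cubeT m)
    rw [← h]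
    congr 1
    congr 1
    ext x
    simp [cubeT]
  · intro m
    exact (measurable_id.sub_const _) cube_meas
  · exact cubeT_disj
  · exact hG.integrableOn

theorem poisson {F : (d → ℝ) → ℂ} (hF : Continuous F) (hs : HasCompactSupport F)
    (hsum : Summable (dualF F)) :
    HasSum (dualF F) (∑' m : d → ℤ, F (iv m)) := by
  obtain ⟨R, hR⟩ := hs.isBounded.exists_norm_le
  have hR' : ∀ x, F x ≠ 0 → ‖x‖ ≤ R := fun x hx => hR x (subset_tsupport _ hx)
  let P : (d → ℝ) → ℂ := fun x => ∑' m : d → ℤ, F (x + iv m)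
  have hfin : ∀ Q : ℝ, ∀ x, ‖x‖ ≤ Q → ∀ m ∉ (finite_int (d := d) (R + Q)).toFinset, F (x + iv m) = 0 := by
    intro Q x hx m hm
    by_contra h
    apply hm
    rw [Finite.mem_toFinset]
    have := hR' _ h
    change ‖m‖ ≤ R + Q
    rw [← iv_norm]
    calc ‖iv m‖ = ‖(x + iv m) - x‖ := by congr 1; abel
      _ ≤ ‖x + iv m‖ + ‖x‖ := norm_sub_le _ _
      _ ≤ R + Q := by linarith
  have hPfin : ∀ Q : ℝ, ∀ x, ‖x‖ ≤ Q → P x = ∑ m ∈ (finite_int (d := d) (R + Q)).toFinset, F (x + iv m) :=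
    fun Q x hx => tsum_eq_sum (hfin Q x hx)
  have hPc : Continuous P := by
    rw [continuous_iff_continuousAt]
    intro x
    have h2 : (fun y => ∑ m ∈ (finite_int (d := d) (R + (‖x‖ + 1))).toFinset, F (y + iv m)) =ᶠ[𝓝 x] P := by
      have : ∀ᶠ y in 𝓝 x, ‖y‖ ≤ ‖x‖ + 1 := by
        have := (continuous_norm.continuousAt (x := x)).eventually_lt_const (show ‖x‖ < ‖x‖ + 1 by linarith)
        exact this.mono fun y hy => hy.le
      exact this.mono fun y hy => (hPfin _ y hy).symm
    have h3 : ContinuousAt (fun y => ∑ m ∈ (finite_int (d := d) (R + (‖x‖ + 1))).toFinset, F (y + iv m)) x := by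
      fun_prop
    exact h3.congr h2
  have hPper : ∀ x (m : d → ℤ), P (x + iv m) = P x := by
    intro x m
    simp only [P]
    rw [← (Equiv.addLeft m).tsum_eq (fun k => F (x + iv k))]
    congr 1; funext k
    congr 1
    funext i; simp [iv]; ring
  let pr : (d → ℝ) → UnitAddTorus d := fun x i => (x i : UnitAddCircle)
  have hq : IsQuotientMap pr := by
    have : IsOpenQuotientMap pr :=
      IsOpenQuotientMap.piMap fun _ => QuotientAddGroup.isOpenQuotientMap_mk
    exact this.isQuotientMap
  let f0 : UnitAddTorus d → ℂ := fun t => P (fun i => (AddCircle.equivIco 1 (0:ℝ) (t i)).1)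
  have hf0 : ∀ x, f0 (pr x) = P x := by
    intro x
    simp only [f0, pr]
    have : ∀ i, ∃ k : ℤ, (AddCircle.equivIco (1 : ℝ) 0 (x i : UnitAddCircle)).1 = x i + k := by
      intro i
      refine ⟨-⌊x i⌋, ?_⟩
      rw [AddCircle.coe_equivIco_mk_apply]
      rw [div_one, mul_one, ← Int.self_sub_floor]; push_cast; ring
    choose k hk using this
    rw [← hPper x k]
    congr 1; funext i; simp [hk, iv]
  let f : C(UnitAddTorus d, ℂ) := ⟨f0, by
    rw [hq.continuous_iff]
    have : f0 ∘ pr = P := funext hf0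
    rw [this]; exact hPc⟩
  have hInteg : ∀ n : d → ℤ, Integrable (fun x : d → ℝ =>
      Complex.exp (-(2 * Real.pi * Complex.I * (∑ i, (n i : ℝ) * x i : ℝ))) * F x) := by
    intro n
    apply Continuous.integrable_of_hasCompactSupport
    · fun_prop
    · exact hs.mul_left
  have hcoef : UnitAddTorus.mFourierCoeff f = dualF F := by
    funext n
    rw [UnitAddTorus.mFourierCoeff_eq_integral f n 0]
    have e1 : ∫ x in cube d, UnitAddTorus.mFourier (-n) (fun i => (x i : UnitAddCircle)) • f (pr x) =
        ∑ m ∈ (finite_int (d := d) (R + 1)).toFinset, ∫ x in cube d, Complex.exp (-(2 * Real.pi * Complex.I * (∑ i, (n i : ℝ) * (x + iv m) i : ℝ))) * F (x + iv m) := by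
      rw [← integral_finsetSum]
      · apply setIntegral_congr_fun cube_meas
        intro x hx
        simp only
        change _ * f0 (pr x) = _
        rw [hf0, hPfin 1 x (cube_norm hx), mFourier_coe, Finset.mul_sum]
        exact Finset.sum_congr rfl fun m _ => by rw [phase_per]
      · intro m _
        apply Integrable.integrableOn
        exact hInteg n |>.comp_add_right (iv m)
    refine Eq.trans e1 ?_
    unfold dualF
    rw [integral_cubes, tsum_eq_sum]
    · intro m hm
      rw [setIntegral_congr_fun cube_meas (g := fun _ => 0), integral_zero]
      intro x hx
      simp only
      rw [hfin 1 x (cube_norm hx) m hm, mul_zero]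
    · exact hInteg n
  have := UnitAddTorus.hasSum_mFourier_series_apply_of_summable (f := f) (by rw [hcoef]; exact hsum) 0
  rw [hcoef] at this
  have e0 : f 0 = ∑' m : d → ℤ, F (iv m) := by
    change f0 0 = _
    have : (0 : UnitAddTorus d) = pr 0 := by funext i; simp [pr]
    rw [this, hf0]
    simp [P]
  rw [e0] at this
  convert this using 1
  funext n
  simp [UnitAddTorus.mFourier]

end poisson

end HF
end HFI


open Filter Topology
open scoped BigOperators

noncomputable section HFJ

namespace HF

open MeasureTheory Set
open scoped ContDiff

namespace AD

variable {V : Type*} [NormedCommRing V] [NormedAlgebra ℝ V] (D : AD V)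

lemma exists_T [FiniteDimensional ℝ V] {ι : Type*} [Fintype ι] (b : Module.Basis ι ℝ V) :
    ∃ T : (ι → ℝ) ≃L[ℝ] V, ∀ u v, D.Tr (T u * v) = ∑ i, u i * b.equivFun v i := by
  classical
  let τ : V →ₗ[ℝ] Module.Dual ℝ V :=
    LinearMap.mk₂ ℝ (fun z v => D.Tr (z * v)) (by intros; simp [add_mul]) (by intros; simp)
      (by intros; simp [mul_add]) (by intros; simp)
  have hτ : Function.Injective τ := by
    rw [injective_iff_map_eq_zero]
    intro z hz
    by_contra hne
    have := D.pos z hne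
    have h2 : τ z (D.st z) = 0 := by rw [hz]; rfl
    have h3 : τ z (D.st z) = D.Tr (z * D.st z) := rfl
    linarith
  let τe : V ≃ₗ[ℝ] Module.Dual ℝ V :=
    LinearEquiv.ofInjectiveOfFinrankEq τ hτ (Subspace.dual_finrank_eq).symm
  let T := (b.dualBasis.equivFun.symm.trans τe.symm).toContinuousLinearEquiv
  refine ⟨T, fun u v => ?_⟩
  have : D.Tr (T u * v) = τe (T u) v := rfl
  rw [this]
  simp only [T, LinearEquiv.coe_toContinuousLinearEquiv', LinearEquiv.trans_apply, LinearEquiv.apply_symm_apply]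
  simp [Module.Basis.equivFun_symm_apply]

variable [FiniteDimensional ℝ V] [Nontrivial V] [MeasurableSpace V] [BorelSpace V]
variable {ι : Type*} [Fintype ι] (b : Module.Basis ι ℝ V)

/-- coordinates as a continuous linear equivalence -/
def phi : (ι → ℝ) ≃L[ℝ] V := b.equivFun.symm.toContinuousLinearEquiv

/-- the test function on the space -/
def GG (ψ : V → ℝ) (g : ℝ → ℝ) (v : V) : ℝ := ψ v * g (Real.log (D.Nm v))

/-- scaled test function in coordinates -/
def FF (ψ : V → ℝ) (g : ℝ → ℝ) (R : ℝ) (x : ι → ℝ) : ℂ := (D.GG ψ g (R⁻¹ • phi b x) : ℝ)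

/-- the measure used -/
def nu : Measure V := (volume : Measure (ι → ℝ)).map (phi b)

instance : (nu b).IsAddHaarMeasure := (phi b).isAddHaarMeasure_map _

lemma GG_cont {ψ : V → ℝ} (hψ : Continuous ψ) (hsup : ∀ v ∈ tsupport ψ, D.Nm v ≠ 0) {g : ℝ → ℝ}
    (hg : Continuous g) : Continuous (D.GG ψ g) := by
  rw [continuous_iff_continuousAt]
  intro v
  by_cases hv : v ∈ tsupport ψ
  · have h1 : ContinuousAt (fun v => Real.log (D.Nm v)) v :=
      (D.Nmc.continuousAt).log (hsup v hv)
    exact hψ.continuousAt.mul (hg.continuousAt.comp h1)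
  · have : (fun _ => (0 : ℝ)) =ᶠ[𝓝 v] D.GG ψ g := by
      filter_upwards [(notMem_tsupport_iff_eventuallyEq.1 hv)] with x hx
      simp [GG, hx]
    exact continuousAt_const.congr this

lemma GG_hcs {ψ : V → ℝ} (hs : HasCompactSupport ψ) (g : ℝ → ℝ) : HasCompactSupport (D.GG ψ g) :=
  hs.mul_right

lemma FF_cont {ψ : V → ℝ} (hψ : Continuous ψ) (hsup : ∀ v ∈ tsupport ψ, D.Nm v ≠ 0) {g : ℝ → ℝ}
    (hg : Continuous g) (R : ℝ) : Continuous (D.FF b ψ g R) := by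
  have := D.GG_cont hψ hsup hg
  unfold FF
  have h2 := (phi b).continuous
  fun_prop

lemma FF_hcs {ψ : V → ℝ} (hs : HasCompactSupport ψ) (g : ℝ → ℝ) {R : ℝ} (hR : 1 ≤ R) :
    HasCompactSupport (D.FF b ψ g R) := by
  have h1 := (D.GG_hcs hs g).comp_homeomorph
    ((phi b).toHomeomorph.trans (Homeomorph.smulOfNeZero R⁻¹ (by positivity)))
  exact h1.comp_left (g := fun r : ℝ => (r : ℂ)) (by simp)

lemma dual_eq (ψ : V → ℝ) (g : ℝ → ℝ) {R : ℝ} (hR : 1 ≤ R) (n : ι → ℤ) :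
    dualF (D.FF b ψ g R) n = R ^ (Fintype.card ι) * ∫ v, Complex.exp (-(2 * Real.pi * Complex.I *
      (R * ∑ i, (n i : ℝ) * b.equivFun v i : ℝ))) * (D.GG ψ g v : ℂ) ∂(nu b) := by
  have hR0 : R ≠ 0 := by positivity
  have h1 : ∀ H : V → ℂ, ∫ v, H v ∂(nu b) = ∫ x : ι → ℝ, H (phi b x) := fun H =>
    (phi b).toHomeomorph.isClosedEmbedding.measurableEmbedding.integral_map H
  rw [h1]
  unfold dualF
  have h2 := Measure.integral_comp_smul (volume : Measure (ι → ℝ)) (fun x : ι → ℝ =>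
    Complex.exp (-(2 * Real.pi * Complex.I *
      (R * ∑ i, (n i : ℝ) * b.equivFun (phi b x) i : ℝ))) * (D.GG ψ g (phi b x) : ℂ)) R⁻¹
  have h3 : |((R⁻¹) ^ (Module.finrank ℝ (ι → ℝ)))⁻¹| = R ^ Fintype.card ι := by
    rw [Module.finrank_fintype_fun_eq_card, abs_of_nonneg (by positivity)]
    simp
  rw [h3] at h2
  have h4 : ∀ x, b.equivFun (phi b x) = x := fun x => b.equivFun.apply_symm_apply x
  rw [Complex.real_smul] at h2
  push_cast at h2 ⊢
  rw [← h2]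
  congr 1; funext x
  simp only [h4, FF, map_smul]
  congr 3
  simp only [Finset.mul_sum]
  congr 1
  funext i
  have hRc : (R : ℂ) ≠ 0 := by exact_mod_cast hR0
  simp only [Pi.smul_apply, smul_eq_mul]
  push_cast
  field_simp

theorem dual_bound {ψ : V → ℝ} (hψ : ContDiff ℝ ∞ ψ) (hs : HasCompactSupport ψ)
    (hsup : ∀ v ∈ tsupport ψ, D.Nm v ≠ 0) (k : ℕ) :
    ∃ C : ℝ, 0 ≤ C ∧ ∀ g : ℝ → ℝ, ContDiff ℝ ∞ g → HasCompactSupport g → ∀ R : ℝ, 1 ≤ R →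
      ∀ n : ι → ℤ, n ≠ 0 → ‖dualF (D.FF b ψ g R) n‖ ≤
        C * gnorm k g * R ^ (Fintype.card ι : ℝ) *
          (R * ‖n‖) ^ (-(k + ((Fintype.card ι : ℝ) - 1) / 2)) := by
  obtain ⟨T, hT⟩ := D.exists_T b
  obtain ⟨r, hr, hTr⟩ : ∃ r : ℝ, 0 < r ∧ ∀ u, ‖u‖ = 1 → r ≤ ‖T u‖ := by
    refine ⟨1 / (‖(T.symm : V →L[ℝ] (ι → ℝ))‖ + 1), by positivity, fun u hu => ?_⟩
    have := (T.symm : V →L[ℝ] (ι → ℝ)).le_opNorm (T u)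
    simp only [ContinuousLinearEquiv.coe_coe, ContinuousLinearEquiv.symm_apply_apply, hu] at this
    rw [div_le_iff₀ (by positivity)]
    nlinarith [norm_nonneg (T u)]
  obtain ⟨Q, hQ, hTQ⟩ : ∃ Q : ℝ, 0 < Q ∧ ∀ u, ‖u‖ = 1 → ‖T u‖ ≤ Q := by
    refine ⟨‖(T : (ι → ℝ) →L[ℝ] V)‖ + 1, by positivity, fun u hu => ?_⟩
    have := (T : (ι → ℝ) →L[ℝ] V).le_opNorm u
    simp only [ContinuousLinearEquiv.coe_coe, hu] at this
    linarith
  obtain ⟨β, hβ, hβc, hβ1, hβt⟩ := exists_shell_cutoff V (s := {v | r ≤ ‖v‖ ∧ ‖v‖ ≤ Q})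
    (t := {v | r / 2 ≤ ‖v‖ ∧ ‖v‖ ≤ 2 * Q})
    ((isClosed_le continuous_const continuous_norm).inter (isClosed_le continuous_norm continuous_const))
    (by
      intro ν hν
      simp only [mem_ofPred_eq] at hν
      rw [mem_interior]
      refine ⟨{ν | r / 2 < ‖ν‖ ∧ ‖ν‖ < 2 * Q}, fun x hx => ⟨hx.1.le, hx.2.le⟩, ?_, ?_⟩
      · exact (isOpen_lt continuous_const continuous_norm).inter (isOpen_lt continuous_norm continuous_const)
      · simp only [mem_ofPred_eq]; constructor <;> linarith [hν.1, hν.2])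
    (by
      apply (isCompact_closedBall (0 : V) (2 * Q)).of_isClosed_subset
      · exact (isClosed_le continuous_const continuous_norm).inter (isClosed_le continuous_norm continuous_const)
      · intro x hx; simpa using hx.2)
  let A : V × V → ℂ := fun w => ((β w.1 * ψ w.2 : ℝ) : ℂ)
  have hA : ContDiff ℝ ∞ A :=
    Complex.ofRealCLM.contDiff.comp ((hβ.comp contDiff_fst).mul (hψ.comp contDiff_snd))
  have hAt : tsupport A ⊆ tsupport β ×ˢ tsupport ψ := by
    apply closure_minimal
    · intro w hw
      have h1 : β w.1 ≠ 0 := fun h => hw (by simp [A, h])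
      have h2 : ψ w.2 ≠ 0 := fun h => hw (by simp [A, h])
      exact ⟨subset_tsupport _ h1, subset_tsupport _ h2⟩
    · exact (isClosed_tsupport _).prod (isClosed_tsupport _)
  have hAs : HasCompactSupport A := (hβc.prod hs).of_isClosed_subset (isClosed_tsupport _) hAt
  obtain ⟨C, hC, hFT⟩ := D.FT (nu b) hA hAs (fun w hw => by
    have := hAt hw
    refine ⟨?_, hsup _ this.2⟩
    have h2 := (hβt this.1).1
    intro h
    rw [h, norm_zero] at h2
    linarith) k
  refine ⟨C, hC, fun g hg hgs R hR n hn => ?_⟩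
  have hn1 : 1 ≤ ‖n‖ := by
    obtain ⟨i, hi⟩ : ∃ i, n i ≠ 0 := by
      by_contra h; push Not at h; exact hn (funext h)
    have h1 := norm_le_pi_norm n i
    have h2 : (1 : ℝ) ≤ ‖n i‖ := by
      rw [Int.norm_eq_abs]; exact_mod_cast Int.one_le_abs hi
    linarith
  set u : ι → ℝ := -(‖n‖⁻¹ • iv n) with hu
  have hu1 : ‖u‖ = 1 := by
    rw [hu, norm_neg, norm_smul, iv_norm, norm_inv, norm_norm]
    exact inv_mul_cancel₀ (by positivity)
  set l : ℝ := 2 * Real.pi * (R * ‖n‖) with hl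
  have hRn : 1 ≤ R * ‖n‖ := by nlinarith
  have hl1 : R * ‖n‖ ≤ l := by rw [hl]; nlinarith [Real.pi_gt_three]
  have hcard : (Module.finrank ℝ D.H : ℝ) = (Fintype.card ι : ℝ) - 1 := by
    have h1 := D.finrank_H
    rw [Module.finrank_eq_card_basis b] at h1
    rw [h1]; push_cast; ring
  have h1 := hFT g hg hgs (T u) l (by linarith)
  rw [hcard] at h1
  have h2 : ∫ v, Complex.exp (-(2 * Real.pi * Complex.I *
      (R * ∑ i, (n i : ℝ) * b.equivFun v i : ℝ))) * (D.GG ψ g v : ℂ) ∂(nu b) = D.fI (nu b) A g (T u) l := by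
    unfold fI
    congr 1; funext v
    have hb1 : β (T u) = 1 := hβ1 _ ⟨hTr u hu1, hTQ u hu1⟩
    simp only [A, hb1, one_mul, GG, hT]
    rw [mul_comm]
    congr 1
    · push_cast; ring
    · unfold ep
      congr 1
      have : l * ∑ i, u i * b.equivFun v i = - (2 * Real.pi * (R * ∑ i, (n i : ℝ) * b.equivFun v i)) := by
        rw [hl, hu]
        simp only [Finset.mul_sum, ← Finset.sum_neg_distrib]
        refine Finset.sum_congr rfl fun i _ => ?_
        simp only [Pi.neg_apply, Pi.smul_apply, iv, smul_eq_mul]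
        field_simp
      rw [this]
      push_cast; ring
  rw [D.dual_eq b ψ g hR n, h2, norm_mul, norm_pow, Complex.norm_real, Real.norm_eq_abs,
    abs_of_nonneg (by linarith), Real.rpow_natCast]
  have h3 : l ^ (-((k : ℝ) + ((Fintype.card ι : ℝ) - 1) / 2)) ≤
      (R * ‖n‖) ^ (-((k : ℝ) + ((Fintype.card ι : ℝ) - 1) / 2)) := by
    apply Real.rpow_le_rpow_of_nonpos (by positivity) hl1
    have : 0 ≤ (Module.finrank ℝ D.H : ℝ) := by positivity
    rw [hcard] at this
    have : (0:ℝ) ≤ k := by positivity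
    linarith
  calc _ ≤ R ^ Fintype.card ι * (C * gnorm k g * (R * ‖n‖) ^ (-((k : ℝ) + ((Fintype.card ι : ℝ) - 1) / 2))) := by
        gcongr
        refine h1.trans ?_
        have := gnorm_nonneg k g
        gcongr
    _ = _ := by ring

end AD

end HF
end HFJ


open Filter Topology
open scoped BigOperators

noncomputable section HFK

namespace HF

open MeasureTheory Set
open scoped ContDiff

section count
variable {ι : Type*} [Fintype ι]

lemma one_le_norm_int {n : ι → ℤ} (hn : n ≠ 0) : 1 ≤ ‖n‖ := by
  obtain ⟨i, hi⟩ : ∃ i, n i ≠ 0 := by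
    by_contra h; push Not at h; exact hn (funext h)
  have h1 := norm_le_pi_norm n i
  have h2 : (1 : ℝ) ≤ ‖n i‖ := by
    rw [Int.norm_eq_abs]; exact_mod_cast Int.one_le_abs hi
  linarith

lemma count_int (s : Finset (ι → ℤ)) (t : ℝ) (ht : 1 ≤ t) :
    ((s.filter (fun n => ‖n‖ ≤ t)).card : ℝ) ≤ 3 ^ (Fintype.card ι) * t ^ (Fintype.card ι : ℝ) := by
  classical
  have h1 : s.filter (fun n => ‖n‖ ≤ t) ⊆ Fintype.piFinset (fun _ : ι => Finset.Icc (-⌊t⌋) ⌊t⌋) := by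
    intro n hn
    rw [Finset.mem_filter] at hn
    rw [Fintype.mem_piFinset]
    intro i
    have := (norm_le_pi_norm n i).trans hn.2
    rw [Int.norm_eq_abs, abs_le] at this
    rw [Finset.mem_Icc]
    constructor
    · have : -n i ≤ ⌊t⌋ := Int.le_floor.2 (by push_cast; linarith)
      omega
    · exact Int.le_floor.2 this.2
  have h2 := Finset.card_le_card h1
  rw [Fintype.card_piFinset] at h2
  simp only [Int.card_Icc, Finset.prod_const, Finset.card_univ] at h2
  have h0 : 0 ≤ ⌊t⌋ := Int.floor_nonneg.2 (by linarith)
  have h3 : (((⌊t⌋ + 1 - -⌊t⌋).toNat : ℕ) : ℝ) ≤ 3 * t := by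
    have h4 : (((⌊t⌋ + 1 - -⌊t⌋).toNat : ℕ) : ℤ) = ⌊t⌋ + 1 - -⌊t⌋ := Int.toNat_of_nonneg (by omega)
    have h5 : (((⌊t⌋ + 1 - -⌊t⌋).toNat : ℕ) : ℝ) = ((⌊t⌋ + 1 - -⌊t⌋ : ℤ) : ℝ) := by exact_mod_cast h4
    rw [h5]; push_cast
    linarith [Int.floor_le t]
  calc _ ≤ (((⌊t⌋ + 1 - -⌊t⌋).toNat ^ (Fintype.card ι) : ℕ) : ℝ) := by exact_mod_cast h2
    _ ≤ (3 * t) ^ (Fintype.card ι) := by push_cast; gcongr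
    _ = _ := by rw [mul_pow, Real.rpow_natCast]

/-- the exponent of the dual sum -/
def Eex (n : ℕ) : ℝ := if n = 1 then 1 else ((n : ℝ) - 1) / 2

/-- abstract dual sum bound -/
lemma dual_sum (hι : 1 ≤ Fintype.card ι) : ∃ K0 : ℝ, 0 ≤ K0 ∧ ∀ (a : (ι → ℤ) → ℝ) (B R M : ℝ), 0 ≤ B → 1 ≤ R → 1 ≤ M →
    (∀ n, n ≠ 0 → a n ≤ B * R ^ (Fintype.card ι : ℝ) *
      (R * ‖n‖) ^ (-((if Fintype.card ι = 1 then 0 else 1) + ((Fintype.card ι : ℝ) - 1) / 2))) →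
    (∀ n, n ≠ 0 → a n ≤ B * M ^ (Fintype.card ι : ℝ) * R ^ (Fintype.card ι : ℝ) *
      (R * ‖n‖) ^ (-((Fintype.card ι : ℝ) + 1 + ((Fintype.card ι : ℝ) - 1) / 2))) →
    ∀ s : Finset (ι → ℤ), (∀ n ∈ s, n ≠ 0) → ∑ n ∈ s, a n ≤ K0 * B * M ^ (Eex (Fintype.card ι)) := by
  set N : ℝ := (Fintype.card ι : ℝ) with hN
  have hN1 : 1 ≤ N := by rw [hN]; exact_mod_cast hι
  set al : ℝ := (if Fintype.card ι = 1 then 0 else 1) + (N - 1) / 2 with hal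
  set al1 : ℝ := N + 1 + (N - 1) / 2 with hal1
  have hcase : (0 ≤ al ∧ al < N) ∧ N - al = Eex (Fintype.card ι) ∧ 2 * N - al1 ≤ Eex (Fintype.card ι) := by
    unfold Eex
    by_cases h : Fintype.card ι = 1
    · have : N = 1 := by rw [hN, h]; norm_num
      simp only [hal, hal1, h, if_true, this]; norm_num
    · have h2 : 2 ≤ N := by
        rw [hN]
        have : 2 ≤ Fintype.card ι := by omega
        exact_mod_cast this
      simp only [hal, hal1, h, if_false, ← hN]
      refine ⟨⟨by linarith, by linarith⟩, by ring, by linarith⟩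
  obtain ⟨⟨ha0, haN⟩, hE, hE1⟩ := hcase
  set c : ℝ := 3 ^ (Fintype.card ι) with hc
  have hc0 : 0 ≤ c := by positivity
  have ha1 : N < al1 := by rw [hal1]; linarith
  have ha10 : 0 ≤ al1 := by linarith
  set c1 := c + al * c / (N - al) with hc1
  set c2 := c + al1 * c / (al1 - N) with hc2
  have hc10 : 0 ≤ c1 := by
    have : 0 < N - al := by linarith
    positivity
  have hc20 : 0 ≤ c2 := by
    have : 0 < al1 - N := by linarith
    positivity
  refine ⟨c1 + c2, by positivity, ?_⟩
  intro a B R M hB hR hM hh ht s hs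
  have hR0 : 0 < R := by linarith
  have hM0 : 0 < M := by linarith
  rw [← Finset.sum_filter_add_sum_filter_not s (fun n => ‖n‖ ≤ M / R)]
  have hhead : ∑ n ∈ s.filter (fun n => ‖n‖ ≤ M / R), a n ≤ c1 * B * M ^ (Eex (Fintype.card ι)) := by
    by_cases hMR : 1 ≤ M / R
    · have h1 := layer_head (w := fun n : ι → ℤ => ‖n‖) (β := N) hc0 ha0 hMR haN
        (s.filter (fun n => ‖n‖ ≤ M / R))
        (fun n hn => one_le_norm_int (hs n (Finset.mem_filter.1 hn).1))
        (fun n hn => (Finset.mem_filter.1 hn).2) (fun t ht => count_int _ t ht)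
      have h2 : ∀ n ∈ s.filter (fun n => ‖n‖ ≤ M / R), a n ≤ B * R ^ (N - al) * ‖n‖ ^ (-al) := by
        intro n hn
        refine (hh n (hs n (Finset.mem_filter.1 hn).1)).trans (le_of_eq ?_)
        rw [Real.mul_rpow hR0.le (norm_nonneg _), sub_eq_add_neg, Real.rpow_add hR0]
        ring
      refine (Finset.sum_le_sum h2).trans ?_
      rw [← Finset.mul_sum]
      calc _ ≤ B * R ^ (N - al) * (c1 * (M / R) ^ (N - al)) := by gcongr
        _ = c1 * B * (R * (M / R)) ^ (N - al) := by
            rw [Real.mul_rpow hR0.le (by positivity)]; ring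
        _ = _ := by rw [mul_div_cancel₀ _ hR0.ne', hE]
    · have : s.filter (fun n => ‖n‖ ≤ M / R) = ∅ := by
        rw [Finset.filter_eq_empty_iff]
        intro n hn h
        have := one_le_norm_int (hs n hn)
        linarith
      rw [this, Finset.sum_empty]
      positivity
  have htail : ∑ n ∈ s.filter (fun n => ¬ ‖n‖ ≤ M / R), a n ≤ c2 * B * M ^ (Eex (Fintype.card ι)) := by
    set T := max 1 (M / R) with hT
    have hT1 : 1 ≤ T := le_max_left _ _
    have hRT : M ≤ R * T := by
      have : M / R ≤ T := le_max_right _ _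
      rw [div_le_iff₀ hR0] at this; linarith
    have h1 := layer_tail (w := fun n : ι → ℤ => ‖n‖) (β := N) hc0 ha10 hT1 ha1
        (s.filter (fun n => ¬ ‖n‖ ≤ M / R))
        (fun n hn => max_le (one_le_norm_int (hs n (Finset.mem_filter.1 hn).1))
          (not_le.1 (Finset.mem_filter.1 hn).2).le) (fun t ht => count_int _ t ht)
    have h2 : ∀ n ∈ s.filter (fun n => ¬ ‖n‖ ≤ M / R), a n ≤ B * M ^ N * R ^ (N - al1) * ‖n‖ ^ (-al1) := by
      intro n hn
      refine (ht n (hs n (Finset.mem_filter.1 hn).1)).trans (le_of_eq ?_)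
      rw [Real.mul_rpow hR0.le (norm_nonneg _), sub_eq_add_neg, Real.rpow_add hR0]
      ring
    refine (Finset.sum_le_sum h2).trans ?_
    rw [← Finset.mul_sum]
    calc _ ≤ B * M ^ N * R ^ (N - al1) * (c2 * T ^ (N - al1)) := by gcongr
      _ = c2 * B * M ^ N * (R * T) ^ (N - al1) := by
          rw [Real.mul_rpow hR0.le (by positivity)]; ring
      _ ≤ c2 * B * M ^ N * M ^ (N - al1) := by
          have := Real.rpow_le_rpow_of_nonpos hM0 hRT (show N - al1 ≤ 0 by linarith)
          gcongr
      _ = c2 * B * M ^ (2 * N - al1) := by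
          rw [mul_assoc, ← Real.rpow_add hM0]; congr 2; ring
      _ ≤ _ := by
          have := Real.rpow_le_rpow_of_exponent_le hM hE1
          gcongr
  calc _ ≤ c1 * B * M ^ (Eex (Fintype.card ι)) + c2 * B * M ^ (Eex (Fintype.card ι)) := add_le_add hhead htail
    _ = _ := by ring

end count

namespace AD

variable {V : Type*} [NormedCommRing V] [NormedAlgebra ℝ V] (D : AD V)
variable [FiniteDimensional ℝ V] [Nontrivial V] [MeasurableSpace V] [BorelSpace V]
variable {ι : Type*} [Fintype ι] (b : Module.Basis ι ℝ V)

/-- smooth lattice point counting -/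
theorem lattice_smooth {ψ : V → ℝ} (hψ : ContDiff ℝ ∞ ψ) (hs : HasCompactSupport ψ)
    (hsup : ∀ v ∈ tsupport ψ, D.Nm v ≠ 0) :
    ∃ C : ℝ, 0 ≤ C ∧ ∀ (B δ : ℝ), 0 ≤ B → 0 < δ → δ ≤ 1 → ∀ g : ℝ → ℝ, ContDiff ℝ ∞ g → HasCompactSupport g →
      gnorm 1 g ≤ B → gnorm (Fintype.card ι + 1) g ≤ B * δ⁻¹ ^ (Fintype.card ι) →
      ∀ R : ℝ, 1 ≤ R → |∑' n : ι → ℤ, D.GG ψ g (R⁻¹ • phi b (iv n)) -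
          (∫ v, D.GG ψ g v ∂(nu b)) * R ^ (Fintype.card ι)| ≤ C * B * δ⁻¹ ^ (Eex (Fintype.card ι)) := by
  have hcard : 1 ≤ Fintype.card ι := by
    rw [← Module.finrank_eq_card_basis b]
    exact Module.finrank_pos
  obtain ⟨K0, hK0, hsum⟩ := dual_sum (ι := ι) hcard
  obtain ⟨C1, hC1, hd1⟩ := D.dual_bound b hψ hs hsup (if Fintype.card ι = 1 then 0 else 1)
  obtain ⟨C2, hC2, hd2⟩ := D.dual_bound b hψ hs hsup (Fintype.card ι + 1)
  refine ⟨K0 * (C1 + C2), by positivity, ?_⟩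
  intro B δ hB hδ hδ1 g hg hgs hg1 hg2 R hR
  have hM : 1 ≤ δ⁻¹ := (one_le_inv₀ hδ).2 hδ1
  have hR0 : 0 < R := by linarith
  set F := D.FF b ψ g R with hF
  have key : ∀ s : Finset (ι → ℤ), (∀ n ∈ s, n ≠ 0) →
      ∑ n ∈ s, ‖dualF F n‖ ≤ K0 * ((C1 + C2) * B) * δ⁻¹ ^ (Eex (Fintype.card ι)) := by
    apply hsum _ _ R _ (by positivity) hR hM
    · intro n hn
      refine (hd1 g hg hgs R hR n hn).trans ?_
      have hle : gnorm (if Fintype.card ι = 1 then 0 else 1) g ≤ B := by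
        refine (gnorm_mono ?_ g).trans hg1
        split_ifs <;> simp
      have h5 : C1 * gnorm (if Fintype.card ι = 1 then 0 else 1) g ≤ (C1 + C2) * B := by
        have := gnorm_nonneg (if Fintype.card ι = 1 then 0 else 1) g
        nlinarith
      push_cast
      gcongr
    · intro n hn
      refine (hd2 g hg hgs R hR n hn).trans ?_
      have h5 : C2 * gnorm (Fintype.card ι + 1) g ≤ (C1 + C2) * B * δ⁻¹ ^ (Fintype.card ι : ℝ) := by
        rw [Real.rpow_natCast]
        calc _ ≤ C2 * (B * δ⁻¹ ^ (Fintype.card ι)) := by gcongr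
          _ ≤ _ := by
            have : 0 ≤ C1 * (B * δ⁻¹ ^ (Fintype.card ι)) := by positivity
            linarith
      push_cast at h5 ⊢
      gcongr
  have hnz : ∀ s : Finset ((({0} : Finset (ι → ℤ)) : Set (ι → ℤ))ᶜ : Set (ι → ℤ)),
      ∑ n ∈ s, ‖dualF F n‖ ≤ K0 * ((C1 + C2) * B) * δ⁻¹ ^ (Eex (Fintype.card ι)) := by
    intro s
    have := key (s.map (Function.Embedding.subtype _)) (by
      intro n hn
      rw [Finset.mem_map] at hn
      obtain ⟨m, -, rfl⟩ := hn
      simpa using m.2)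
    rwa [Finset.sum_map] at this
  have hsm1 : Summable (fun n : ((({0} : Finset (ι → ℤ)) : Set (ι → ℤ))ᶜ : Set (ι → ℤ)) => ‖dualF F n‖) :=
    summable_of_sum_le (fun _ => norm_nonneg _) hnz
  have hle1 := hsm1.tsum_le_of_sum_le hnz
  have hsm : Summable (dualF F) := by
    exact (Finset.summable_compl_iff ({0} : Finset (ι → ℤ))).1 hsm1.of_norm
  have hP := poisson (D.FF_cont b hψ.continuous hsup hg.continuous R) (D.FF_hcs b hs g hR) hsm
  have hsplit := (hsm.sum_add_tsum_compl (s := {0}))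
  rw [hP.tsum_eq] at hsplit
  simp only [Finset.sum_singleton] at hsplit
  have h0 : dualF F 0 = (((∫ v, D.GG ψ g v ∂(nu b)) * R ^ (Fintype.card ι) : ℝ) : ℂ) := by
    rw [hF, D.dual_eq b ψ g hR 0]
    simp only [Pi.zero_apply, Int.cast_zero, zero_mul, Finset.sum_const_zero, mul_zero, Complex.ofReal_zero, neg_zero,
      Complex.exp_zero, one_mul]
    have h := integral_ofReal (𝕜 := ℂ) (μ := nu b) (f := D.GG ψ g)
    push_cast
    rw [mul_comm]
    congr 1
  have hcast : ∑' n : ι → ℤ, F (iv n) = ((∑' n : ι → ℤ, D.GG ψ g (R⁻¹ • phi b (iv n)) : ℝ) : ℂ) := by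
    rw [Complex.ofReal_tsum]; rfl
  have hfin : ((∑' n : ι → ℤ, D.GG ψ g (R⁻¹ • phi b (iv n)) -
          (∫ v, D.GG ψ g v ∂(nu b)) * R ^ (Fintype.card ι) : ℝ) : ℂ) =
      ∑' n : ((({0} : Finset (ι → ℤ)) : Set (ι → ℤ))ᶜ : Set (ι → ℤ)), dualF F n := by
    rw [Complex.ofReal_sub, ← hcast, ← h0, ← hsplit]; ring
  rw [← Real.norm_eq_abs, ← Complex.norm_real, hfin]
  refine (norm_tsum_le_tsum_norm hsm1).trans (hle1.trans (le_of_eq ?_))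
  ring

end AD

end HF
end HFK


open Filter Topology
open scoped BigOperators

noncomputable section HFL

namespace HF

open MeasureTheory Set
open scoped ContDiff

section AD
open NumberField NumberField.mixedEmbedding NumberField.InfinitePlace

/-- `(exp z - 1)/z` -/
def EC : ℂ → ℂ := dslope Complex.exp 0

lemma EC_smooth : ContDiff ℝ ∞ EC := by
  have h : DifferentiableOn ℂ EC univ :=
    (Complex.differentiableOn_dslope (f := Complex.exp) (c := 0) univ_mem).2 Complex.differentiable_exp.differentiableOn
  exact ((differentiableOn_univ.1 h).contDiff (n := ∞)).restrict_scalars ℝ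

lemma EC_eq (z : ℂ) : Complex.exp z = 1 + z * EC z := by
  have := sub_smul_dslope Complex.exp 0 z
  simp only [sub_zero, smul_eq_mul, Complex.exp_zero] at this
  unfold EC; rw [this]; ring

lemma EC_zero : EC 0 = 1 := by
  unfold EC; rw [dslope_same]; simp

lemma ER_eq (x : ℝ) : Real.exp x = 1 + x * (EC x).re := by
  have h := EC_eq x
  have := congrArg Complex.re h
  rw [← Complex.ofReal_exp, Complex.ofReal_re] at this
  simpa using this

variable (K : Type) [Field K] [NumberField K]

open scoped Classical in
/-- the trace form -/
def mTr : mixedSpace K →L[ℝ] ℝ :=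
  (∑ w : {w : InfinitePlace K // IsReal w}, (ContinuousLinearMap.proj (R := ℝ) (φ := fun _ : {w : InfinitePlace K // IsReal w} => ℝ) w).comp
      (ContinuousLinearMap.fst ℝ _ _)) +
  2 • (∑ w : {w : InfinitePlace K // IsComplex w}, Complex.reCLM.comp
      ((ContinuousLinearMap.proj (R := ℝ) (φ := fun _ : {w : InfinitePlace K // IsComplex w} => ℂ) w).comp
      (ContinuousLinearMap.snd ℝ _ _)))

open scoped Classical in
lemma mTr_apply (v : mixedSpace K) : mTr K v = ∑ w, v.1 w + 2 * ∑ w, (v.2 w).re := by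
  simp [mTr]

/-- the involution -/
def mst : mixedSpace K →L[ℝ] mixedSpace K :=
  (ContinuousLinearMap.fst ℝ _ _).prod (ContinuousLinearMap.pi fun w =>
    (Complex.conjCLE : ℂ →L[ℝ] ℂ).comp ((ContinuousLinearMap.proj (R := ℝ) (φ := fun _ : {w : InfinitePlace K // IsComplex w} => ℂ) w).comp
      (ContinuousLinearMap.snd ℝ _ _)))

lemma mst_apply (v : mixedSpace K) : mst K v = (v.1, fun w => (starRingEnd ℂ) (v.2 w)) := by
  rfl

open scoped Classical in
/-- the data for the mixed space -/
def mAD : AD (mixedSpace K) where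
  Tr := mTr K
  st := mst K
  ex := fun v => (fun w => Real.exp (v.1 w), fun w => Complex.exp (v.2 w))
  E := fun v => (fun w => (EC (v.1 w)).re, fun w => EC (v.2 w))
  Nm := mixedEmbedding.norm
  Esm := by
    have := EC_smooth
    refine ContDiff.prodMk ?_ ?_
    · rw [contDiff_pi]
      intro w
      have h1 : ContDiff ℝ ∞ (fun v : mixedSpace K => v.1 w) :=
        (contDiff_apply ℝ ℝ w).comp contDiff_fst
      exact Complex.reCLM.contDiff.comp (this.comp (Complex.ofRealCLM.contDiff.comp h1))
    · rw [contDiff_pi]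
      intro w
      have h1 : ContDiff ℝ ∞ (fun v : mixedSpace K => v.2 w) :=
        (contDiff_apply ℝ ℂ w).comp contDiff_snd
      exact this.comp h1
  exE := by
    intro z
    ext w
    · exact ER_eq _
    · exact EC_eq _
  E0 := by
    ext w
    · simp [EC_zero]
    · simp [EC_zero]
  exadd := by
    intro x y
    ext w
    · simp [Real.exp_add]
    · simp [Complex.exp_add]
  Trst := by intro v; simp [mTr_apply, mst_apply]
  stone := by
    rw [mst_apply]
    ext w <;> simp
  pos := by
    intro v hv
    rw [mTr_apply, mst_apply]
    have e1 : ∀ w, (v * (v.1, fun w => (starRingEnd ℂ) (v.2 w))).1 w = (v.1 w) ^ 2 := by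
      intro w; simp [sq]
    have e2 : ∀ w, ((v * (v.1, fun w => (starRingEnd ℂ) (v.2 w))).2 w).re = Complex.normSq (v.2 w) := by
      intro w; simp [Complex.mul_conj]
    simp only [e1, e2]
    have p1 : 0 ≤ ∑ w, (v.1 w) ^ 2 := Finset.sum_nonneg fun _ _ => sq_nonneg _
    have p2 : 0 ≤ ∑ w, Complex.normSq (v.2 w) := Finset.sum_nonneg fun _ _ => Complex.normSq_nonneg _
    by_contra hle
    have z1 : ∑ w, (v.1 w) ^ 2 = 0 := by linarith
    have z2 : ∑ w, Complex.normSq (v.2 w) = 0 := by linarith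
    apply hv
    ext w
    · have := (Finset.sum_eq_zero_iff_of_nonneg (fun _ _ => sq_nonneg _)).1 z1 w (Finset.mem_univ _)
      simpa using this
    · have := (Finset.sum_eq_zero_iff_of_nonneg (fun _ _ => Complex.normSq_nonneg _)).1 z2 w (Finset.mem_univ _)
      simpa using this
  Nmex := by
    intro v y
    rw [map_mul]
    congr 1
    rw [mixedEmbedding.norm_apply, mTr_apply, Real.exp_add, Real.exp_sum, Finset.mul_sum, Real.exp_sum,
      InfinitePlace.prod_eq_prod_mul_prod]
    congr 1
    · refine Finset.prod_congr rfl fun w _ => ?_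
      rw [normAtPlace_apply_of_isReal w.2, mult_isReal, pow_one, Real.norm_eq_abs, abs_of_pos (Real.exp_pos _)]
    · refine Finset.prod_congr rfl fun w _ => ?_
      rw [normAtPlace_apply_of_isComplex w.2, mult_isComplex, Complex.norm_exp, ← Real.exp_nat_mul]
      norm_num
  Nmc := mixedEmbedding.continuous_norm K
  Nmunit := by
    intro v hv
    rw [mixedEmbedding.norm_ne_zero_iff] at hv
    rw [Prod.isUnit_iff, Pi.isUnit_iff, Pi.isUnit_iff]
    refine ⟨fun w => ?_, fun w => ?_⟩
    · have := hv w
      rw [normAtPlace_apply_of_isReal w.2] at this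
      simpa using this
    · have := hv w
      rw [normAtPlace_apply_of_isComplex w.2] at this
      simpa using this

end AD

end HF
end HFL


open Filter Topology
open scoped BigOperators

noncomputable section HFM

namespace HF

open MeasureTheory Set
open scoped ContDiff

/-- the bump whose integer translates sum to one -/
def eta (t : ℝ) : ℝ := Real.smoothTransition (t + 1) - Real.smoothTransition t

lemma eta_smooth : ContDiff ℝ ∞ eta := by
  have := Real.smoothTransition.contDiff (n := (⊤ : ℕ∞))
  exact (this.comp (contDiff_id.add contDiff_const)).sub this

lemma eta_zero {t : ℝ} (h : t ≤ -1 ∨ 1 ≤ t) : eta t = 0 := by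
  unfold eta
  rcases h with h | h
  · rw [Real.smoothTransition.zero_of_nonpos (by linarith), Real.smoothTransition.zero_of_nonpos (by linarith), sub_zero]
  · rw [Real.smoothTransition.one_of_one_le (by linarith), Real.smoothTransition.one_of_one_le (by linarith), sub_self]

lemma eta_sum (c : ℝ) : ∃ t : Finset ℤ, (∀ n ∉ t, eta (c + n) = 0) ∧ ∑ n ∈ t, eta (c + n) = 1 := by
  refine ⟨{-⌊c⌋, -⌊c⌋ - 1}, ?_, ?_⟩
  · intro n hn
    simp only [Finset.mem_insert, Finset.mem_singleton, not_or] at hn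
    apply eta_zero
    have h1 := Int.floor_le c
    have h2 := Int.lt_floor_add_one c
    rcases lt_or_ge n (-⌊c⌋ - 1) with h | h
    · left
      have : n ≤ -⌊c⌋ - 2 := by omega
      have : (n : ℝ) ≤ -⌊c⌋ - 2 := by exact_mod_cast this
      linarith
    · right
      have : -⌊c⌋ + 1 ≤ n := by omega
      have : -(⌊c⌋ : ℝ) + 1 ≤ n := by exact_mod_cast this
      linarith
  · rw [Finset.sum_pair (by omega)]
    have h1 := Int.floor_le c
    have h2 := Int.lt_floor_add_one c
    unfold eta
    push_cast
    rw [Real.smoothTransition.one_of_one_le (x := c + -(⌊c⌋ : ℝ) + 1) (by linarith),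
      Real.smoothTransition.zero_of_nonpos (x := c + (-(⌊c⌋ : ℝ) - 1)) (by linarith)]
    have : c + (-(⌊c⌋ : ℝ) - 1) + 1 = c + -(⌊c⌋ : ℝ) := by ring
    rw [this]; ring

section psi
open NumberField NumberField.mixedEmbedding NumberField.InfinitePlace NumberField.Units NumberField.Units.dirichletUnitTheorem
open scoped Classical

variable (K : Type) [Field K] [NumberField K]

/-- real basis of the log space -/
def Bu : Module.Basis (Fin (rank K)) ℝ (logSpace K) := (basisUnitLattice K).ofZLatticeBasis ℝ _

/-- homogeneous partition function -/
def psi0 (v : mixedSpace K) : ℝ := ∏ j, eta ((Bu K).repr (logMap v) j)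

/-- units as torsion times exponents -/
def unitE : (torsion K × (Fin (rank K) → ℤ)) ≃ (𝓞 K)ˣ :=
  Equiv.ofBijective (fun z => z.1 * ∏ i, (fundSystem K i) ^ (z.2 i)) (by
    rw [Function.bijective_iff_existsUnique]
    intro x
    obtain ⟨z, hz, hu⟩ := exist_unique_eq_mul_prod K x
    exact ⟨z, hz.symm, fun y hy => hu y hy.symm⟩)

lemma repr_unitE (z : torsion K × (Fin (rank K) → ℤ)) {v : mixedSpace K} (hv : mixedEmbedding.norm v ≠ 0) (j : Fin (rank K)) :
    (Bu K).repr (logMap (unitE K z • v)) j = (Bu K).repr (logMap v) j + z.2 j := by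
  rw [logMap_unit_smul _ hv]
  have h1 : logEmbedding K (Additive.ofMul (unitE K z)) = ∑ i, (z.2 i : ℝ) • Bu K i := by
    have : unitE K z = z.1 * ∏ i, (fundSystem K i) ^ (z.2 i) := rfl
    rw [this, ofMul_mul, map_add, logEmbedding_eq_zero_iff.2 z.1.2, zero_add, ofMul_prod, map_sum]
    refine Finset.sum_congr rfl fun i _ => ?_
    rw [ofMul_zpow, map_zsmul, logEmbedding_fundSystem]
    rw [Bu, Module.Basis.ofZLatticeBasis_apply, Int.cast_smul_eq_zsmul]
  rw [h1, map_add, Finsupp.add_apply]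
  rw [add_comm]
  congr 1
  rw [Module.Basis.repr_sum_self]

lemma psi0_sum {v : mixedSpace K} (hv : mixedEmbedding.norm v ≠ 0) :
    HasSum (fun u : (𝓞 K)ˣ => psi0 K (u • v)) (torsionOrder K : ℝ) := by
  rw [← (unitE K).hasSum_iff]
  have h0 : ((fun u : (𝓞 K)ˣ => psi0 K (u • v)) ∘ unitE K) =
      fun z => ∏ j, eta ((Bu K).repr (logMap v) j + z.2 j) := by
    funext z
    simp only [Function.comp, psi0]
    exact Finset.prod_congr rfl fun j _ => by rw [repr_unitE K z hv]
  rw [h0]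
  choose t ht0 ht1 using eta_sum
  letI : Fintype (torsion K) := Fintype.ofFinite _
  let s : Finset (torsion K × (Fin (rank K) → ℤ)) :=
    Finset.univ ×ˢ Fintype.piFinset (fun j => t ((Bu K).repr (logMap v) j))
  have h1 : ∑ z ∈ s, ∏ j, eta ((Bu K).repr (logMap v) j + z.2 j) = torsionOrder K := by
    rw [Finset.sum_product]
    simp only
    have := Finset.prod_univ_sum (fun j => t ((Bu K).repr (logMap v) j)) (fun j (n : ℤ) => eta ((Bu K).repr (logMap v) j + n))
    rw [← this]
    simp [ht1, torsionOrder, Finset.card_univ, Nat.card_eq_fintype_card]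
  rw [← h1]
  apply hasSum_sum_of_ne_finset_zero
  intro z hz
  have : ∃ j, z.2 j ∉ t ((Bu K).repr (logMap v) j) := by
    by_contra h
    push Not at h
    exact hz (by simp [s, h])
  obtain ⟨j, hj⟩ := this
  exact Finset.prod_eq_zero (Finset.mem_univ j) (ht0 _ _ hj)

lemma psi0_smul {v : mixedSpace K} (hv : mixedEmbedding.norm v ≠ 0) {c : ℝ} (hc : c ≠ 0) :
    psi0 K (c • v) = psi0 K v := by
  unfold psi0; rw [logMap_real_smul hv hc]

lemma log_place_smooth (w : InfinitePlace K) {v : mixedSpace K} (hv : mixedEmbedding.norm v ≠ 0) :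
    ContDiffAt ℝ ∞ (fun v : mixedSpace K => Real.log (normAtPlace w v)) v := by
  have hw := mixedEmbedding.norm_ne_zero_iff.1 hv w
  by_cases h : IsReal w
  · have e : (fun v : mixedSpace K => Real.log (normAtPlace w v)) = fun v => Real.log (v.1 ⟨w, h⟩) := by
      funext v
      rw [normAtPlace_apply_of_isReal h, Real.norm_eq_abs, Real.log_abs]
    rw [e]
    rw [normAtPlace_apply_of_isReal h] at hw
    refine ContDiffAt.log ?_ (by simpa using hw)
    exact ((contDiff_apply ℝ ℝ (⟨w, h⟩ : {w : InfinitePlace K // IsReal w})).comp contDiff_fst).contDiffAt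
  · have h' : IsComplex w := not_isReal_iff_isComplex.1 h
    have e : (fun v : mixedSpace K => Real.log (normAtPlace w v)) = fun v => Real.log ‖v.2 ⟨w, h'⟩‖ := by
      funext v
      rw [normAtPlace_apply_of_isComplex h']
    rw [e]
    rw [normAtPlace_apply_of_isComplex h'] at hw
    have h2 : ContDiffAt ℝ ∞ (fun v : mixedSpace K => v.2 ⟨w, h'⟩) v :=
      ((contDiff_apply ℝ ℂ (⟨w, h'⟩ : {w : InfinitePlace K // IsComplex w})).comp contDiff_snd).contDiffAt
    exact (h2.norm ℝ (by simpa using hw)).log hw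

lemma log_norm (v : mixedSpace K) (hv : mixedEmbedding.norm v ≠ 0) :
    Real.log (mixedEmbedding.norm v) = ∑ w : InfinitePlace K, (mult w : ℝ) * Real.log (normAtPlace w v) := by
  have hw := mixedEmbedding.norm_ne_zero_iff.1 hv
  rw [mixedEmbedding.norm_apply, Real.log_prod (fun w _ => pow_ne_zero _ (hw w))]
  simp

lemma log_norm_smooth {v : mixedSpace K} (hv : mixedEmbedding.norm v ≠ 0) :
    ContDiffAt ℝ ∞ (fun v : mixedSpace K => Real.log (mixedEmbedding.norm v)) v := by
  have h1 : ContDiffAt ℝ ∞ (fun v : mixedSpace K => ∑ w : InfinitePlace K, (mult w : ℝ) * Real.log (normAtPlace w v)) v :=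
    ContDiffAt.sum fun w _ => contDiffAt_const.mul (log_place_smooth K w hv)
  refine h1.congr_of_eventuallyEq ?_
  have := (mixedEmbedding.continuous_norm K).continuousAt (x := v) |>.eventually_ne hv
  exact this.mono fun x hx => log_norm K x hx

lemma logMap_smooth {v : mixedSpace K} (hv : mixedEmbedding.norm v ≠ 0) :
    ContDiffAt ℝ ∞ (fun v : mixedSpace K => logMap v) v := by
  rw [contDiffAt_pi]
  intro w
  simp only [logMap_apply]
  exact contDiffAt_const.mul ((log_place_smooth K _ hv).sub ((log_norm_smooth K hv).mul contDiffAt_const))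

lemma psi0_smooth {v : mixedSpace K} (hv : mixedEmbedding.norm v ≠ 0) : ContDiffAt ℝ ∞ (psi0 K) v := by
  unfold psi0
  refine contDiffAt_prod fun j _ => ?_
  refine eta_smooth.contDiffAt.comp v ?_
  have h1 : ContDiff ℝ ∞ (fun x : logSpace K => (Bu K).repr x j) :=
    ((Bu K).coord j).toContinuousLinearMap.contDiff
  exact h1.contDiffAt.comp v (logMap_smooth K hv)

/-- the cutoff partition function -/
def psi (χ : ℝ → ℝ) (v : mixedSpace K) : ℝ := χ (mixedEmbedding.norm v) * psi0 K v

lemma bdd_aux1 {x m A r L : ℝ} (hx : 0 ≤ x) (hm : 1 ≤ m) (h : m * x ≤ A + r * (2 * (L + A))) (hA : 0 ≤ A) (hr : 1 ≤ r) :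
    x ≤ 2 * r * (L + 2 * A) + A := by
  have : x ≤ m * x := by nlinarith
  nlinarith

lemma bdd_aux2 {x A r L : ℝ} (h : x ≤ L + A) (hA : 0 ≤ A) (hr : 1 ≤ r) (hL : 0 ≤ L) :
    x ≤ 2 * r * (L + 2 * A) + A := by
  nlinarith

set_option maxHeartbeats 1000000 in
lemma bdd_psi0 (A : ℝ) : ∃ M : ℝ, ∀ v : mixedSpace K, mixedEmbedding.norm v ≠ 0 → psi0 K v ≠ 0 →
    |Real.log (mixedEmbedding.norm v)| ≤ A → ‖v‖ ≤ M := by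
  set L : ℝ := ∑ j, ‖Bu K j‖ with hL
  have hL0 : 0 ≤ L := Finset.sum_nonneg fun _ _ => norm_nonneg _
  set r : ℝ := (Fintype.card (InfinitePlace K) : ℝ) with hr
  refine ⟨Real.exp (2 * r * (L + 2 * |A|) + |A|), fun v hv hp hA => ?_⟩
  have hn : (1 : ℝ) ≤ Module.finrank ℚ K := by exact_mod_cast Module.finrank_pos
  have hlm : ‖logMap v‖ ≤ L := by
    rw [← (Bu K).sum_repr (logMap v)]
    refine (norm_sum_le _ _).trans (Finset.sum_le_sum fun j _ => ?_)
    rw [_root_.norm_smul]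
    have : |(Bu K).repr (logMap v) j| ≤ 1 := by
      by_contra h
      apply hp
      apply Finset.prod_eq_zero (Finset.mem_univ j)
      apply eta_zero
      push Not at h
      rcases lt_abs.1 h with h | h
      · right; exact h.le
      · left; linarith
    rw [Real.norm_eq_abs]
    nlinarith [norm_nonneg (Bu K j)]
  have hA' : |Real.log (mixedEmbedding.norm v)| ≤ |A| := hA.trans (le_abs_self A)
  have hA0 : |Real.log (mixedEmbedding.norm v) * (Module.finrank ℚ K : ℝ)⁻¹| ≤ |A| := by
    rw [abs_mul, abs_of_nonneg (by positivity : (0:ℝ) ≤ (Module.finrank ℚ K : ℝ)⁻¹)]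
    calc _ ≤ |A| * 1 := by
          gcongr
          exact inv_le_one_of_one_le₀ hn
      _ = _ := mul_one _
  have h1 : ∀ w : InfinitePlace K, w ≠ w₀ → |Real.log (normAtPlace w v)| ≤ L + |A| := by
    intro w hw
    have := (norm_le_pi_norm (logMap v) ⟨w, hw⟩).trans hlm
    rw [logMap_apply, norm_mul, Real.norm_eq_abs, Real.norm_eq_abs] at this
    have hm : (1 : ℝ) ≤ |((mult w : ℕ) : ℝ)| := by
      rw [abs_of_nonneg (by positivity)]
      exact_mod_cast one_le_mult
    have h3 : |Real.log (normAtPlace w v) - Real.log (mixedEmbedding.norm v) * (Module.finrank ℚ K : ℝ)⁻¹| ≤ L := by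
      have := abs_nonneg (Real.log (normAtPlace w v) - Real.log (mixedEmbedding.norm v) * (Module.finrank ℚ K : ℝ)⁻¹)
      nlinarith
    have h4 := abs_sub_abs_le_abs_sub (Real.log (normAtPlace w v)) (Real.log (mixedEmbedding.norm v) * (Module.finrank ℚ K : ℝ)⁻¹)
    linarith
  have hm2 : ∀ w : InfinitePlace K, (mult w : ℝ) ≤ 2 := by
    intro w
    have : mult w ≤ 2 := by unfold mult; split_ifs <;> norm_num
    exact_mod_cast this
  have hr1 : 1 ≤ r := by
    rw [hr]; exact_mod_cast Fintype.card_pos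
  have h2 : ∀ w : InfinitePlace K, |Real.log (normAtPlace w v)| ≤ 2 * r * (L + 2 * |A|) + |A| := by
    intro w
    have hAn := abs_nonneg A
    by_cases hw : w = w₀
    · subst hw
      have h5 := log_norm K v hv
      rw [← Finset.add_sum_erase _ _ (Finset.mem_univ (w₀ : InfinitePlace K))] at h5
      have h6 : |∑ w ∈ Finset.univ.erase (w₀ : InfinitePlace K), (mult w : ℝ) * Real.log (normAtPlace w v)| ≤ r * (2 * (L + |A|)) := by
        refine (Finset.abs_sum_le_sum_abs _ _).trans ?_
        have : ∀ w ∈ Finset.univ.erase (w₀ : InfinitePlace K), |(mult w : ℝ) * Real.log (normAtPlace w v)| ≤ 2 * (L + |A|) := by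
          intro w hw
          rw [abs_mul, abs_of_nonneg (by positivity : (0:ℝ) ≤ (mult w : ℝ))]
          have a1 := h1 w (Finset.ne_of_mem_erase hw)
          have a2 := hm2 w
          gcongr
        refine (Finset.sum_le_card_nsmul _ _ _ this).trans ?_
        rw [nsmul_eq_mul]
        gcongr
        rw [hr]
        exact_mod_cast Finset.card_le_univ _
      have hm : (1 : ℝ) ≤ (mult (w₀ : InfinitePlace K) : ℝ) := by
        exact_mod_cast one_le_mult
      have h7 : |(mult (w₀ : InfinitePlace K) : ℝ) * Real.log (normAtPlace w₀ v)| ≤ |A| + r * (2 * (L + |A|)) := by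
        have : (mult (w₀ : InfinitePlace K) : ℝ) * Real.log (normAtPlace w₀ v) = Real.log (mixedEmbedding.norm v) - ∑ w ∈ Finset.univ.erase (w₀ : InfinitePlace K), (mult w : ℝ) * Real.log (normAtPlace w v) := by linarith
        rw [this]
        have h9 := norm_sub_le (Real.log (mixedEmbedding.norm v)) (∑ w ∈ Finset.univ.erase (w₀ : InfinitePlace K), (mult w : ℝ) * Real.log (normAtPlace w v))
        simp only [Real.norm_eq_abs] at h9
        linarith
      rw [abs_mul, abs_of_nonneg (by positivity : (0:ℝ) ≤ (mult (w₀ : InfinitePlace K) : ℝ))] at h7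
      exact bdd_aux1 (abs_nonneg _) hm h7 hAn hr1
    · exact bdd_aux2 (h1 w hw) hAn hr1 hL0
  have h3 : ∀ w : InfinitePlace K, normAtPlace w v ≤ Real.exp (2 * r * (L + 2 * |A|) + |A|) := by
    intro w
    have hw := mixedEmbedding.norm_ne_zero_iff.1 hv w
    have hpos : 0 < normAtPlace w v := lt_of_le_of_ne (normAtPlace_nonneg w v) hw.symm
    rw [← Real.log_le_iff_le_exp hpos]
    exact (le_abs_self _).trans (h2 w)
  rw [norm_eq_sup'_normAtPlace]
  exact Finset.sup'_le _ _ fun w _ => h3 w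

end psi

end HF
end HFM


open Filter Topology
open scoped BigOperators

noncomputable section HFN

namespace HF

open MeasureTheory Set
open scoped ContDiff

/-- cutoff in the norm variable -/
def chi (t : ℝ) : ℝ := Real.smoothTransition (20 * t - 1) * Real.smoothTransition (4 - t)

lemma chi_smooth : ContDiff ℝ ∞ chi := by
  have := Real.smoothTransition.contDiff (n := (⊤ : ℕ∞))
  exact (this.comp ((contDiff_const.mul contDiff_id).sub contDiff_const)).mul (this.comp (contDiff_const.sub contDiff_id))

lemma chi_one {t : ℝ} (h : -2 ≤ Real.log t) (h' : Real.log t ≤ 1) (ht : 0 < t) : chi t = 1 := by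
  have h1 : (1 / 10 : ℝ) ≤ t := by
    rw [Real.le_log_iff_exp_le ht] at h
    refine le_trans ?_ h
    have : Real.exp 1 ≤ 3 := by linarith [Real.exp_one_lt_d9]
    have h2 : Real.exp 2 = Real.exp 1 * Real.exp 1 := by rw [← Real.exp_add]; norm_num
    rw [Real.exp_neg, one_div]
    apply inv_anti₀ (Real.exp_pos _)
    rw [h2]; nlinarith [Real.exp_pos 1]
  have h2 : t ≤ 3 := by
    rw [Real.log_le_iff_le_exp ht] at h'
    linarith [Real.exp_one_lt_d9]
  unfold chi
  rw [Real.smoothTransition.one_of_one_le (by linarith), Real.smoothTransition.one_of_one_le (by linarith), one_mul]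

lemma chi_ne {t : ℝ} (h : chi t ≠ 0) : 1 / 20 ≤ t ∧ t ≤ 4 := by
  unfold chi at h
  constructor
  · by_contra hc
    push Not at hc
    exact h (by rw [Real.smoothTransition.zero_of_nonpos (by linarith), zero_mul])
  · by_contra hc
    push Not at hc
    exact h (by rw [Real.smoothTransition.zero_of_nonpos (x := 4 - t) (by linarith), mul_zero])

section psi
open NumberField NumberField.mixedEmbedding NumberField.InfinitePlace NumberField.Units NumberField.Units.dirichletUnitTheorem
open scoped Classical

variable (K : Type) [Field K] [NumberField K]

lemma psi_ts {v : mixedSpace K} (hv : v ∈ tsupport (psi K chi)) : 1 / 20 ≤ mixedEmbedding.norm v := by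
  have hc : IsClosed {v : mixedSpace K | 1 / 20 ≤ mixedEmbedding.norm v} :=
    isClosed_le continuous_const (mAD K).Nmc
  have : tsupport (psi K chi) ⊆ {v : mixedSpace K | 1 / 20 ≤ mixedEmbedding.norm v} := by
    apply closure_minimal _ hc
    intro v hv
    exact (chi_ne (left_ne_zero_of_mul hv)).1
  exact this hv

lemma psi_ts_ne {v : mixedSpace K} (hv : v ∈ tsupport (psi K chi)) : mixedEmbedding.norm v ≠ 0 := by
  have := psi_ts K hv
  positivity

lemma norm_smooth {v : mixedSpace K} (hv : mixedEmbedding.norm v ≠ 0) :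
    ContDiffAt ℝ ∞ (fun v : mixedSpace K => mixedEmbedding.norm v) v := by
  have h1 := (log_norm_smooth K hv).exp
  apply h1.congr_of_eventuallyEq
  have : ∀ᶠ w : mixedSpace K in 𝓝 v, mixedEmbedding.norm w ≠ 0 :=
    ((mAD K).Nmc.continuousAt).eventually_ne hv
  filter_upwards [this] with w hw
  rw [Real.exp_log]
  exact lt_of_le_of_ne (mixedEmbedding.norm_nonneg w) (Ne.symm hw)

lemma psi_smooth : ContDiff ℝ ∞ (psi K chi) := by
  apply smooth_of_tsupport
  intro v hv
  have h := psi_ts_ne K hv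
  exact (chi_smooth.contDiffAt.comp v (norm_smooth K h)).mul (psi0_smooth K h)

lemma psi_hcs : HasCompactSupport (psi K chi) := by
  obtain ⟨M, hM⟩ := bdd_psi0 K (Real.log 20)
  apply HasCompactSupport.of_support_subset_isCompact (isCompact_closedBall (0 : mixedSpace K) M)
  intro v hv
  rw [mem_closedBall_zero_iff]
  have h1 := chi_ne (left_ne_zero_of_mul hv)
  have hp : 0 < mixedEmbedding.norm v := by linarith
  refine hM v hp.ne' (right_ne_zero_of_mul hv) ?_
  rw [abs_le]
  constructor
  · rw [← Real.log_inv]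
    exact Real.log_le_log (by norm_num) (by linarith)
  · exact Real.log_le_log hp (by linarith)

end psi

/-- shell bumps -/
def gb (a b d y : ℝ) : ℝ := Real.smoothTransition (a - d * y) - Real.smoothTransition (b - d * y)

lemma gb_smooth (a b d : ℝ) : ContDiff ℝ ∞ (gb a b d) := by
  have := Real.smoothTransition.contDiff (n := (⊤ : ℕ∞))
  exact (this.comp (contDiff_const.sub (contDiff_const.mul contDiff_id))).sub
    (this.comp (contDiff_const.sub (contDiff_const.mul contDiff_id)))

lemma iter_S (a d : ℝ) (j : ℕ) (y : ℝ) :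
    iteratedDeriv j (fun y => Real.smoothTransition (a - d * y)) y = (-d) ^ j * iteratedDeriv j Real.smoothTransition (a - d * y) := by
  have h1 : (fun y => Real.smoothTransition (a - d * y)) = fun y => (fun z => Real.smoothTransition (a + z)) ((-d) * y) := by
    funext y; congr 1; ring
  rw [h1, iteratedDeriv_comp_const_mul (f := fun z => Real.smoothTransition (a + z))]
  · rw [iteratedDeriv_comp_const_add]
    simp only [smul_eq_mul]
    congr 2; ring
  · exact (Real.smoothTransition.contDiff (n := j)).comp (contDiff_const.add contDiff_id)

lemma iter_S_zero {j : ℕ} (hj : 1 ≤ j) {z : ℝ} (hz : z ∉ Icc (0:ℝ) 1) : iteratedDeriv j Real.smoothTransition z = 0 := by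
  have : ∃ c : ℝ, Real.smoothTransition =ᶠ[𝓝 z] fun _ => c := by
    rw [mem_Icc, not_and_or] at hz
    push Not at hz
    rcases hz with h | h
    · exact ⟨0, by filter_upwards [Iio_mem_nhds h] with w hw using Real.smoothTransition.zero_of_nonpos (le_of_lt hw)⟩
    · exact ⟨1, by filter_upwards [Ioi_mem_nhds h] with w hw using Real.smoothTransition.one_of_one_le (le_of_lt hw)⟩
  obtain ⟨c, hc⟩ := this
  rw [hc.iteratedDeriv_eq, iteratedDeriv_const]
  simp; omega

lemma iter_S_int {j : ℕ} (hj : 1 ≤ j) : Integrable (iteratedDeriv j Real.smoothTransition) := by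
  apply Continuous.integrable_of_hasCompactSupport
  · exact (Real.smoothTransition.contDiff (n := j)).continuous_iteratedDeriv j le_rfl
  · exact HasCompactSupport.intro isCompact_Icc (fun z hz => iter_S_zero hj hz)

lemma gb_iter (a b : ℝ) {d : ℝ} (hd : 0 < d) {j : ℕ} (hj : 1 ≤ j) :
    ∫ y, |iteratedDeriv j (gb a b d) y| ≤ 2 * d ^ (j - 1) * ∫ z, |iteratedDeriv j Real.smoothTransition z| := by
  have hA : ∀ c : ℝ, Integrable (fun y => (-d) ^ j * iteratedDeriv j Real.smoothTransition (c - d * y)) := by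
    intro c
    apply Integrable.const_mul
    have := ((iter_S_int hj).comp_sub_left c).comp_mul_left' hd.ne'
    simpa using this
  have hI : ∀ c : ℝ, ∫ y, |(-d) ^ j * iteratedDeriv j Real.smoothTransition (c - d * y)| = d ^ (j-1) * ∫ z, |iteratedDeriv j Real.smoothTransition z| := by
    intro c
    simp only [abs_mul, abs_pow, abs_neg, abs_of_pos hd]
    rw [integral_const_mul]
    have h1 := Measure.integral_comp_mul_left (fun z => |iteratedDeriv j Real.smoothTransition (c - z)|) d
    rw [h1, integral_sub_left_eq_self (fun z => |iteratedDeriv j Real.smoothTransition z|) volume c]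
    obtain ⟨i, rfl⟩ : ∃ i, j = i + 1 := ⟨j - 1, by omega⟩
    rw [abs_of_pos (by positivity), smul_eq_mul, Nat.add_sub_cancel]
    field_simp
    try ring
  have hS : ∀ c : ℝ, ContDiff ℝ j (fun y => Real.smoothTransition (c - d * y)) := fun c =>
    (Real.smoothTransition.contDiff (n := j)).comp (contDiff_const.sub (contDiff_const.mul contDiff_id))
  calc ∫ y, |iteratedDeriv j (gb a b d) y| ≤ ∫ y, (|(-d) ^ j * iteratedDeriv j Real.smoothTransition (a - d * y)| + |(-d) ^ j * iteratedDeriv j Real.smoothTransition (b - d * y)|) := by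
        apply integral_mono_of_nonneg
        · exact Eventually.of_forall fun _ => abs_nonneg _
        · exact (hA a).abs.add (hA b).abs
        · refine Eventually.of_forall fun y => ?_
          have : iteratedDeriv j (gb a b d) y = iteratedDeriv j (fun y => Real.smoothTransition (a - d * y)) y - iteratedDeriv j (fun y => Real.smoothTransition (b - d * y)) y := by
            exact iteratedDeriv_fun_sub (hS a).contDiffAt (hS b).contDiffAt
          simp only
          rw [this, iter_S, iter_S]
          exact abs_sub _ _
    _ = _ := by
        rw [integral_add (hA a).abs (hA b).abs, hI, hI]; ring

/-- uniform bounds for the bumps -/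
lemma gb_bound (k : ℕ) : ∃ B : ℝ, 0 ≤ B ∧ ∀ a b d : ℝ, 1 ≤ d → (∀ y, gb a b d y ≠ 0 → -2 ≤ y ∧ y ≤ 1) →
    gnorm 1 (gb a b d) ≤ B ∧ gnorm (k + 1) (gb a b d) ≤ B * d ^ k := by
  set I : ℕ → ℝ := fun j => ∫ z, |iteratedDeriv j Real.smoothTransition z| with hI
  have hI0 : ∀ j, 0 ≤ I j := fun j => integral_nonneg fun _ => abs_nonneg _
  have h0 : ∀ a b d : ℝ, (∀ y, gb a b d y ≠ 0 → -2 ≤ y ∧ y ≤ 1) → ∫ y, |iteratedDeriv 0 (gb a b d) y| ≤ 3 := by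
    intro a b d h
    simp only [iteratedDeriv_zero]
    have : ∫ y, |gb a b d y| ≤ ∫ y, (Icc (-2:ℝ) 1).indicator (fun _ => (1:ℝ)) y := by
      apply integral_mono_of_nonneg
      · exact Eventually.of_forall fun _ => abs_nonneg _
      · exact (integrable_indicator_iff measurableSet_Icc).mpr (by simp)
      · refine Eventually.of_forall fun y => ?_
        by_cases hy : gb a b d y = 0
        · simp only [hy, abs_zero]
          exact indicator_nonneg (by simp) _
        · simp only
          rw [indicator_of_mem (by exact h y hy)]
          unfold gb
          rw [abs_le]
          constructor <;> linarith [Real.smoothTransition.nonneg (a - d*y), Real.smoothTransition.le_one (a - d*y), Real.smoothTransition.nonneg (b - d*y), Real.smoothTransition.le_one (b - d*y)]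
    refine this.trans ?_
    rw [integral_indicator measurableSet_Icc]
    simp; norm_num
  have key : ∀ (k : ℕ) (a b d : ℝ), 1 ≤ d → (∀ y, gb a b d y ≠ 0 → -2 ≤ y ∧ y ≤ 1) →
      gnorm (k+1) (gb a b d) ≤ (3 + ∑ j ∈ Finset.range (k+1), 2 * I (j+1)) * d ^ k := by
    intro k a b d hd h
    unfold gnorm
    rw [Finset.sum_range_succ', add_comm, add_mul]
    have hd1 : 1 ≤ d ^ k := one_le_pow₀ hd
    refine add_le_add ((h0 a b d h).trans (by linarith)) ?_
    rw [Finset.sum_mul]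
    apply Finset.sum_le_sum
    intro j hj
    refine (gb_iter a b (by linarith) (by omega)).trans ?_
    have : d ^ (j + 1 - 1) ≤ d ^ k := pow_le_pow_right₀ hd (by simp at hj; omega)
    have := mul_le_mul_of_nonneg_left this (hI0 (j+1))
    change 2 * d ^ (j + 1 - 1) * I (j+1) ≤ _
    linarith
  refine ⟨(3 + ∑ j ∈ Finset.range (k+1), 2 * I (j+1)), by have := Finset.sum_nonneg (s := Finset.range (k+1)) (fun j _ => hI0 (j+1)); rw [← Finset.mul_sum]; linarith, fun a b d hd h => ⟨?_, key k a b d hd h⟩⟩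
  have := key 0 a b d hd h
  rw [pow_zero, mul_one] at this
  refine this.trans ?_
  have : ∑ j ∈ Finset.range (0+1), 2 * I (j+1) ≤ ∑ j ∈ Finset.range (k+1), 2 * I (j+1) :=
    Finset.sum_le_sum_of_subset_of_nonneg (by simp) (fun j _ _ => by linarith [hI0 (j+1)])
  linarith

end HF

end HFN


open Filter Topology
open scoped BigOperators

noncomputable section HFO

namespace HF

open MeasureTheory Set
open scoped ContDiff

section ideals
open NumberField NumberField.mixedEmbedding NumberField.InfinitePlace NumberField.Units NumberField.Units.dirichletUnitTheorem
open scoped Classical nonZeroDivisors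

variable (K : Type) [Field K] [NumberField K]

/-- ideals in a class -/
abbrev SC (C : ClassGroup (𝓞 K)) := {I : (Ideal (𝓞 K))⁰ // ClassGroup.mk0 I = C}

variable {K}

lemma exists_gen {C : ClassGroup (𝓞 K)} {J : (Ideal (𝓞 K))⁰} (hJ : ClassGroup.mk0 J = C⁻¹) (I : SC K C) :
    ∃ α : 𝓞 K, Ideal.span {α} = (I.1 : Ideal (𝓞 K)) * J := by
  have h1 : ClassGroup.mk0 (I.1 * J) = 1 := by rw [map_mul, I.2, hJ, mul_inv_cancel]
  have h2 := (ClassGroup.mk0_eq_one_iff (I.1 * J).2).1 h1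
  obtain ⟨a, ha⟩ := h2.principal
  exact ⟨a, ha.symm⟩

/-- coordinates of the lattice -/
def eJ (J : (Ideal (𝓞 K))⁰) : (Module.Free.ChooseBasisIndex ℤ (FractionalIdeal.mk0 K J).1 → ℤ) ≃ (FractionalIdeal.mk0 K J).1 :=
  (fractionalIdealBasis K (FractionalIdeal.mk0 K J).1).equivFun.symm.toEquiv

lemma phi_eJ (J : (Ideal (𝓞 K))⁰) (n) :
    AD.phi (fractionalIdealLatticeBasis K (FractionalIdeal.mk0 K J)) (iv n) = mixedEmbedding K (eJ J n : K) := by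
  have h1 : AD.phi (fractionalIdealLatticeBasis K (FractionalIdeal.mk0 K J)) (iv n) =
    ∑ i, (n i : ℝ) • fractionalIdealLatticeBasis K (FractionalIdeal.mk0 K J) i := by
    simp only [AD.phi]
    exact Module.Basis.equivFun_symm_apply _ _
  rw [h1]
  have h2 : (eJ J n : K) = ∑ i, n i • basisOfFractionalIdeal K (FractionalIdeal.mk0 K J) i := by
    simp only [eJ, basisOfFractionalIdeal_apply]
    change (((fractionalIdealBasis K (FractionalIdeal.mk0 K J).1).equivFun.symm n : (FractionalIdeal.mk0 K J).1) : K) = _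
    rw [Module.Basis.equivFun_symm_apply]
    have := map_sum ((Submodule.subtype ((FractionalIdeal.mk0 K J).1 : Submodule (𝓞 K) K)).restrictScalars ℤ) (fun i => n i • (fractionalIdealBasis K (FractionalIdeal.mk0 K J).1) i) Finset.univ
    exact this.trans (Finset.sum_congr rfl fun i _ => map_zsmul ((Submodule.subtype ((FractionalIdeal.mk0 K J).1 : Submodule (𝓞 K) K)).restrictScalars ℤ) (n i) _)
  rw [h2, map_sum]
  refine Finset.sum_congr rfl fun i _ => ?_
  rw [fractionalIdealLatticeBasis_apply, map_zsmul, Int.cast_smul_eq_zsmul]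

lemma eJ_surj (J : (Ideal (𝓞 K))⁰) {α : 𝓞 K} (h : α ∈ (J : Ideal (𝓞 K))) : ∃ n, (eJ J n : K) = α := by
  have : (α : K) ∈ (FractionalIdeal.mk0 K J).1 := by
    rw [FractionalIdeal.coe_mk0, FractionalIdeal.mem_coeIdeal]
    exact ⟨α, h, rfl⟩
  exact ⟨(eJ J).symm ⟨_, this⟩, by rw [Equiv.apply_symm_apply]⟩

lemma eJ_mem (J : (Ideal (𝓞 K))⁰) (n) : ∃ α : 𝓞 K, α ∈ (J : Ideal (𝓞 K)) ∧ (eJ J n : K) = α := by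
  have key : ∀ x ∈ (FractionalIdeal.mk0 K J).1, ∃ α ∈ (J : Ideal (𝓞 K)), algebraMap (𝓞 K) K α = x := by
    intro x hx
    rw [FractionalIdeal.coe_mk0, FractionalIdeal.mem_coeIdeal] at hx
    exact hx
  obtain ⟨a, ha, h⟩ := key _ (eJ J n).2
  exact ⟨a, ha, h.symm⟩

lemma norm_gen {I J : Ideal (𝓞 K)} {α : 𝓞 K} (h : Ideal.span {α} = I * J) :
    mixedEmbedding.norm (mixedEmbedding K (α : K)) = (Ideal.absNorm I : ℝ) * Ideal.absNorm J := by
  have h1 : Ideal.absNorm (Ideal.span {α}) = Ideal.absNorm I * Ideal.absNorm J := by rw [h, map_mul]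
  rw [Ideal.absNorm_span_singleton] at h1
  rw [mixedEmbedding.norm_eq_norm, ← Nat.cast_mul, ← h1, Nat.cast_natAbs, ← Algebra.coe_norm_int]
  push_cast
  rfl

lemma psi_g (g : ℝ → ℝ) (hg : ∀ y, g y ≠ 0 → -2 ≤ y ∧ y ≤ 1) {v : mixedSpace K} (hv : mixedEmbedding.norm v ≠ 0) :
    (mAD K).GG (psi K chi) g v = psi0 K v * g (Real.log (mixedEmbedding.norm v)) := by
  have : (mAD K).Nm v = mixedEmbedding.norm v := rfl
  unfold AD.GG psi
  rw [this]
  by_cases h : g (Real.log (mixedEmbedding.norm v)) = 0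
  · rw [h, mul_zero, mul_zero]
  · rw [chi_one (hg _ h).1 (hg _ h).2 (lt_of_le_of_ne (mixedEmbedding.norm_nonneg v) (Ne.symm hv)), one_mul]

lemma finite_SC (C : ClassGroup (𝓞 K)) (x : ℝ) : {I : SC K C | (Ideal.absNorm (I.1 : Ideal (𝓞 K)) : ℝ) ≤ x}.Finite := by
  have h := Ideal.finite_setOfPred_absNorm_le₀ (S := 𝓞 K) ⌊x⌋₊
  have h2 : {I : (Ideal (𝓞 K))⁰ | Ideal.absNorm (I : Ideal (𝓞 K)) ≤ ⌊x⌋₊}.Finite := h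
  refine (h2.preimage (f := fun I : SC K C => I.1) (Subtype.val_injective.injOn)).subset ?_
  intro I hI
  exact Nat.le_floor hI

set_option maxHeartbeats 1000000 in
lemma ideal_sum {C : ClassGroup (𝓞 K)} {J : (Ideal (𝓞 K))⁰} (hJ : ClassGroup.mk0 J = C⁻¹) {g : ℝ → ℝ}
    (hg : ∀ y, g y ≠ 0 → -2 ≤ y ∧ y ≤ 1) {X R : ℝ} (hX : 0 < X) (hR : 0 < R)
    (hRX : R ^ (Module.finrank ℚ K) = X * Ideal.absNorm (J : Ideal (𝓞 K))) :
    ∑' n, (mAD K).GG (psi K chi) g (R⁻¹ • AD.phi (fractionalIdealLatticeBasis K (FractionalIdeal.mk0 K J)) (iv n)) =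
      torsionOrder K * ∑' I : SC K C, g (Real.log (Ideal.absNorm (I.1 : Ideal (𝓞 K)) / X)) := by
  choose al hal using exists_gen hJ
  have hNJ : (0:ℝ) < Ideal.absNorm (J : Ideal (𝓞 K)) := by
    exact_mod_cast Ideal.absNorm_pos_of_nonZeroDivisors J
  have hNI : ∀ I : SC K C, (0:ℝ) < Ideal.absNorm (I.1 : Ideal (𝓞 K)) := fun I => by
    exact_mod_cast Ideal.absNorm_pos_of_nonZeroDivisors I.1
  set V : SC K C → mixedSpace K := fun I => mixedEmbedding K (al I : K) with hV
  have hVn : ∀ I : SC K C, mixedEmbedding.norm (V I) = (Ideal.absNorm (I.1 : Ideal (𝓞 K)) : ℝ) * Ideal.absNorm (J : Ideal (𝓞 K)) :=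
    fun I => norm_gen (hal I)
  have hV0 : ∀ I : SC K C, mixedEmbedding.norm (V I) ≠ 0 := fun I => by rw [hVn]; exact (mul_pos (hNI I) hNJ).ne'
  have hal0 : ∀ I : SC K C, al I ≠ 0 := by
    intro I h
    apply hV0 I
    simp only [hV]
    rw [h]
    simp
  have hmem : ∀ (I : SC K C) (u : (𝓞 K)ˣ), (u : 𝓞 K) * al I ∈ (J : Ideal (𝓞 K)) := by
    intro I u
    apply Ideal.mul_mem_left
    have : al I ∈ Ideal.span {al I} := Ideal.mem_span_singleton_self _
    rw [hal I] at this
    exact (Ideal.mul_le_right : (I.1 : Ideal (𝓞 K)) * (J : Ideal (𝓞 K)) ≤ J) this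
  choose f hf using fun p : SC K C × (𝓞 K)ˣ => eJ_surj J (hmem p.1 p.2)
  have hphi : ∀ p, AD.phi (fractionalIdealLatticeBasis K (FractionalIdeal.mk0 K J)) (iv (f p)) = p.2 • V p.1 := by
    intro p
    rw [phi_eJ, hf, unitSMul_smul, hV]
    push_cast
    rw [map_mul]
  have hspan : ∀ p : SC K C × (𝓞 K)ˣ, Ideal.span {(p.2 : 𝓞 K) * al p.1} = (p.1.1 : Ideal (𝓞 K)) * J := by
    intro p
    rw [← hal, Ideal.span_singleton_mul_left_unit p.2.isUnit]
  have hinj : Function.Injective f := by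
    intro p q h
    have h1 : ((p.2 : 𝓞 K) * al p.1 : 𝓞 K) = (q.2 : 𝓞 K) * al q.1 := by
      apply RingOfIntegers.ext
      have := hf p
      rw [h, hf q] at this
      exact this.symm
    have h2 : p.1 = q.1 := by
      have h3 := hspan p
      rw [h1, hspan q] at h3
      have h4 := mul_right_cancel₀ (nonZeroDivisors.coe_ne_zero J) h3
      exact Subtype.ext (Subtype.ext h4.symm)
    rw [h2] at h1
    exact Prod.ext h2 (Units.ext (mul_right_cancel₀ (hal0 _) h1))
  set F := fun n => (mAD K).GG (psi K chi) g (R⁻¹ • AD.phi (fractionalIdealLatticeBasis K (FractionalIdeal.mk0 K J)) (iv n)) with hF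
  have hsupp : Function.support F ⊆ Set.range f := by
    intro n hn
    obtain ⟨β, hβ, he⟩ := eJ_mem J n
    have hβ0 : β ≠ 0 := by
      rintro rfl
      apply hn
      simp only [hF]
      rw [phi_eJ, he]
      simp [AD.GG, psi, chi, Real.smoothTransition.zero_of_nonpos]
    have hdvd : (J : Ideal (𝓞 K)) ∣ Ideal.span {β} := by
      rw [Ideal.dvd_span_singleton]; exact hβ
    obtain ⟨I0, hI0⟩ := hdvd
    have hI00 : I0 ≠ 0 := by
      rintro rfl
      rw [mul_zero] at hI0
      exact hβ0 (Ideal.span_singleton_eq_bot.1 hI0)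
    let I1 : (Ideal (𝓞 K))⁰ := ⟨I0, mem_nonZeroDivisors_of_ne_zero hI00⟩
    have hcl : ClassGroup.mk0 I1 = C := by
      have h1 : ClassGroup.mk0 (J * I1) = 1 := by
        rw [ClassGroup.mk0_eq_one_iff (J * I1).2]
        refine ⟨⟨β, ?_⟩⟩
        exact hI0.symm
      rw [map_mul, hJ, inv_mul_eq_one] at h1
      exact h1.symm
    have h2 : Ideal.span {β} = Ideal.span {al ⟨I1, hcl⟩} := by
      rw [hal, hI0, mul_comm]
    rw [Ideal.span_singleton_eq_span_singleton] at h2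
    obtain ⟨u, hu⟩ := h2.symm
    refine ⟨(⟨I1, hcl⟩, u), ?_⟩
    apply (eJ J).injective
    apply Subtype.ext
    rw [hf, he, ← hu]
    push_cast
    rw [mul_comm]
  have hFf : ∀ p : SC K C × (𝓞 K)ˣ, F (f p) = psi0 K (p.2 • V p.1) * g (Real.log (Ideal.absNorm (p.1.1 : Ideal (𝓞 K)) / X)) := by
    intro p
    have h0 : mixedEmbedding.norm (p.2 • V p.1) ≠ 0 := by rw [norm_unit_smul]; exact hV0 _
    have h1 : mixedEmbedding.norm (R⁻¹ • p.2 • V p.1) = Ideal.absNorm (p.1.1 : Ideal (𝓞 K)) / X := by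
      rw [mixedEmbedding.norm_smul, norm_unit_smul, hVn, abs_of_pos (inv_pos.2 hR), inv_pow, hRX]
      field_simp
    have h2 : mixedEmbedding.norm (R⁻¹ • p.2 • V p.1) ≠ 0 := by
      rw [h1]; exact (div_pos (hNI _) hX).ne'
    simp only [hF]
    rw [hphi, psi_g g hg h2, h1, psi0_smul K h0 (inv_pos.2 hR).ne']
  have hfin : (Function.support fun I : SC K C => g (Real.log (Ideal.absNorm (I.1 : Ideal (𝓞 K)) / X))).Finite := by
    refine (finite_SC C (Real.exp 1 * X)).subset ?_
    intro I hI
    have := (hg _ hI).2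
    rw [Real.log_le_iff_le_exp (div_pos (hNI I) hX), div_le_iff₀ hX] at this
    exact this
  have hp : ∀ I : SC K C, HasSum (fun u : (𝓞 K)ˣ => F (f (I, u))) (torsionOrder K * g (Real.log (Ideal.absNorm (I.1 : Ideal (𝓞 K)) / X))) := by
    intro I
    simp only [hFf]
    exact (psi0_sum K (hV0 I)).mul_right _
  have hsum : Summable (F ∘ f) := by
    apply Summable.of_norm
    rw [summable_prod_of_nonneg (fun _ => norm_nonneg _)]
    refine ⟨fun I => (hp I).summable.norm, ?_⟩
    apply summable_of_hasFiniteSupport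
    refine hfin.subset ?_
    intro I hI h
    apply hI
    have h' : g (Real.log (Ideal.absNorm (I.1 : Ideal (𝓞 K)) / X)) = 0 := h
    have : ∀ u, (F ∘ f) (I, u) = 0 := fun u => by rw [Function.comp_apply, hFf, h', mul_zero]
    simp only [this, norm_zero, tsum_zero]
  rw [← hinj.tsum_eq hsupp]
  have := hsum.tsum_prod' (fun I => (hp I).summable)
  simp only [Function.comp_def] at this
  rw [this, ← tsum_mul_left]
  exact tsum_congr fun I => (hp I).tsum_eq

end ideals

end HF

end HFO


open Filter Topology
open scoped BigOperators

noncomputable section HFP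

namespace HF

open MeasureTheory Set
open scoped ContDiff

section abs
variable {S : Type*} (w : S → ℝ)

/-- counting function -/
def TT (X : ℝ) : ℝ := Nat.card {s // w s ≤ X}

open scoped Classical in
/-- indicator of `w ≤ X` -/
def I1 (X : ℝ) (s : S) : ℝ := if w s ≤ X then (1:ℝ) else 0

variable {w}

lemma I1_fin (hfin : ∀ x, {s | w s ≤ x}.Finite) (X : ℝ) : (Function.support (I1 w X)).Finite := by
  refine (hfin X).subset ?_
  intro s hs
  by_contra h
  exact hs (if_neg h)

lemma I1_sum (hfin : ∀ x, {s | w s ≤ x}.Finite) (X : ℝ) : Summable (I1 w X) :=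
  summable_of_hasFiniteSupport (I1_fin hfin X)

lemma TT_eq (hfin : ∀ x, {s | w s ≤ x}.Finite) (X : ℝ) : TT w X = ∑' s, I1 w X s := by
  rw [tsum_eq_sum (s := (hfin X).toFinset)]
  · rw [Finset.sum_congr rfl (g := fun _ => (1:ℝ))]
    · simp only [Finset.sum_const, nsmul_eq_mul, mul_one, TT]
      have : Nat.card {s // w s ≤ X} = (hfin X).toFinset.card := by
        rw [← Set.ncard_eq_toFinset_card _ (hfin X)]; rfl
      rw [this]
    · intro s hs
      have : w s ≤ X := by simpa using hs
      exact if_pos this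
  · intro s hs
    have : ¬ w s ≤ X := by simpa using hs
    exact if_neg this

lemma TT_diff (hfin : ∀ x, {s | w s ≤ x}.Finite) (X Y : ℝ) : TT w X - TT w Y = ∑' s, (I1 w X s - I1 w Y s) := by
  rw [TT_eq hfin, TT_eq hfin, (I1_sum hfin X).tsum_sub (I1_sum hfin Y)]

lemma I1_diff {X Y : ℝ} (h : Y ≤ X) (s : S) : I1 w X s - I1 w Y s = (Ioc Y X).indicator (fun _ => (1:ℝ)) (w s) := by
  unfold I1
  by_cases h1 : w s ≤ Y
  · rw [if_pos h1, if_pos (h1.trans h), indicator_of_notMem (by simp [h1]), sub_self]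
  · by_cases h2 : w s ≤ X
    · rw [if_neg h1, if_pos h2, indicator_of_mem (show w s ∈ Ioc Y X from ⟨not_le.1 h1, h2⟩), sub_zero]
    · rw [if_neg h1, if_neg h2, indicator_of_notMem (by simp [h2]), sub_zero]

lemma gp_bounds {d : ℝ} (hd : 2 ≤ d) (y : ℝ) : (-1 < y → y ≤ 0 → gb 1 (-d) d y = 1) ∧ 0 ≤ gb 1 (-d) d y ∧ gb 1 (-d) d y ≤ 1 ∧
    (gb 1 (-d) d y ≠ 0 → -1 - d⁻¹ < y ∧ y < d⁻¹) := by
  have hS1 := Real.smoothTransition.le_one (1 - d * y)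
  have hS2 := Real.smoothTransition.nonneg (-d - d * y)
  have hm := Real.smoothTransition.monotone (show -d - d * y ≤ 1 - d * y by linarith)
  refine ⟨fun h1 h2 => ?_, ?_, ?_, fun h => ⟨?_, ?_⟩⟩
  · unfold gb
    rw [Real.smoothTransition.one_of_one_le (by nlinarith), Real.smoothTransition.zero_of_nonpos (by nlinarith), sub_zero]
  · unfold gb; linarith
  · unfold gb; linarith
  · by_contra hc
    push Not at hc
    apply h
    have : d * y ≤ d * (-1 - d⁻¹) := mul_le_mul_of_nonneg_left hc (by linarith)
    have h3 : d * d⁻¹ = 1 := mul_inv_cancel₀ (by linarith)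
    unfold gb
    rw [Real.smoothTransition.one_of_one_le (by nlinarith), Real.smoothTransition.one_of_one_le (by nlinarith), sub_self]
  · by_contra hc
    push Not at hc
    apply h
    have : d * d⁻¹ ≤ d * y := mul_le_mul_of_nonneg_left hc (by linarith)
    have h3 : d * d⁻¹ = 1 := mul_inv_cancel₀ (by linarith)
    unfold gb
    rw [Real.smoothTransition.zero_of_nonpos (by nlinarith), Real.smoothTransition.zero_of_nonpos (by nlinarith), sub_self]

lemma gm_bounds {d : ℝ} (hd : 2 ≤ d) (y : ℝ) : (-1 + d⁻¹ < y → y ≤ -d⁻¹ → gb 0 (1 - d) d y = 1) ∧ 0 ≤ gb 0 (1 - d) d y ∧ gb 0 (1 - d) d y ≤ 1 ∧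
    (gb 0 (1 - d) d y ≠ 0 → -1 < y ∧ y < 0) := by
  have hS1 := Real.smoothTransition.le_one (0 - d * y)
  have hS2 := Real.smoothTransition.nonneg (1 - d - d * y)
  have hm := Real.smoothTransition.monotone (show 1 - d - d * y ≤ 0 - d * y by linarith)
  have h3 : d * d⁻¹ = 1 := mul_inv_cancel₀ (by linarith)
  refine ⟨fun h1 h2 => ?_, ?_, ?_, fun h => ⟨?_, ?_⟩⟩
  · unfold gb
    have h4 : d * y ≤ d * (-d⁻¹) := mul_le_mul_of_nonneg_left h2 (by linarith)
    have h5 : d * (-1 + d⁻¹) ≤ d * y := mul_le_mul_of_nonneg_left h1.le (by linarith)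
    rw [Real.smoothTransition.one_of_one_le (by nlinarith), Real.smoothTransition.zero_of_nonpos (by nlinarith), sub_zero]
  · unfold gb; linarith
  · unfold gb; linarith
  · by_contra hc
    push Not at hc
    apply h
    unfold gb
    rw [Real.smoothTransition.one_of_one_le (by nlinarith), Real.smoothTransition.one_of_one_le (by nlinarith), sub_self]
  · by_contra hc
    push Not at hc
    apply h
    unfold gb
    rw [Real.smoothTransition.zero_of_nonpos (by nlinarith), Real.smoothTransition.zero_of_nonpos (by nlinarith), sub_self]

lemma TT_lim {κ : ℝ} (hlim : Tendsto (fun x => TT w x / x) atTop (𝓝 κ)) {c : ℝ} (hc : 0 < c) :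
    Tendsto (fun X => TT w (X * c) / X) atTop (𝓝 (κ * c)) := by
  have h1 := (hlim.comp (tendsto_id.atTop_mul_const hc)).mul_const c
  refine h1.congr' ?_
  filter_upwards [eventually_gt_atTop 0] with X hX
  simp only [Function.comp, id]
  field_simp

lemma log_mem {x X a b : ℝ} (hx : 0 < x) (hX : 0 < X) : x ∈ Ioc (X * Real.exp a) (X * Real.exp b) ↔ a < Real.log (x / X) ∧ Real.log (x / X) ≤ b := by
  have h : 0 < x / X := div_pos hx hX
  rw [Real.lt_log_iff_exp_lt h, Real.log_le_iff_le_exp h, lt_div_iff₀ hX, div_le_iff₀ hX, mem_Ioc, mul_comm X, mul_comm X]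

lemma le_of_asymp {κ p q c : ℝ} (hlim : Tendsto (fun x => TT w x / x) atTop (𝓝 κ)) (hp : 0 < p) (hq : 0 < q)
    {μ : ℝ} {Sg : ℝ → ℝ} (h1 : ∀ X ≥ 1, |Sg X - μ * X| ≤ c) (h2 : ∀ X ≥ 1, Sg X ≤ TT w (X * p) - TT w (X * q)) :
    μ ≤ κ * p - κ * q := by
  have hl : Tendsto (fun X : ℝ => TT w (X * p) / X - TT w (X * q) / X + c * X⁻¹) atTop (𝓝 (κ * p - κ * q + c * 0)) :=
    ((TT_lim hlim hp).sub (TT_lim hlim hq)).add (tendsto_inv_atTop_zero.const_mul c)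
  rw [mul_zero, add_zero] at hl
  refine ge_of_tendsto hl ?_
  filter_upwards [eventually_ge_atTop 1] with X hX
  have hX0 : 0 < X := by linarith
  have h3 := (abs_le.1 (h1 X hX)).1
  have h4 := h2 X hX
  have : μ * X ≤ TT w (X * p) - TT w (X * q) + c := by linarith
  rw [← le_div_iff₀ hX0] at this
  refine this.trans (le_of_eq ?_)
  field_simp

lemma ge_of_asymp {κ p q c : ℝ} (hlim : Tendsto (fun x => TT w x / x) atTop (𝓝 κ)) (hp : 0 < p) (hq : 0 < q)
    {μ : ℝ} {Sg : ℝ → ℝ} (h1 : ∀ X ≥ 1, |Sg X - μ * X| ≤ c) (h2 : ∀ X ≥ 1, TT w (X * p) - TT w (X * q) ≤ Sg X) :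
    κ * p - κ * q ≤ μ := by
  have hl : Tendsto (fun X : ℝ => TT w (X * p) / X - TT w (X * q) / X - c * X⁻¹) atTop (𝓝 (κ * p - κ * q - c * 0)) :=
    ((TT_lim hlim hp).sub (TT_lim hlim hq)).sub (tendsto_inv_atTop_zero.const_mul c)
  rw [mul_zero, sub_zero] at hl
  refine le_of_tendsto hl ?_
  filter_upwards [eventually_ge_atTop 1] with X hX
  have hX0 : 0 < X := by linarith
  have h3 := (abs_le.1 (h1 X hX)).2
  have h4 := h2 X hX
  have : TT w (X * p) - TT w (X * q) - c ≤ μ * X := by linarith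
  rw [← div_le_iff₀ hX0] at this
  refine le_trans (le_of_eq ?_) this
  field_simp

lemma shell_bound (hw : ∀ s, 1 ≤ w s) (hfin : ∀ x, {s | w s ≤ x}.Finite) {κ : ℝ} (hκ : 0 ≤ κ)
    (hlim : Tendsto (fun x => TT w x / x) atTop (𝓝 κ)) {E C0 : ℝ}
    (hsm : ∀ a b d : ℝ, 1 ≤ d → (∀ y, gb a b d y ≠ 0 → -2 ≤ y ∧ y ≤ 1) → ∃ μ : ℝ, ∀ X ≥ 1,
      |∑' s, gb a b d (Real.log (w s / X)) - μ * X| ≤ C0 * d ^ E) {d : ℝ} (hd : 2 ≤ d) {X : ℝ} (hX : 1 ≤ X) :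
    |TT w X - TT w (X * Real.exp (-1)) - κ * (1 - Real.exp (-1)) * X| ≤ 3 * κ * d⁻¹ * X + C0 * d ^ E := by
  have hd1 : d⁻¹ ≤ 1 / 2 := by rw [inv_le_comm₀ (by linarith) (by norm_num)]; simpa using hd
  have hd0 : 0 < d⁻¹ := inv_pos.2 (by linarith)
  have hw0 : ∀ s, 0 < w s := fun s => lt_of_lt_of_le one_pos (hw s)
  -- summability
  have hgs : ∀ (g : ℝ → ℝ) (X : ℝ), 0 < X → (∀ y, g y ≠ 0 → -2 ≤ y ∧ y ≤ 1) → Summable (fun s => g (Real.log (w s / X))) := by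
    intro g X hX hg
    apply summable_of_hasFiniteSupport
    refine (hfin (Real.exp 1 * X)).subset ?_
    intro s hs
    have := (hg _ hs).2
    rw [Real.log_le_iff_le_exp (div_pos (hw0 s) hX), div_le_iff₀ hX] at this
    exact this
  have hds : ∀ X Y, Summable (fun s => I1 w X s - I1 w Y s) := fun X Y => (I1_sum hfin X).sub (I1_sum hfin Y)
  have hcp : ∀ y, gb 1 (-d) d y ≠ 0 → -2 ≤ y ∧ y ≤ 1 := fun y hy => by
    have := (gp_bounds hd y).2.2.2 hy
    constructor <;> linarith
  have hcm : ∀ y, gb 0 (1-d) d y ≠ 0 → -2 ≤ y ∧ y ≤ 1 := fun y hy => by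
    have := (gm_bounds hd y).2.2.2 hy
    constructor <;> linarith
  obtain ⟨μp, hp⟩ := hsm 1 (-d) d (by linarith) hcp
  obtain ⟨μm, hm⟩ := hsm 0 (1-d) d (by linarith) hcm
  -- comparison lemmas
  have up : ∀ (g : ℝ → ℝ) (a b X : ℝ), a ≤ b → 0 < X → (∀ y, g y ≠ 0 → -2 ≤ y ∧ y ≤ 1) → (∀ y, g y ≤ 1) → (∀ y, g y ≠ 0 → a < y ∧ y ≤ b) →
      ∑' s, g (Real.log (w s / X)) ≤ TT w (X * Real.exp b) - TT w (X * Real.exp a) := by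
    intro g a b X hab hX hg h1 h2
    rw [TT_diff hfin]
    refine (hgs g X hX hg).tsum_le_tsum (fun s => ?_) (hds _ _)
    rw [I1_diff (mul_le_mul_of_nonneg_left (Real.exp_le_exp.2 hab) hX.le)]
    by_cases h : g (Real.log (w s / X)) = 0
    · rw [h]; exact indicator_nonneg (by simp) _
    · rw [indicator_of_mem ((log_mem (hw0 s) hX).2 (h2 _ h))]; exact h1 _
  have dn : ∀ (g : ℝ → ℝ) (a b X : ℝ), a ≤ b → 0 < X → (∀ y, g y ≠ 0 → -2 ≤ y ∧ y ≤ 1) → (∀ y, 0 ≤ g y) → (∀ y, a < y → y ≤ b → g y = 1) →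
      TT w (X * Real.exp b) - TT w (X * Real.exp a) ≤ ∑' s, g (Real.log (w s / X)) := by
    intro g a b X hab hX hg h1 h2
    rw [TT_diff hfin]
    refine (hds _ _).tsum_le_tsum (fun s => ?_) (hgs g X hX hg)
    rw [I1_diff (mul_le_mul_of_nonneg_left (Real.exp_le_exp.2 hab) hX.le)]
    by_cases h : w s ∈ Ioc (X * Real.exp a) (X * Real.exp b)
    · rw [indicator_of_mem h]
      rw [log_mem (hw0 s) hX] at h
      rw [h2 _ h.1 h.2]
    · rw [indicator_of_notMem h]; exact h1 _
  have hμp : μp ≤ κ * Real.exp d⁻¹ - κ * Real.exp (-1 - d⁻¹) :=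
    le_of_asymp hlim (Real.exp_pos _) (Real.exp_pos _) hp (fun X hX => up _ _ _ X (by linarith) (by linarith) hcp
      (fun y => (gp_bounds hd y).2.2.1) (fun y hy => ⟨((gp_bounds hd y).2.2.2 hy).1, ((gp_bounds hd y).2.2.2 hy).2.le⟩))
  have hμm : κ * Real.exp (-d⁻¹) - κ * Real.exp (-1 + d⁻¹) ≤ μm :=
    ge_of_asymp hlim (Real.exp_pos _) (Real.exp_pos _) hm (fun X hX => dn _ _ _ X (by linarith) (by linarith) hcm
      (fun y => (gm_bounds hd y).2.1) (fun y => (gm_bounds hd y).1))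
  have hX0 : 0 < X := by linarith
  have u1 := up _ (-1) 0 X (by norm_num) hX0 hcm (fun y => (gm_bounds hd y).2.2.1) (fun y hy => ⟨((gm_bounds hd y).2.2.2 hy).1, ((gm_bounds hd y).2.2.2 hy).2.le⟩)
  have u2 := dn _ (-1) 0 X (by norm_num) hX0 hcp (fun y => (gp_bounds hd y).2.1) (fun y => (gp_bounds hd y).1)
  rw [Real.exp_zero, mul_one] at u1 u2
  -- numeric
  have e1 : Real.exp d⁻¹ ≤ 1 + 2 * d⁻¹ := by
    have := Real.abs_exp_sub_one_le (x := d⁻¹) (by rw [abs_of_pos hd0]; linarith)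
    rw [abs_of_pos hd0] at this
    linarith [(abs_le.1 this).2]
  have e2 : 1 - d⁻¹ ≤ Real.exp (-d⁻¹) := by linarith [Real.add_one_le_exp (-d⁻¹)]
  have e3 : Real.exp (-1) ≤ 1 / 2 := by
    rw [Real.exp_neg, inv_le_comm₀ (Real.exp_pos _) (by norm_num)]
    have := Real.add_one_le_exp 1
    norm_num at this ⊢; linarith
  have e0 := Real.exp_pos (-1)
  have e4 : Real.exp (-1 - d⁻¹) = Real.exp (-1) * Real.exp (-d⁻¹) := by rw [← Real.exp_add]; ring_nf
  have e5 : Real.exp (-1 + d⁻¹) = Real.exp (-1) * Real.exp (d⁻¹) := by rw [← Real.exp_add]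
  have hμp' : μp ≤ κ * (1 - Real.exp (-1)) + 3 * κ * d⁻¹ := by
    refine hμp.trans ?_
    rw [e4]
    have : Real.exp d⁻¹ - Real.exp (-1) * Real.exp (-d⁻¹) ≤ 1 - Real.exp (-1) + 3 * d⁻¹ := by nlinarith
    nlinarith [mul_le_mul_of_nonneg_left this hκ]
  have hμm' : κ * (1 - Real.exp (-1)) - 3 * κ * d⁻¹ ≤ μm := by
    refine le_trans ?_ hμm
    rw [e5]
    have : 1 - Real.exp (-1) - 3 * d⁻¹ ≤ Real.exp (-d⁻¹) - Real.exp (-1) * Real.exp (d⁻¹) := by nlinarith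
    nlinarith [mul_le_mul_of_nonneg_left this hκ]
  have p1 := (abs_le.1 (hp X hX)).2
  have p2 := (abs_le.1 (hm X hX)).1
  have q1 := mul_le_mul_of_nonneg_right hμp' hX0.le
  have q2 := mul_le_mul_of_nonneg_right hμm' hX0.le
  rw [abs_le]
  constructor <;> nlinarith

lemma landau_abs (hw : ∀ s, 1 ≤ w s) (hfin : ∀ x, {s | w s ≤ x}.Finite) {κ : ℝ} (hκ : 0 ≤ κ)
    (hlim : Tendsto (fun x => TT w x / x) atTop (𝓝 κ)) {E C0 : ℝ} (hE : 0 < E) (hC0 : 0 ≤ C0)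
    (hsm : ∀ a b d : ℝ, 1 ≤ d → (∀ y, gb a b d y ≠ 0 → -2 ≤ y ∧ y ≤ 1) → ∃ μ : ℝ, ∀ X ≥ 1,
      |∑' s, gb a b d (Real.log (w s / X)) - μ * X| ≤ C0 * d ^ E) :
    ∃ C : ℝ, 0 ≤ C ∧ ∀ X ≥ 1, |TT w X - κ * X| ≤ C * X ^ (E / (E + 1)) := by
  set θ := E / (E + 1) with hθ
  have hθ0 : 0 < θ := by positivity
  set C1 := 3 * κ + C0 * 2 ^ E with hC1
  have hC10 : 0 ≤ C1 := by positivity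
  have step : ∀ X ≥ 1, |(TT w X - κ * X) - (TT w (X * Real.exp (-1)) - κ * (X * Real.exp (-1)))| ≤ C1 * X ^ θ := by
    intro X hX
    have hX0 : 0 < X := by linarith
    have h1 : 1 ≤ X ^ (1 / (E + 1)) := Real.one_le_rpow hX (by positivity)
    have := shell_bound hw hfin hκ hlim hsm (d := 2 * X ^ (1 / (E + 1))) (by linarith) hX
    have e1 : (2 * X ^ (1 / (E + 1)))⁻¹ * X = X ^ θ / 2 := by
      rw [mul_inv, ← Real.rpow_neg hX0.le]
      have : X ^ (-(1 / (E + 1))) * X = X ^ θ := by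
        nth_rewrite 2 [← Real.rpow_one X]
        rw [← Real.rpow_add hX0]
        congr 1; rw [hθ]; field_simp; ring
      rw [← this]; ring
    have e2 : (2 * X ^ (1 / (E + 1))) ^ E = 2 ^ E * X ^ θ := by
      rw [Real.mul_rpow (by norm_num) (by positivity), ← Real.rpow_mul hX0.le]
      congr 2; rw [hθ]; field_simp
    rw [e2, mul_assoc (3 * κ), e1] at this
    have hp : 0 ≤ X ^ θ := by positivity
    have e3 : TT w X - κ * X - (TT w (X * Real.exp (-1)) - κ * (X * Real.exp (-1))) = TT w X - TT w (X * Real.exp (-1)) - κ * (1 - Real.exp (-1)) * X := by ring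
    rw [e3]
    refine this.trans ?_
    rw [hC1]
    nlinarith [mul_nonneg hκ hp]
  have hq : Real.exp (-θ) < 1 := by rw [Real.exp_lt_one_iff]; linarith
  set M := (C1 + κ) / (1 - Real.exp (-θ)) with hM
  have hq' : 0 < 1 - Real.exp (-θ) := by linarith
  have hM0 : 0 ≤ M := div_nonneg (by linarith) hq'.le
  have hMe : C1 + κ + M * Real.exp (-θ) = M := by
    have : M * (1 - Real.exp (-θ)) = C1 + κ := by rw [hM]; field_simp
    linarith
  refine ⟨M, hM0, ?_⟩
  have ind : ∀ k : ℕ, ∀ X ≥ 1, X < Real.exp k → |TT w X - κ * X| ≤ M * X ^ θ := by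
    intro k
    induction k with
    | zero => intro X hX h; simp at h; linarith
    | succ k ih =>
      intro X hX h
      have hs := step X hX
      have hX0 : 0 < X := by linarith
      have h1 : 1 ≤ X ^ θ := Real.one_le_rpow hX hθ0.le
      have h2 : |TT w (X * Real.exp (-1)) - κ * (X * Real.exp (-1))| ≤ (κ + M * Real.exp (-θ)) * X ^ θ := by
        by_cases hY : 1 ≤ X * Real.exp (-1)
        · have h3 : X * Real.exp (-1) < Real.exp k := by
            have := mul_lt_mul_of_pos_right h (Real.exp_pos (-1))
            rw [← Real.exp_add] at this
            simpa using this
          refine (ih _ hY h3).trans ?_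
          rw [Real.mul_rpow hX0.le (Real.exp_pos _).le, ← Real.exp_mul, neg_one_mul]
          nlinarith
        · push Not at hY
          have h3 : TT w (X * Real.exp (-1)) = 0 := by
            unfold TT
            have : IsEmpty {s // w s ≤ X * Real.exp (-1)} := ⟨fun s => by linarith [hw s.1, s.2]⟩
            simp
          have h4 : 0 < X * Real.exp (-1) := by positivity
          rw [h3, zero_sub, abs_neg, abs_of_nonneg (by positivity)]
          have := mul_nonneg hM0 (Real.exp_pos (-θ)).le
          nlinarith [mul_le_mul_of_nonneg_left hY.le hκ]
      calc |TT w X - κ * X| ≤ |(TT w X - κ * X) - (TT w (X * Real.exp (-1)) - κ * (X * Real.exp (-1)))| + |TT w (X * Real.exp (-1)) - κ * (X * Real.exp (-1))| := by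
            have := abs_add_le ((TT w X - κ * X) - (TT w (X * Real.exp (-1)) - κ * (X * Real.exp (-1)))) (TT w (X * Real.exp (-1)) - κ * (X * Real.exp (-1)))
            simpa using this
        _ ≤ C1 * X ^ θ + (κ + M * Real.exp (-θ)) * X ^ θ := add_le_add hs h2
        _ = M * X ^ θ := by rw [← add_mul, ← add_assoc, hMe]
  intro X hX
  obtain ⟨k, hk⟩ := exists_nat_gt X
  exact ind k X hX (hk.trans_le (by linarith [Real.add_one_le_exp (k:ℝ)]))
end abs

end HF
end HFP


open Filter Topology
open scoped BigOperators

noncomputable section HFQ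

namespace HF

open MeasureTheory Set
open scoped ContDiff

section ideals
open NumberField NumberField.mixedEmbedding NumberField.InfinitePlace NumberField.Units NumberField.Units.dirichletUnitTheorem
open scoped Classical nonZeroDivisors

variable (K : Type) [Field K] [NumberField K]

lemma gb_hcs {a b d : ℝ} (h : ∀ y, gb a b d y ≠ 0 → -2 ≤ y ∧ y ≤ 1) : HasCompactSupport (gb a b d) := by
  apply HasCompactSupport.of_support_subset_isCompact (isCompact_Icc (a := (-2:ℝ)) (b := 1))
  intro y hy
  exact h y hy

lemma card_idx (J : (Ideal (𝓞 K))⁰) : Fintype.card (Module.Free.ChooseBasisIndex ℤ (FractionalIdeal.mk0 K J).1) = Module.finrank ℚ K := by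
  rw [← Module.finrank_eq_card_basis (basisOfFractionalIdeal K (FractionalIdeal.mk0 K J))]

variable {K}

lemma class_smooth (C : ClassGroup (𝓞 K)) : ∃ C0 : ℝ, 0 ≤ C0 ∧ ∀ a b d : ℝ, 1 ≤ d → (∀ y, gb a b d y ≠ 0 → -2 ≤ y ∧ y ≤ 1) →
    ∃ μ : ℝ, ∀ X ≥ 1, |∑' I : SC K C, gb a b d (Real.log ((Ideal.absNorm (I.1 : Ideal (𝓞 K)) : ℝ) / X)) - μ * X| ≤ C0 * d ^ (Eex (Module.finrank ℚ K)) := by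
  obtain ⟨J, hJ⟩ := ClassGroup.mk0_surjective C⁻¹
  have hNJ : (1:ℝ) ≤ Ideal.absNorm (J : Ideal (𝓞 K)) := by
    exact_mod_cast Ideal.absNorm_pos_of_nonZeroDivisors J
  set n := Module.finrank ℚ K with hn
  have hn0 : n ≠ 0 := (Module.finrank_pos).ne'
  obtain ⟨C1, hC1, hL⟩ := (mAD K).lattice_smooth (fractionalIdealLatticeBasis K (FractionalIdeal.mk0 K J)) (psi_smooth K) (psi_hcs K)
    (fun v hv => psi_ts_ne K hv)
  rw [card_idx K J] at hL
  obtain ⟨B, hB, hgB⟩ := gb_bound n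
  have hw : (0:ℝ) < torsionOrder K := by exact_mod_cast Nat.pos_of_ne_zero (torsionOrder_ne_zero K)
  refine ⟨C1 * B / torsionOrder K, by positivity, ?_⟩
  intro a b d hd hg
  refine ⟨(∫ v, (mAD K).GG (psi K chi) (gb a b d) v ∂(AD.nu (fractionalIdealLatticeBasis K (FractionalIdeal.mk0 K J)))) * Ideal.absNorm (J : Ideal (𝓞 K)) / torsionOrder K, ?_⟩
  intro X hX
  have hXN : 1 ≤ X * Ideal.absNorm (J : Ideal (𝓞 K)) := one_le_mul_of_one_le_of_one_le hX hNJ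
  set R := (X * Ideal.absNorm (J : Ideal (𝓞 K))) ^ ((n:ℝ)⁻¹) with hR
  have hR1 : 1 ≤ R := Real.one_le_rpow hXN (by positivity)
  have hRX : R ^ n = X * Ideal.absNorm (J : Ideal (𝓞 K)) := Real.rpow_inv_natCast_pow (by linarith) hn0
  have hd0 : 0 < d := by linarith
  have key := hL B d⁻¹ hB (inv_pos.2 hd0) (inv_le_one_of_one_le₀ hd) (gb a b d) (gb_smooth a b d) (gb_hcs hg)
    (hgB a b d hd hg).1 (by rw [inv_inv]; exact (hgB a b d hd hg).2) R hR1
  rw [ideal_sum hJ hg (by linarith) (by linarith) hRX, hRX, inv_inv] at key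
  set Sg := ∑' I : SC K C, gb a b d (Real.log ((Ideal.absNorm (I.1 : Ideal (𝓞 K)) : ℝ) / X))
  have e : Sg - (∫ v, (mAD K).GG (psi K chi) (gb a b d) v ∂(AD.nu (fractionalIdealLatticeBasis K (FractionalIdeal.mk0 K J)))) * Ideal.absNorm (J : Ideal (𝓞 K)) / torsionOrder K * X
    = (torsionOrder K * Sg - (∫ v, (mAD K).GG (psi K chi) (gb a b d) v ∂(AD.nu (fractionalIdealLatticeBasis K (FractionalIdeal.mk0 K J)))) * (X * Ideal.absNorm (J : Ideal (𝓞 K)))) / torsionOrder K := by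
    field_simp
  rw [e, abs_div, abs_of_pos hw, div_le_iff₀ hw]
  refine key.trans (le_of_eq ?_)
  rw [← hn]
  field_simp

lemma Eex_pos {n : ℕ} (hn : n ≠ 0) : 0 < Eex n := by
  unfold Eex
  split_ifs with h
  · norm_num
  · have : (2:ℝ) ≤ n := by exact_mod_cast (show 2 ≤ n by omega)
    linarith

/-- the exponent -/
def th (n : ℕ) : ℝ := Eex n / (Eex n + 1)

lemma th_eq {n : ℕ} (hn : 2 ≤ n) : th n = 1 - 2 / ((n:ℝ) + 1) := by
  have h : ¬ n = 1 := by omega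
  have : (2:ℝ) ≤ n := by exact_mod_cast hn
  simp only [th, Eex, if_neg h]
  have e : ((n:ℝ) - 1) / 2 + 1 = (n + 1) / 2 := by ring
  have e2 : (n:ℝ) + 1 ≠ 0 := by positivity
  rw [e]
  field_simp
  ring

lemma th_one : th 1 = 1 / 2 := by
  norm_num [th, Eex]

lemma th_pos {n : ℕ} (hn : n ≠ 0) : 0 < th n := by
  have := Eex_pos hn
  unfold th; positivity

lemma th_lt {n : ℕ} (hn : n ≠ 0) : th n < 1 := by
  have := Eex_pos hn
  unfold th
  rw [div_lt_one (by linarith)]; linarith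

lemma class_landau (C : ClassGroup (𝓞 K)) : ∃ A : ℝ, 0 ≤ A ∧ ∀ X ≥ 1,
    |TT (fun I : SC K C => (Ideal.absNorm (I.1 : Ideal (𝓞 K)) : ℝ)) X - ((2 ^ nrRealPlaces K * (2 * Real.pi) ^ nrComplexPlaces K * regulator K) /
            (torsionOrder K * Real.sqrt |discr K|)) * X| ≤ A * X ^ th (Module.finrank ℚ K) := by
  obtain ⟨C0, hC0, h⟩ := class_smooth C
  refine landau_abs (fun I => by exact_mod_cast Ideal.absNorm_pos_of_nonZeroDivisors I.1) (finite_SC C) ?_ ?_ (Eex_pos (Module.finrank_pos).ne') hC0 h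
  · have := regulator_pos K
    positivity
  · refine (NumberField.Ideal.tendsto_norm_le_and_mk_eq_div_atTop K C).congr fun x => ?_
    congr 2
    refine Nat.card_congr ?_
    exact ⟨fun I => ⟨⟨I.1, I.2.2⟩, I.2.1⟩, fun I => ⟨I.1.1, I.2, I.1.2⟩, fun _ => rfl, fun _ => rfl⟩

variable (K)

/-- number of nonzero ideals -/
def cI (X : ℝ) : ℝ := TT (fun I : (Ideal (𝓞 K))⁰ => (Ideal.absNorm (I : Ideal (𝓞 K)) : ℝ)) X

lemma cI_sum (X : ℝ) : cI K X = ∑ C : ClassGroup (𝓞 K), TT (fun I : SC K C => (Ideal.absNorm (I.1 : Ideal (𝓞 K)) : ℝ)) X := by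
  unfold cI TT
  have : ∀ C : ClassGroup (𝓞 K), Finite {s : SC K C // (Ideal.absNorm (s.1 : Ideal (𝓞 K)) : ℝ) ≤ X} := fun C => (finite_SC C X).to_subtype
  rw [← Nat.cast_sum, ← Nat.card_sigma]
  congr 1
  refine Nat.card_congr ?_
  exact ⟨fun I => ⟨ClassGroup.mk0 I.1, ⟨⟨I.1, rfl⟩, I.2⟩⟩, fun I => ⟨I.2.1.1, I.2.2⟩, fun _ => rfl, by
    rintro ⟨C, ⟨⟨I, rfl⟩, h⟩⟩; rfl⟩

theorem landau : ∃ A : ℝ, 0 ≤ A ∧ ∀ X ≥ 1,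
    |cI K X - ((2 ^ nrRealPlaces K * (2 * Real.pi) ^ nrComplexPlaces K * classNumber K * regulator K) /
            (torsionOrder K * Real.sqrt |discr K|)) * X| ≤ A * X ^ th (Module.finrank ℚ K) := by
  choose A hA h using class_landau (K := K)
  refine ⟨∑ C, A C, Finset.sum_nonneg fun C _ => hA C, ?_⟩
  intro X hX
  have e : cI K X - ((2 ^ nrRealPlaces K * (2 * Real.pi) ^ nrComplexPlaces K * classNumber K * regulator K) /
            (torsionOrder K * Real.sqrt |discr K|)) * X = ∑ C : ClassGroup (𝓞 K), (TT (fun I : SC K C => (Ideal.absNorm (I.1 : Ideal (𝓞 K)) : ℝ)) X - ((2 ^ nrRealPlaces K * (2 * Real.pi) ^ nrComplexPlaces K * regulator K) /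
            (torsionOrder K * Real.sqrt |discr K|)) * X) := by
    rw [cI_sum, Finset.sum_sub_distrib, Finset.sum_const, Finset.card_univ, nsmul_eq_mul, classNumber]
    ring
  rw [e, Finset.sum_mul]
  exact (Finset.abs_sum_le_sum_abs _ _).trans (Finset.sum_le_sum fun C _ => h C X hX)

end ideals

end HF
end HFQ


open Filter Topology
open scoped BigOperators

noncomputable section HFR

namespace HF

/-- An abstract system of (Beurling type) primes with finite norm balls. -/
structure BSys (ι : Type) where
  N : ι → ℝ
  two_le : ∀ p, 2 ≤ N p
  fin : ∀ X : ℝ, {e : ι →₀ ℕ | (e.prod fun p k => N p ^ k) ≤ X}.Finite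

namespace BSys
open scoped Classical

variable {ι : Type} (D : BSys ι)

/-- norm -/
def W (e : ι →₀ ℕ) : ℝ := e.prod fun p k => D.N p ^ k

/-- norm balls -/
def ball (X : ℝ) : Finset (ι →₀ ℕ) := (D.fin X).toFinset

/-- counting function of norm balls -/
def I (X : ℝ) : ℝ := (D.ball X).card

lemma mem_ball {X : ℝ} {e : ι →₀ ℕ} : e ∈ D.ball X ↔ D.W e ≤ X := by
  simp [ball, W]

lemma N_pos (p : ι) : 0 < D.N p := by linarith [D.two_le p]

lemma one_le_W (e : ι →₀ ℕ) : 1 ≤ D.W e := by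
  unfold W Finsupp.prod
  refine Finset.prod_induction _ (fun x : ℝ => 1 ≤ x) (fun a b => one_le_mul_of_one_le_of_one_le) le_rfl ?_
  intro p _
  exact one_le_pow₀ (by linarith [D.two_le p])

lemma W_pos (e : ι →₀ ℕ) : 0 < D.W e := by linarith [D.one_le_W e]

lemma W_add (e f : ι →₀ ℕ) : D.W (e + f) = D.W e * D.W f := by
  unfold W
  exact Finsupp.prod_add_index' (by simp) (fun p a b => pow_add _ _ _)

lemma W_nsmul (h : ℕ) (e : ι →₀ ℕ) : D.W (h • e) = D.W e ^ h := by
  induction h with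
  | zero => simp [W]
  | succ n ih => rw [succ_nsmul, W_add, ih, pow_succ]

lemma W_single (p : ι) : D.W (Finsupp.single p 1) = D.N p := by
  simp [W]

lemma W_rpow (e : ι →₀ ℕ) (s : ℝ) : D.W e ^ s = e.prod fun p k => (D.N p ^ s) ^ k := by
  unfold W Finsupp.prod
  rw [← Real.finsetProd_rpow _ _ (fun p _ => pow_nonneg (D.N_pos p).le _)]
  refine Finset.prod_congr rfl fun p _ => ?_
  simp only
  rw [← Real.rpow_natCast, ← Real.rpow_natCast, ← Real.rpow_mul (D.N_pos p).le, ← Real.rpow_mul (D.N_pos p).le, mul_comm]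

lemma euler_fin (s : ℝ) (P : Finset ι) (t : ι → Finset ℕ) :
    ∑ e ∈ P.finsupp t, D.W e ^ s = ∏ p ∈ P, ∑ k ∈ t p, (D.N p ^ s) ^ k := by
  rw [Finset.prod_sum, Finset.finsupp, Finset.sum_map]
  refine Finset.sum_congr rfl fun f _ => ?_
  rw [W_rpow]
  simp only [Function.Embedding.coeFn_mk]
  rw [Finsupp.prod_indicator_index_eq_prod_attach]
  intro p _
  simp

lemma sub_finsupp (F : Finset (ι →₀ ℕ)) (t : ι → Finset ℕ) (hF : ∀ e ∈ F, ∀ p, e p ∈ t p) :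
    ∃ P0 : Finset ι, ∀ P, P0 ⊆ P → F ⊆ P.finsupp t := by
  refine ⟨F.biUnion Finsupp.support, fun P hP e he => ?_⟩
  rw [Finset.mem_finsupp_iff]
  exact ⟨(Finset.subset_biUnion_of_mem Finsupp.support he).trans hP, fun p _ => hF e he p⟩

lemma of_finsupp {P : Finset ι} {t : ι → Finset ℕ} (h0 : ∀ p, 0 ∈ t p) {e : ι →₀ ℕ} (he : e ∈ P.finsupp t) (p : ι) :
    e p ∈ t p := by
  rw [Finset.mem_finsupp_iff] at he
  by_cases hp : p ∈ P
  · exact he.2 p hp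
  · have : p ∉ e.support := fun h => hp (he.1 h)
    rw [Finsupp.notMem_support_iff.1 this]; exact h0 p

lemma summable_N {C : ℝ} (hC : 0 ≤ C) (hI : ∀ t, 1 ≤ t → D.I t ≤ C * t) {s : ℝ} (hs : 1 < s) :
    Summable fun p => D.N p ^ (-s) := by
  refine summable_of_sum_le (c := (C + s * C / (s - 1)) * (1:ℝ) ^ (1 - s)) (fun p => Real.rpow_nonneg (D.N_pos p).le _) fun P => ?_
  apply layer_tail (β := 1) hC (by linarith) le_rfl hs P
  · intro p _; linarith [D.two_le p]
  · intro t ht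
    rw [Real.rpow_one]
    refine le_trans ?_ (hI t ht)
    unfold I
    norm_cast
    refine Finset.card_le_card_of_injOn (fun p => Finsupp.single p 1) ?_ ?_
    · intro p hp
      have := (Finset.mem_filter.1 hp).2
      simpa [mem_ball, W_single] using this
    · intro p _ q _ hpq
      exact (Finsupp.single_left_injective one_ne_zero) hpq

/-- exponents allowed in the `h`-full cofactor -/
def tB (h : ℕ) : Finset ℕ := insert 0 (Finset.Ico (h + 1) (2 * h))

lemma mem_tB {h k : ℕ} : k ∈ tB h ↔ k = 0 ∨ (h + 1 ≤ k ∧ k < 2 * h) := by simp [tB]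

/-- exponents with an excluded set of primes -/
def tZ (h : ℕ) (Z : Set ι) (p : ι) : Finset ℕ := if p ∈ Z then {0} else tB h

lemma zero_mem_tZ (h : ℕ) (Z : Set ι) (p : ι) : 0 ∈ tZ h Z p := by
  unfold tZ; split_ifs <;> simp [tB]

lemma mem_tZ {h : ℕ} {Z : Set ι} {p : ι} {k : ℕ} : k ∈ tZ h Z p ↔ (k ∈ tB h ∧ (p ∈ Z → k = 0)) := by
  unfold tZ; split_ifs with hp
  · simp only [Finset.mem_singleton, hp, forall_const]
    exact ⟨fun h => ⟨by simp [h, tB], h⟩, fun h => h.2⟩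
  · simp [hp]

/-- local term -/
def lf (h : ℕ) (p : ι) : ℝ := ∑ k ∈ Finset.Ico (h + 1) (2 * h), (D.N p ^ (-(1:ℝ)/h)) ^ k

lemma sum_tB (h : ℕ) (p : ι) : ∑ k ∈ tB h, (D.N p ^ (-(1:ℝ)/h)) ^ k = 1 + D.lf h p := by
  unfold tB lf
  rw [Finset.sum_insert (by simp)]; simp

lemma lf_nonneg (h : ℕ) (p : ι) : 0 ≤ D.lf h p :=
  Finset.sum_nonneg fun k _ => pow_nonneg (Real.rpow_nonneg (D.N_pos p).le _) _

lemma lf_le {h : ℕ} (hh : 2 ≤ h) (p : ι) : D.lf h p ≤ h * D.N p ^ (-(1 + 1 / (h:ℝ))) := by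
  have hN := D.two_le p
  have hh0 : (0:ℝ) < h := by exact_mod_cast (show 0 < h by omega)
  have e : D.N p ^ (-(1 + 1 / (h:ℝ))) = (D.N p ^ (-(1:ℝ)/h)) ^ (h + 1) := by
    rw [← Real.rpow_natCast, ← Real.rpow_mul (D.N_pos p).le]
    congr 1; push_cast; field_simp
  rw [e]
  have h1 : D.N p ^ (-(1:ℝ)/h) ≤ 1 := Real.rpow_le_one_of_one_le_of_nonpos (by linarith) (by
    rw [neg_div]; have : 0 < 1 / (h:ℝ) := by positivity
    linarith)
  have h0 : 0 ≤ D.N p ^ (-(1:ℝ)/h) := Real.rpow_nonneg (D.N_pos p).le _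
  calc D.lf h p ≤ ∑ k ∈ Finset.Ico (h + 1) (2 * h), (D.N p ^ (-(1:ℝ)/h)) ^ (h + 1) :=
        Finset.sum_le_sum fun k hk => pow_le_pow_of_le_one h0 h1 (Finset.mem_Ico.1 hk).1
    _ = ((2 * h - (h + 1) : ℕ) : ℝ) * _ := by rw [Finset.sum_const, Nat.card_Ico, nsmul_eq_mul]
    _ ≤ _ := by
      gcongr
      omega

lemma summable_lf {C : ℝ} (hC : 0 ≤ C) (hI : ∀ t, 1 ≤ t → D.I t ≤ C * t) {h : ℕ} (hh : 2 ≤ h) : Summable (D.lf h) := by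
  have hh0 : (0:ℝ) < h := by exact_mod_cast (show 0 < h by omega)
  have : 0 < 1 / (h:ℝ) := by positivity
  exact Summable.of_nonneg_of_le (D.lf_nonneg h) (D.lf_le hh) ((D.summable_N hC hI (s := 1 + 1 / (h:ℝ)) (by linarith)).mul_left _)

/-- the `h`-full cofactor map -/
def bb (h k : ℕ) : ℕ := if k % h = 0 then 0 else h + k % h

/-- the `h`-th power part map -/
def aa (h k : ℕ) : ℕ := (k - bb h k) / h

lemma bb_zero (h : ℕ) : bb h 0 = 0 := by simp [bb]
lemma aa_zero (h : ℕ) : aa h 0 = 0 := by simp [aa]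

lemma bb_mem {h : ℕ} (hh : 2 ≤ h) (k : ℕ) : bb h k ∈ tB h := by
  rw [mem_tB]; unfold bb
  have := Nat.mod_lt k (show 0 < h by omega)
  split_ifs <;> omega

lemma aa_bb {h : ℕ} (hh : 2 ≤ h) {k : ℕ} (hk : k = 0 ∨ h ≤ k) : h * aa h k + bb h k = k := by
  unfold aa bb
  have h1 := Nat.mod_lt k (show 0 < h by omega)
  have h2 := Nat.div_add_mod k h
  split_ifs with h0
  · rw [Nat.sub_zero]; omega
  · have hk' : h ≤ k := by
      rcases hk with rfl | hk
      · simp at h0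
      · exact hk
    have h3 : 1 ≤ k / h := (Nat.one_le_div_iff (by omega)).2 hk'
    have h4 : k - (h + k % h) = h * (k / h - 1) := by
      rw [Nat.mul_sub]; omega
    rw [h4, Nat.mul_div_cancel_left _ (by omega), Nat.mul_sub]
    have : h * 1 ≤ h * (k / h) := Nat.mul_le_mul_left _ h3
    omega

lemma bb_of {h : ℕ} (hh : 2 ≤ h) {a b : ℕ} (hb : b ∈ tB h) : bb h (h * a + b) = b := by
  rw [mem_tB] at hb; unfold bb
  rcases hb with rfl | ⟨h1, h2⟩
  · simp
  · obtain ⟨c, rfl⟩ := Nat.exists_eq_add_of_le (show h ≤ b by omega)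
    have : (h * a + (h + c)) % h = c := by
      rw [← add_assoc, ← Nat.mul_succ, Nat.mul_add_mod, Nat.mod_eq_of_lt (by omega)]
    rw [this, if_neg (by omega)]

lemma aa_of {h : ℕ} (hh : 2 ≤ h) {a b : ℕ} (hb : b ∈ tB h) : aa h (h * a + b) = a := by
  unfold aa
  rw [bb_of hh hb, Nat.add_sub_cancel, Nat.mul_div_cancel_left _ (by omega)]

lemma le_root {h : ℕ} (hh : 2 ≤ h) {x : ℝ} (a b : ι →₀ ℕ) (hx : 0 ≤ x) :
    D.W (h • a + b) ≤ x ↔ D.W a ≤ (x / D.W b) ^ ((1:ℝ) / h) := by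
  rw [W_add, W_nsmul, ← le_div_iff₀ (D.W_pos b)]
  have h0 : h ≠ 0 := by omega
  have hy : 0 ≤ x / D.W b := div_nonneg hx (D.W_pos b).le
  rw [one_div, Real.le_rpow_inv_iff_of_pos (D.W_pos a).le hy (by positivity), Real.rpow_natCast]

lemma count_decomp {h : ℕ} (hh : 2 ≤ h) (Z : Set ι) {x : ℝ} (hx : 0 ≤ x) :
    ((D.ball x).filter fun e => (∀ p, e p = 0 ∨ h ≤ e p) ∧ ∀ p ∈ Z, e p = 0).card =
    ∑ b ∈ (D.ball x).filter (fun e => ∀ p, e p ∈ tZ h Z p),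
      ((D.ball ((x / D.W b) ^ ((1:ℝ) / h))).filter fun e => ∀ p ∈ Z, e p = 0).card := by
  rw [← Finset.card_sigma]
  refine Finset.card_nbij' (fun e => ⟨e.mapRange (bb h) (bb_zero h), e.mapRange (aa h) (aa_zero h)⟩) (fun s => h • s.2 + s.1) ?_ ?_ ?_ ?_
  · intro e he
    rw [Finset.mem_coe, Finset.mem_filter, mem_ball] at he
    obtain ⟨h1, h2, h3⟩ := he
    have e1 : h • e.mapRange (aa h) (aa_zero h) + e.mapRange (bb h) (bb_zero h) = e := by
      ext p; simp [aa_bb hh (h2 p)]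
    rw [Finset.mem_coe, Finset.mem_sigma, Finset.mem_filter, Finset.mem_filter, mem_ball, mem_ball]
    refine ⟨⟨?_, ?_⟩, ?_, ?_⟩
    · refine le_trans ?_ h1
      conv_rhs => rw [← e1]
      rw [W_add]
      exact le_mul_of_one_le_left (D.W_pos _).le (D.one_le_W _)
    · intro p
      rw [mem_tZ]
      refine ⟨by simpa using bb_mem hh _, fun hp => ?_⟩
      simp [h3 p hp, bb_zero]
    · rw [← D.le_root hh _ _ hx, e1]; exact h1
    · intro p hp; simp [h3 p hp, aa_zero]
  · rintro ⟨b, a⟩ hs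
    rw [Finset.mem_coe, Finset.mem_sigma, Finset.mem_filter, Finset.mem_filter, mem_ball, mem_ball] at hs
    obtain ⟨⟨h1, h2⟩, h3, h4⟩ := hs
    simp only at h1 h2 h3 h4
    rw [Finset.mem_coe, Finset.mem_filter, mem_ball]
    refine ⟨(D.le_root hh _ _ hx).2 h3, ?_, ?_⟩
    · intro p
      have := (mem_tB.1 (mem_tZ.1 (h2 p)).1)
      simp only [Finsupp.coe_add, Finsupp.coe_smul, Pi.add_apply, Pi.smul_apply, smul_eq_mul]
      rcases this with h0 | h0
      · rw [h0, add_zero]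
        rcases Nat.eq_zero_or_pos (a p) with ha | ha
        · left; simp [ha]
        · right; exact Nat.le_mul_of_pos_right _ ha
      · right; have := Nat.zero_le (h * a p); omega
    · intro p hp
      simp [h4 p hp, (mem_tZ.1 (h2 p)).2 hp]
  · intro e he
    rw [Finset.mem_coe, Finset.mem_filter, mem_ball] at he
    obtain ⟨h1, h2, h3⟩ := he
    ext p; simp [aa_bb hh (h2 p)]
  · rintro ⟨b, a⟩ hs
    rw [Finset.mem_coe, Finset.mem_sigma, Finset.mem_filter, Finset.mem_filter, mem_ball, mem_ball] at hs
    obtain ⟨⟨h1, h2⟩, h3, h4⟩ := hs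
    simp only at h2
    have hb := fun p => (mem_tZ.1 (h2 p)).1
    have ea : (h • a + b).mapRange (aa h) (aa_zero h) = a := by
      ext p; simp [aa_of hh (hb p)]
    have eb : (h • a + b).mapRange (bb h) (bb_zero h) = b := by
      ext p; simp [bb_of hh (hb p)]
    simp only [ea, eb]

end BSys
end HF
end HFR


open Filter Topology
open scoped BigOperators

noncomputable section HFS

namespace HF
namespace BSys
open scoped Classical

variable {ι : Type} (D : BSys ι)

lemma sumB_le {h : ℕ} (hs : Summable (D.lf h)) (F : Finset (ι →₀ ℕ)) (hF : ∀ e ∈ F, ∀ p, e p ∈ tB h) :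
    ∑ e ∈ F, D.W e ^ (-(1:ℝ)/h) ≤ Real.exp (∑' p, D.lf h p) := by
  obtain ⟨P, hP⟩ := sub_finsupp F (fun _ => tB h) hF
  calc ∑ e ∈ F, D.W e ^ (-(1:ℝ)/h) ≤ ∑ e ∈ P.finsupp (fun _ => tB h), D.W e ^ (-(1:ℝ)/h) :=
        Finset.sum_le_sum_of_subset_of_nonneg (hP P subset_rfl) fun e _ _ => Real.rpow_nonneg (D.W_pos e).le _
    _ = ∏ p ∈ P, (1 + D.lf h p) := by
        rw [euler_fin]; simp_rw [sum_tB]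
    _ ≤ ∏ p ∈ P, Real.exp (D.lf h p) := by
        refine Finset.prod_le_prod (fun p _ => by linarith [D.lf_nonneg h p]) fun p _ => ?_
        rw [add_comm]; exact Real.add_one_le_exp _
    _ = Real.exp (∑ p ∈ P, D.lf h p) := (Real.exp_sum _ _).symm
    _ ≤ _ := Real.exp_le_exp.2 (hs.sum_le_tsum _ fun p _ => D.lf_nonneg h p)

lemma Bcount {C0 : ℝ} (hC0 : 0 ≤ C0) (hI : ∀ t, 1 ≤ t → D.I t ≤ C0 * t) {h : ℕ} (hh : 2 ≤ h) :
    ∃ C : ℝ, 0 ≤ C ∧ ∀ y : ℝ, 1 ≤ y → (((D.ball y).filter fun e => ∀ p, e p ∈ tB h).card : ℝ) ≤ C * y ^ ((1:ℝ) / (h + 1)) := by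
  have hh' : 2 ≤ h + 1 := by omega
  have hs := D.summable_lf hC0 hI hh'
  refine ⟨C0 * Real.exp (∑' p, D.lf (h + 1) p), by positivity, fun y hy => ?_⟩
  have hy0 : 0 ≤ y := by linarith
  have h1 : ((D.ball y).filter fun e => ∀ p, e p ∈ tB h).card ≤
      ((D.ball y).filter fun e => (∀ p, e p = 0 ∨ h + 1 ≤ e p) ∧ ∀ p ∈ (∅ : Set ι), e p = 0).card := by
    refine Finset.card_le_card ?_
    intro e he
    rw [Finset.mem_filter] at he ⊢
    refine ⟨he.1, fun p => ?_, by simp⟩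
    rcases mem_tB.1 (he.2 p) with h0 | h0
    · exact Or.inl h0
    · exact Or.inr h0.1
  rw [D.count_decomp hh' ∅ hy0] at h1
  have h2 : ∀ b ∈ (D.ball y).filter (fun e => ∀ p, e p ∈ tZ (h + 1) ∅ p),
      ((((D.ball ((y / D.W b) ^ ((1:ℝ) / ((h + 1 : ℕ):ℝ)))).filter fun e => ∀ p ∈ (∅ : Set ι), e p = 0).card : ℕ) : ℝ) ≤
      C0 * y ^ ((1:ℝ) / (h + 1)) * D.W b ^ (-(1:ℝ) / ((h + 1 : ℕ) : ℝ)) := by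
    intro b hb
    rw [Finset.mem_filter, mem_ball] at hb
    have hq : 1 ≤ (y / D.W b) ^ ((1:ℝ) / ((h + 1 : ℕ):ℝ)) :=
      Real.one_le_rpow ((one_le_div (D.W_pos b)).2 hb.1) (by positivity)
    calc _ ≤ D.I ((y / D.W b) ^ ((1:ℝ) / ((h + 1 : ℕ):ℝ))) := by
          unfold I; exact_mod_cast Finset.card_filter_le _ _
      _ ≤ C0 * (y / D.W b) ^ ((1:ℝ) / ((h + 1 : ℕ):ℝ)) := hI _ hq
      _ = _ := by
          rw [Real.div_rpow hy0 (D.W_pos b).le, neg_div, Real.rpow_neg (D.W_pos b).le]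
          push_cast; ring
  calc _ ≤ ((∑ b ∈ (D.ball y).filter (fun e => ∀ p, e p ∈ tZ (h + 1) ∅ p),
      ((D.ball ((y / D.W b) ^ ((1:ℝ) / ((h + 1 : ℕ):ℝ)))).filter fun e => ∀ p ∈ (∅ : Set ι), e p = 0).card : ℕ) : ℝ) := by
        exact_mod_cast h1
    _ ≤ ∑ b ∈ (D.ball y).filter (fun e => ∀ p, e p ∈ tZ (h + 1) ∅ p), C0 * y ^ ((1:ℝ) / (h + 1)) * D.W b ^ (-(1:ℝ) / ((h + 1 : ℕ) : ℝ)) := by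
        rw [Nat.cast_sum]; exact Finset.sum_le_sum h2
    _ ≤ C0 * y ^ ((1:ℝ) / (h + 1)) * Real.exp (∑' p, D.lf (h + 1) p) := by
        rw [← Finset.mul_sum]
        refine mul_le_mul_of_nonneg_left (D.sumB_le hs _ ?_) (by positivity)
        intro e he p
        exact (mem_tZ.1 ((Finset.mem_filter.1 he).2 p)).1
    _ = _ := by ring

lemma I_ell (ℓ : ι) (y : ℝ) : (((D.ball y).filter fun e => ∀ p ∈ ({ℓ} : Set ι), e p = 0).card : ℝ) = D.I y - D.I (y / D.N ℓ) := by
  have h1 := Finset.card_filter_add_card_filter_not (s := D.ball y) (fun e => ∀ p ∈ ({ℓ} : Set ι), e p = 0)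
  have h2 : ((D.ball y).filter fun e => ¬ ∀ p ∈ ({ℓ} : Set ι), e p = 0).card = (D.ball (y / D.N ℓ)).card := by
    symm
    refine Finset.card_nbij' (fun e => e + Finsupp.single ℓ 1) (fun e => e - Finsupp.single ℓ 1) ?_ ?_ ?_ ?_
    · intro e he
      rw [Finset.mem_coe, mem_ball] at he
      rw [Finset.mem_coe, Finset.mem_filter, mem_ball, W_add, W_single]
      refine ⟨(le_div_iff₀ (D.N_pos ℓ)).1 he, by simp⟩
    · intro e he
      rw [Finset.mem_coe, Finset.mem_filter, mem_ball] at he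
      rw [Finset.mem_coe, mem_ball, le_div_iff₀ (D.N_pos ℓ), ← W_single, ← W_add, tsub_add_cancel_of_le]
      · exact he.1
      · have := he.2
        simp at this
        rw [Finsupp.single_le_iff]; omega
    · intro e _; simp
    · intro e he
      rw [Finset.mem_coe, Finset.mem_filter, mem_ball] at he
      refine tsub_add_cancel_of_le ?_
      have := he.2
      simp at this
      rw [Finsupp.single_le_iff]; omega
  unfold I
  rw [← h2, ← h1]
  push_cast; ring

lemma I_zero {y : ℝ} (hy : y < 1) : D.I y = 0 := by
  unfold I
  rw [Nat.cast_eq_zero, Finset.card_eq_zero, Finset.eq_empty_iff_forall_notMem]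
  intro e he
  rw [mem_ball] at he
  linarith [D.one_le_W e]

section main
variable {κ A θ : ℝ} (hκ : 0 ≤ κ) (hA : 0 ≤ A) (h0 : 0 ≤ θ) (h1 : θ ≤ 1)
  (hI : ∀ X, 1 ≤ X → |D.I X - κ * X| ≤ A * X ^ θ)

lemma I_le (hA : 0 ≤ A) (h1 : θ ≤ 1) (hI : ∀ X, 1 ≤ X → |D.I X - κ * X| ≤ A * X ^ θ) (X : ℝ) (hX : 1 ≤ X) :
    D.I X ≤ (κ + A) * X := by
  have := (abs_le.1 (hI X hX)).2
  have h2 : X ^ θ ≤ X := by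
    conv_rhs => rw [← Real.rpow_one X]
    exact Real.rpow_le_rpow_of_exponent_le hX h1
  nlinarith

lemma I_ell_err (hκ : 0 ≤ κ) (hA : 0 ≤ A) (h0 : 0 ≤ θ)
    (hI : ∀ X, 1 ≤ X → |D.I X - κ * X| ≤ A * X ^ θ) (ℓ : ι) (y : ℝ) (hy : 1 ≤ y) :
    |(((D.ball y).filter fun e => ∀ p ∈ ({ℓ} : Set ι), e p = 0).card : ℝ) - κ * (1 - (D.N ℓ)⁻¹) * y| ≤ (2 * A + κ) * y ^ θ := by
  rw [I_ell]
  have hN := D.two_le ℓ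
  have hNp := D.N_pos ℓ
  have hy0 : 0 < y := by linarith
  have e1 := hI y hy
  have e2 : |D.I (y / D.N ℓ) - κ * (y / D.N ℓ)| ≤ (A + κ) * y ^ θ := by
    rcases le_or_gt 1 (y / D.N ℓ) with h | h
    · refine (hI _ h).trans ?_
      have : (y / D.N ℓ) ^ θ ≤ y ^ θ := Real.rpow_le_rpow (by positivity) (div_le_self hy0.le (by linarith)) h0
      have h3 : 0 ≤ y ^ θ := by positivity
      nlinarith
    · rw [D.I_zero h, zero_sub, abs_neg, abs_of_nonneg (by positivity)]
      have h3 : 1 ≤ y ^ θ := Real.one_le_rpow hy h0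
      nlinarith
  have e : D.I y - D.I (y / D.N ℓ) - κ * (1 - (D.N ℓ)⁻¹) * y = (D.I y - κ * y) - (D.I (y / D.N ℓ) - κ * (y / D.N ℓ)) := by
    rw [div_eq_mul_inv]; ring
  rw [e]
  refine (abs_sub _ _).trans ?_
  linarith

lemma local_prod {h : ℕ} (hs : Summable (D.lf h)) (ℓ : ι) :
    ∃ S, 0 ≤ S ∧ HasProd (fun p => ∑ k ∈ tZ h {ℓ} p, (D.N p ^ (-(1:ℝ)/h)) ^ k) S ∧ ∏' p, (1 + D.lf h p) = S * (1 + D.lf h ℓ) := by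
  set g : ι → ℝ := fun p => if p = ℓ then 0 else D.lf h p with hg
  have e : (fun p => ∑ k ∈ tZ h {ℓ} p, (D.N p ^ (-(1:ℝ)/h)) ^ k) = fun p => 1 + g p := by
    funext p
    simp only [hg, tZ, Set.mem_singleton_iff]
    split_ifs
    · simp
    · rw [sum_tB]
  have hgs : Summable g := Summable.of_nonneg_of_le (fun p => by
    simp only [hg]; split_ifs; exacts [le_rfl, D.lf_nonneg h p]) (fun p => by
    simp only [hg]; split_ifs; exacts [D.lf_nonneg h p, le_rfl]) hs
  have hm : Multipliable fun p => 1 + g p := Real.multipliable_one_add_of_summable hgs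
  rw [e]
  refine ⟨∏' p, (1 + g p), ?_, hm.hasProd, ?_⟩
  · refine ge_of_tendsto' hm.hasProd fun P => Finset.prod_nonneg fun p _ => ?_
    simp only [hg]; split_ifs
    · norm_num
    · linarith [D.lf_nonneg h p]
  · have h2 : HasProd (fun p => if p = ℓ then 1 + D.lf h ℓ else 1) (1 + D.lf h ℓ) := hasProd_ite_eq ℓ _
    have h3 := hm.hasProd.mul h2
    have e3 : (fun p => 1 + D.lf h p) = fun p => (1 + g p) * (if p = ℓ then 1 + D.lf h ℓ else 1) := by
      funext p
      by_cases hp : p = ℓ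
      · subst hp; simp [hg]
      · simp [hg, hp]
    rw [e3]
    exact h3.tprod_eq

end main

end BSys
end HF
end HFS


open Filter Topology
open scoped BigOperators

noncomputable section HFT

namespace HF
namespace BSys
open scoped Classical

variable {ι : Type} (D : BSys ι)

lemma card_sub {h : ℕ} {C1 β : ℝ} (hB : ∀ y : ℝ, 1 ≤ y → (((D.ball y).filter fun e => ∀ p, e p ∈ tB h).card : ℝ) ≤ C1 * y ^ β)
    (F : Finset (ι →₀ ℕ)) (hF : ∀ e ∈ F, ∀ p, e p ∈ tB h) (t : ℝ) (ht : 1 ≤ t) :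
    ((F.filter (fun e => D.W e ≤ t)).card : ℝ) ≤ C1 * t ^ β := by
  refine le_trans ?_ (hB t ht)
  norm_cast
  refine Finset.card_le_card fun e he => ?_
  rw [Finset.mem_filter] at he ⊢
  exact ⟨(D.mem_ball).2 he.2, hF e he.1⟩

lemma trunc {h : ℕ} (hh : 2 ≤ h) {C1 : ℝ} (hC1 : 0 ≤ C1) (hB : ∀ y : ℝ, 1 ≤ y → (((D.ball y).filter fun e => ∀ p, e p ∈ tB h).card : ℝ) ≤ C1 * y ^ ((1:ℝ) / (h + 1)))
    (ℓ : ι) {S : ℝ} (hS : HasProd (fun p => ∑ k ∈ tZ h {ℓ} p, (D.N p ^ (-(1:ℝ)/h)) ^ k) S) {x : ℝ} (hx : 1 ≤ x) :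
    |∑ b ∈ (D.ball x).filter (fun e => ∀ p, e p ∈ tZ h {ℓ} p), D.W b ^ (-(1:ℝ)/h) - S| ≤
      (C1 + (1 / (h:ℝ)) * C1 / (1 / (h:ℝ) - 1 / (h + 1))) * x ^ ((1:ℝ) / (h + 1) - 1 / h) := by
  have hh0 : (0:ℝ) < h := by exact_mod_cast (show 0 < h by omega)
  set Bx := (D.ball x).filter (fun e => ∀ p, e p ∈ tZ h {ℓ} p) with hBx
  obtain ⟨P0, hP0⟩ := sub_finsupp Bx (tZ h {ℓ}) (fun e he => (Finset.mem_filter.1 he).2)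
  have ht : Tendsto (fun P : Finset ι => |∑ b ∈ Bx, D.W b ^ (-(1:ℝ)/h) - ∏ p ∈ P, ∑ k ∈ tZ h {ℓ} p, (D.N p ^ (-(1:ℝ)/h)) ^ k|) atTop
      (𝓝 |∑ b ∈ Bx, D.W b ^ (-(1:ℝ)/h) - S|) := (tendsto_const_nhds.sub hS).abs
  refine le_of_tendsto ht ?_
  filter_upwards [eventually_ge_atTop P0] with P hP
  have hsub := hP0 P hP
  rw [← euler_fin, ← Finset.sum_sdiff hsub, abs_sub_comm, add_sub_cancel_right, abs_of_nonneg (Finset.sum_nonneg fun e _ => Real.rpow_nonneg (D.W_pos e).le _)]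
  have hF : ∀ e ∈ P.finsupp (tZ h {ℓ}) \ Bx, ∀ p, e p ∈ tZ h {ℓ} p := fun e he p =>
    of_finsupp (zero_mem_tZ h {ℓ}) (Finset.mem_sdiff.1 he).1 p
  have hlt : (1:ℝ) / (h + 1) < 1 / h := one_div_lt_one_div_of_lt hh0 (by linarith)
  rw [neg_div]
  refine layer_tail (β := 1 / ((h:ℝ) + 1)) hC1 (by positivity) hx hlt _ ?_ (D.card_sub hB _ fun e he p => (mem_tZ.1 (hF e he p)).1)
  intro e he
  by_contra hlt
  push Not at hlt
  refine (Finset.mem_sdiff.1 he).2 (Finset.mem_filter.2 ⟨(D.mem_ball).2 hlt.le, hF e he⟩)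

lemma head_sum {h : ℕ} (hh : 2 ≤ h) {C1 : ℝ} (hC1 : 0 ≤ C1) (hB : ∀ y : ℝ, 1 ≤ y → (((D.ball y).filter fun e => ∀ p, e p ∈ tB h).card : ℝ) ≤ C1 * y ^ ((1:ℝ) / (h + 1)))
    {θ : ℝ} (h0 : 0 ≤ θ) {R : ℝ → ℝ}
    (hR1 : θ < h / ((h:ℝ) + 1) → ∀ x, R x = x ^ ((1:ℝ) / (h + 1)))
    (hR2 : θ = h / ((h:ℝ) + 1) → ∀ x, R x = x ^ ((1:ℝ) / (h + 1)) * Real.log x)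
    (hR3 : h / ((h:ℝ) + 1) < θ → ∀ x, R x = x ^ ((1:ℝ) / h * θ)) :
    ∃ C2 : ℝ, 0 ≤ C2 ∧ ∀ x : ℝ, 2 ≤ x → x ^ ((1:ℝ) / (h + 1)) ≤ C2 * R x ∧ ∀ F : Finset (ι →₀ ℕ), (∀ e ∈ F, D.W e ≤ x ∧ ∀ p, e p ∈ tB h) →
      ∑ e ∈ F, ((x / D.W e) ^ ((1:ℝ) / h)) ^ θ ≤ C2 * R x := by
  have hh0 : (0:ℝ) < h := by exact_mod_cast (show 0 < h by omega)
  have key : ∀ x : ℝ, 2 ≤ x → ∀ F : Finset (ι →₀ ℕ), ∑ e ∈ F, ((x / D.W e) ^ ((1:ℝ) / h)) ^ θ = x ^ ((1:ℝ) / h * θ) * ∑ e ∈ F, D.W e ^ (-((1:ℝ) / h * θ)) := by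
    intro x hx F
    rw [Finset.mul_sum]
    refine Finset.sum_congr rfl fun e _ => ?_
    have := D.W_pos e
    rw [← Real.rpow_mul (by positivity), Real.div_rpow (by linarith) this.le, Real.rpow_neg this.le]; rfl
  have ha : 0 ≤ (1:ℝ) / h * θ := by positivity
  have conv : (1:ℝ) / h * (h / ((h:ℝ) + 1)) = 1 / (h + 1) := by field_simp
  have hhp : 0 < (1:ℝ) / h := by positivity
  rcases lt_trichotomy θ (h / ((h:ℝ) + 1)) with hc | hc | hc
  · have hc' : (1:ℝ) / h * θ < 1 / (h + 1) := by rw [← conv]; gcongr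
    have hd : 0 < 1 / ((h:ℝ) + 1) - 1 / h * θ := by linarith
    set c := C1 + (1 / h * θ) * C1 / (1 / ((h:ℝ) + 1) - 1 / h * θ) with hcdef
    have hcn : 0 ≤ c := by positivity
    refine ⟨1 + c, by positivity, fun x hx => ?_⟩
    have hx0 : 0 < x := by linarith
    have hxp : 0 ≤ x ^ ((1:ℝ) / (h + 1)) := by positivity
    rw [hR1 hc x]
    refine ⟨by nlinarith, fun F hF => ?_⟩
    rw [key x hx]
    have := layer_head (β := 1 / ((h:ℝ) + 1)) hC1 ha (show 1 ≤ x by linarith) hc' F (w := D.W) (fun e _ => D.one_le_W e) (fun e he => (hF e he).1)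
      (D.card_sub hB F fun e he => (hF e he).2)
    calc _ ≤ x ^ ((1:ℝ) / h * θ) * (c * x ^ (1 / ((h:ℝ) + 1) - 1 / h * θ)) := by gcongr
      _ = c * x ^ ((1:ℝ) / (h + 1)) := by
        rw [mul_left_comm, ← Real.rpow_add hx0]; congr 2; ring
      _ ≤ _ := by nlinarith
  · have hc' : (1:ℝ) / h * θ = 1 / (h + 1) := by rw [← conv, hc]
    have hl2 : 0 < Real.log 2 := Real.log_pos (by norm_num)
    set a := (1:ℝ) / h * θ with hadef
    refine ⟨(1 + C1) / Real.log 2 + a * C1, by positivity, fun x hx => ?_⟩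
    have hx0 : 0 < x := by linarith
    have hxp : 0 ≤ x ^ ((1:ℝ) / (h + 1)) := by positivity
    have hlx : Real.log 2 ≤ Real.log x := Real.log_le_log (by norm_num) hx
    have e1 : 1 + C1 ≤ (1 + C1) / Real.log 2 * Real.log x := by
      rw [div_mul_eq_mul_div, le_div_iff₀ hl2]; gcongr
    have e2 : 0 ≤ a * C1 * Real.log x := by
      have : 0 < Real.log x := by linarith
      positivity
    rw [hR2 hc x]
    refine ⟨?_, fun F hF => ?_⟩
    · calc x ^ ((1:ℝ) / (h + 1)) ≤ x ^ ((1:ℝ) / (h + 1)) * ((1 + C1) / Real.log 2 * Real.log x + a * C1 * Real.log x) := by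
            refine le_mul_of_one_le_right hxp (by linarith)
        _ = _ := by ring
    · rw [key x hx]
      have := layer_log (β := 1 / ((h:ℝ) + 1)) hC1 ha (show 1 ≤ x by linarith) hc' F (w := D.W) (fun e _ => D.one_le_W e) (fun e he => (hF e he).1)
        (D.card_sub hB F fun e he => (hF e he).2)
      calc _ ≤ x ^ ((1:ℝ) / (h + 1)) * (C1 + a * C1 * Real.log x) := by
            rw [← hc']; gcongr
        _ ≤ x ^ ((1:ℝ) / (h + 1)) * ((1 + C1) / Real.log 2 * Real.log x + a * C1 * Real.log x) := by
            gcongr; linarith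
        _ = _ := by ring
  · have hc' : (1:ℝ) / (h + 1) < 1 / h * θ := by rw [← conv]; gcongr
    have hd : 0 < 1 / h * θ - 1 / ((h:ℝ) + 1) := by linarith
    set c := C1 + (1 / h * θ) * C1 / (1 / h * θ - 1 / ((h:ℝ) + 1)) with hcdef
    have hcn : 0 ≤ c := by positivity
    refine ⟨1 + c, by positivity, fun x hx => ?_⟩
    have hx0 : 0 < x := by linarith
    have hxp : 0 ≤ x ^ ((1:ℝ) / h * θ) := by positivity
    rw [hR3 hc x]
    refine ⟨?_, fun F hF => ?_⟩
    · have : x ^ ((1:ℝ) / (h + 1)) ≤ x ^ ((1:ℝ) / h * θ) := Real.rpow_le_rpow_of_exponent_le (by linarith) hc'.le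
      nlinarith
    rw [key x hx]
    have := layer_tail (β := 1 / ((h:ℝ) + 1)) hC1 ha le_rfl hc' F (w := D.W) (fun e _ => D.one_le_W e)
      (D.card_sub hB F fun e he => (hF e he).2)
    rw [Real.one_rpow, mul_one] at this
    calc _ ≤ x ^ ((1:ℝ) / h * θ) * c := by gcongr
      _ ≤ _ := by nlinarith

theorem main {κ A θ : ℝ} (hκ : 0 ≤ κ) (hA : 0 ≤ A) (h0 : 0 ≤ θ) (h1 : θ ≤ 1)
    (hI : ∀ X, 1 ≤ X → |D.I X - κ * X| ≤ A * X ^ θ) {h : ℕ} (hh : 2 ≤ h) {R : ℝ → ℝ}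
    (hR1 : θ < h / ((h:ℝ) + 1) → ∀ x, R x = x ^ ((1:ℝ) / (h + 1)))
    (hR2 : θ = h / ((h:ℝ) + 1) → ∀ x, R x = x ^ ((1:ℝ) / (h + 1)) * Real.log x)
    (hR3 : h / ((h:ℝ) + 1) < θ → ∀ x, R x = x ^ ((1:ℝ) / h * θ)) :
    ∃ C : ℝ, ∀ (ℓ : ι) (x : ℝ), 2 ≤ x →
      |(((D.ball x).filter fun e => (∀ p, e p = 0 ∨ h ≤ e p) ∧ ∀ p ∈ ({ℓ} : Set ι), e p = 0).card : ℝ)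
        - κ * (∏' p, (1 + D.lf h p)) * ((1 - (D.N ℓ)⁻¹) / (1 + D.lf h ℓ)) * x ^ ((1:ℝ) / h)| ≤ C * R x := by
  have hh0 : (0:ℝ) < h := by exact_mod_cast (show 0 < h by omega)
  have hI' := D.I_le hA h1 hI
  have hC0 : 0 ≤ κ + A := by linarith
  obtain ⟨C1, hC1, hB⟩ := D.Bcount hC0 hI' hh
  obtain ⟨C2, hC2, hH⟩ := D.head_sum hh hC1 hB h0 hR1 hR2 hR3
  have hs := D.summable_lf hC0 hI' hh
  have hlt : (1:ℝ) / (h + 1) < 1 / h := one_div_lt_one_div_of_lt hh0 (by linarith)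
  set c := C1 + (1 / (h:ℝ)) * C1 / (1 / (h:ℝ) - 1 / (h + 1)) with hc
  have hcn : 0 ≤ c := by
    have : 0 < 1 / (h:ℝ) - 1 / (h + 1) := by linarith
    positivity
  refine ⟨(2 * A + κ) * C2 + κ * c * C2, fun ℓ x hx => ?_⟩
  have hx0 : 0 < x := by linarith
  obtain ⟨S, hS0, hS, hSe⟩ := D.local_prod hs ℓ
  have hlp : 0 < 1 + D.lf h ℓ := by linarith [D.lf_nonneg h ℓ]
  have hN := D.two_le ℓ
  have hu0 : 0 ≤ 1 - (D.N ℓ)⁻¹ := by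
    have : (D.N ℓ)⁻¹ ≤ 1 := inv_le_one_of_one_le₀ (by linarith)
    linarith
  have hu1 : 1 - (D.N ℓ)⁻¹ ≤ 1 := by
    have : 0 < (D.N ℓ)⁻¹ := inv_pos.2 (by linarith)
    linarith
  rw [hSe, D.count_decomp hh {ℓ} hx0.le]
  set Bx := (D.ball x).filter (fun e => ∀ p, e p ∈ tZ h {ℓ} p) with hBx
  have hmem : ∀ e ∈ Bx, D.W e ≤ x ∧ ∀ p, e p ∈ tB h := fun e he => by
    rw [hBx, Finset.mem_filter, mem_ball] at he
    exact ⟨he.1, fun p => (mem_tZ.1 (he.2 p)).1⟩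
  set u := 1 - (D.N ℓ)⁻¹
  have e1 : κ * (S * (1 + D.lf h ℓ)) * (u / (1 + D.lf h ℓ)) * x ^ ((1:ℝ) / h) = κ * u * S * x ^ ((1:ℝ) / h) := by
    field_simp
  rw [e1, Nat.cast_sum]
  have e2 : ∑ b ∈ Bx, ((((D.ball ((x / D.W b) ^ ((1:ℝ) / h))).filter fun e => ∀ p ∈ ({ℓ} : Set ι), e p = 0).card : ℕ) : ℝ) - κ * u * S * x ^ ((1:ℝ) / h)
    = ∑ b ∈ Bx, (((((D.ball ((x / D.W b) ^ ((1:ℝ) / h))).filter fun e => ∀ p ∈ ({ℓ} : Set ι), e p = 0).card : ℕ) : ℝ) - κ * u * (x / D.W b) ^ ((1:ℝ) / h))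
      + κ * u * x ^ ((1:ℝ) / h) * (∑ b ∈ Bx, D.W b ^ (-(1:ℝ)/h) - S) := by
    have : ∀ b ∈ Bx, κ * u * (x / D.W b) ^ ((1:ℝ) / h) = κ * u * x ^ ((1:ℝ) / h) * D.W b ^ (-(1:ℝ)/h) := by
      intro b _
      rw [Real.div_rpow hx0.le (D.W_pos b).le, neg_div, Real.rpow_neg (D.W_pos b).le]; ring
    rw [Finset.sum_sub_distrib, Finset.sum_congr rfl this, ← Finset.mul_sum]
    ring
  rw [e2]
  refine (abs_add_le _ _).trans ?_
  rw [add_mul]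
  refine add_le_add ?_ ?_
  · refine (Finset.abs_sum_le_sum_abs _ _).trans ?_
    calc _ ≤ ∑ b ∈ Bx, (2 * A + κ) * ((x / D.W b) ^ ((1:ℝ) / h)) ^ θ := by
          refine Finset.sum_le_sum fun b hb => ?_
          refine D.I_ell_err hκ hA h0 hI ℓ _ (Real.one_le_rpow ((one_le_div (D.W_pos b)).2 (hmem b hb).1) (by positivity))
      _ ≤ (2 * A + κ) * (C2 * R x) := by
          rw [← Finset.mul_sum]
          exact mul_le_mul_of_nonneg_left ((hH x hx).2 Bx hmem) (by positivity)
      _ = _ := by ring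
  · have ht := D.trunc hh hC1 hB ℓ hS (x := x) (by linarith)
    have hxp : 0 ≤ x ^ ((1:ℝ) / h) := by positivity
    rw [abs_mul, abs_of_nonneg (by positivity)]
    calc _ ≤ κ * 1 * x ^ ((1:ℝ) / h) * (c * x ^ ((1:ℝ) / (h + 1) - 1 / h)) := by gcongr
      _ = κ * c * (x ^ ((1:ℝ) / h) * x ^ ((1:ℝ) / (h + 1) - 1 / h)) := by ring
      _ = κ * c * x ^ ((1:ℝ) / (h + 1)) := by
          rw [← Real.rpow_add hx0]; congr 2; ring
      _ ≤ κ * c * (C2 * R x) := mul_le_mul_of_nonneg_left (hH x hx).1 (by positivity)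
      _ = _ := by ring

end BSys
end HF
end HFT


open Filter Topology
open scoped BigOperators

noncomputable section HFU

namespace HF

section bridge
open NumberField
open scoped Classical nonZeroDivisors

variable (K : Type) [Field K] [NumberField K]

/-- nonzero primes -/
abbrev PI := {p : Ideal (𝓞 K) // p.IsPrime ∧ p ≠ ⊥}

variable {K}

/-- the ideal with given exponents -/
def FF (e : PI K →₀ ℕ) : Ideal (𝓞 K) := e.prod fun p k => p.1 ^ k

lemma PI_prime (p : PI K) : Prime p.1 := (Ideal.prime_iff_isPrime p.2.2).2 p.2.1

lemma FF_add (e f : PI K →₀ ℕ) : FF (e + f) = FF e * FF f :=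
  Finsupp.prod_add_index' (by simp) (fun p a b => pow_add _ _ _)

lemma FF_ne (e : PI K →₀ ℕ) : FF e ≠ 0 := by
  unfold FF Finsupp.prod
  rw [Finset.prod_ne_zero_iff]
  intro p _
  exact pow_ne_zero _ (PI_prime p).ne_zero

lemma PI_eq_of_dvd {p q : PI K} (h : p.1 ∣ q.1) : p = q := by
  have h1 := Ideal.dvd_iff_le.1 h
  have hm := q.2.1.isMaximal q.2.2
  exact Subtype.ext (hm.eq_of_le p.2.1.ne_top h1).symm

lemma FF_not_dvd {p : PI K} {e : PI K →₀ ℕ} (h : e p = 0) : ¬ p.1 ∣ FF e := by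
  intro hd
  unfold FF Finsupp.prod at hd
  rw [(PI_prime p).dvd_finsetProd_iff] at hd
  obtain ⟨q, hq, hd⟩ := hd
  have := PI_eq_of_dvd ((PI_prime p).dvd_of_dvd_pow hd)
  subst this
  exact (Finsupp.mem_support_iff.1 hq) h

lemma FF_single (p : PI K) (k : ℕ) : FF (Finsupp.single p k) = p.1 ^ k := by
  simp [FF]

lemma pow_dvd_FF {p : PI K} {e : PI K →₀ ℕ} {k : ℕ} : p.1 ^ k ∣ FF e ↔ k ≤ e p := by
  have e1 : FF e = p.1 ^ (e p) * FF (e.erase p) := by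
    conv_lhs => rw [← Finsupp.single_add_erase p e]
    rw [FF_add, FF_single]
  have h2 : ¬ p.1 ∣ FF (e.erase p) := FF_not_dvd (by simp)
  constructor
  · intro h
    rw [e1] at h
    have := (PI_prime p).pow_dvd_of_dvd_mul_right k h2 h
    exact (pow_dvd_pow_iff (PI_prime p).ne_zero (PI_prime p).not_isUnit).1 this
  · intro h
    rw [e1]
    exact (pow_dvd_pow _ h).mul_right _

lemma FF_inj : Function.Injective (FF : (PI K →₀ ℕ) → Ideal (𝓞 K)) := by
  intro e f h
  ext p
  apply le_antisymm
  · rw [← pow_dvd_FF, ← h, pow_dvd_FF]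
  · rw [← pow_dvd_FF, h, pow_dvd_FF]

lemma FF_surj (m : Ideal (𝓞 K)) (hm : m ≠ 0) : ∃ e, FF e = m := by
  induction m using UniqueFactorizationMonoid.induction_on_prime with
  | h₁ => exact absurd rfl hm
  | h₂ x hx =>
    refine ⟨0, ?_⟩
    rw [Ideal.isUnit_iff.1 hx]; simp [FF]
  | h₃ a p ha hp ih =>
    obtain ⟨e, he⟩ := ih ha
    refine ⟨Finsupp.single ⟨p, Ideal.isPrime_of_prime hp, hp.ne_zero⟩ 1 + e, ?_⟩
    rw [FF_add, FF_single, he, pow_one]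

lemma norm_FF (e : PI K →₀ ℕ) : (Ideal.absNorm (FF e) : ℝ) = e.prod fun p k => (Ideal.absNorm p.1 : ℝ) ^ k := by
  unfold FF Finsupp.prod
  rw [map_prod]
  push_cast
  simp

lemma two_le_norm (p : PI K) : (2:ℝ) ≤ Ideal.absNorm p.1 := by
  have h0 : Ideal.absNorm p.1 ≠ 0 := by
    rw [Ne, Ideal.absNorm_eq_zero_iff]; exact p.2.2
  have h1 : Ideal.absNorm p.1 ≠ 1 := by
    rw [Ne, Ideal.absNorm_eq_one_iff]; exact p.2.1.ne_top
  exact_mod_cast (show 2 ≤ Ideal.absNorm p.1 by omega)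

variable (K)

/-- the system of prime ideals -/
def PS : BSys (PI K) where
  N p := Ideal.absNorm p.1
  two_le := two_le_norm
  fin X := by
    refine Set.Finite.of_finite_image (f := FF) (Set.Finite.subset (Ideal.finite_setOfPred_absNorm_le (S := 𝓞 K) ⌊X⌋₊) ?_) (FF_inj.injOn)
    rintro _ ⟨e, he, rfl⟩
    have he' : (Ideal.absNorm (FF e) : ℝ) ≤ X := by rw [norm_FF]; exact he
    have : Ideal.absNorm (FF e) ≠ 0 := by
      rw [Ne, Ideal.absNorm_eq_zero_iff]; exact FF_ne e
    simp
    exact Nat.le_floor he'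

lemma PS_W (e : PI K →₀ ℕ) : (PS K).W e = Ideal.absNorm (FF e) := by
  rw [norm_FF]; rfl

lemma PS_I (X : ℝ) : (PS K).I X = cI K X := by
  unfold BSys.I cI TT
  rw [Nat.cast_inj, ← Nat.card_eq_finsetCard]
  refine Nat.card_congr (Equiv.ofBijective (fun e => ⟨⟨FF e.1, mem_nonZeroDivisors_of_ne_zero (FF_ne e.1)⟩, ?_⟩) ⟨?_, ?_⟩)
  · have := ((PS K).mem_ball).1 e.2
    rwa [PS_W] at this
  · intro e f hef
    simp only [Subtype.mk.injEq] at hef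
    exact Subtype.ext (FF_inj hef)
  · rintro ⟨⟨m, hm⟩, hX⟩
    obtain ⟨e, rfl⟩ := FF_surj m (nonZeroDivisors.ne_zero hm)
    exact ⟨⟨e, ((PS K).mem_ball).2 (by rw [PS_W]; exact hX)⟩, rfl⟩

lemma hfull_iff (h : ℕ) (e : PI K →₀ ℕ) : IsHFull K h (FF e) ↔ ∀ p, e p = 0 ∨ h ≤ e p := by
  constructor
  · rintro ⟨_, H⟩ p
    rcases Nat.eq_zero_or_pos (e p) with h0 | h0
    · exact Or.inl h0
    · right
      rw [← pow_dvd_FF]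
      refine H p.1 p.2.1 ?_
      have := (pow_dvd_FF (k := 1)).2 h0
      rwa [pow_one] at this
  · intro H
    refine ⟨FF_ne e, fun p hp hd => ?_⟩
    have hp0 : p ≠ ⊥ := by
      rintro rfl
      exact FF_ne e (zero_dvd_iff.1 hd)
    have h1 : 1 ≤ e ⟨p, hp, hp0⟩ := by
      rw [← pow_dvd_FF, pow_one]; exact hd
    have h2 := (H ⟨p, hp, hp0⟩).resolve_left (by omega)
    rwa [← pow_dvd_FF] at h2

lemma ell_iff (ℓ : PI K) (e : PI K →₀ ℕ) : (¬ ℓ.1 ∣ FF e) ↔ ∀ p ∈ ({ℓ} : Set (PI K)), e p = 0 := by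
  have := pow_dvd_FF (p := ℓ) (e := e) (k := 1)
  rw [pow_one] at this
  rw [this]
  simp

lemma PS_count (h : ℕ) (ℓ : PI K) (x : ℝ) :
    Nat.card {m : Ideal (𝓞 K) // IsHFull K h m ∧ (Ideal.absNorm m : ℝ) ≤ x ∧ ¬ ℓ.1 ∣ m} =
    (((PS K).ball x).filter fun e => (∀ p, e p = 0 ∨ h ≤ e p) ∧ ∀ p ∈ ({ℓ} : Set (PI K)), e p = 0).card := by
  rw [← Nat.card_eq_finsetCard]
  symm
  refine Nat.card_congr (Equiv.ofBijective (fun e => ⟨FF e.1, ?_⟩) ⟨?_, ?_⟩)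
  · have := e.2
    rw [Finset.mem_filter, BSys.mem_ball, PS_W] at this
    exact ⟨(hfull_iff K h _).2 this.2.1, this.1, (ell_iff K ℓ _).2 this.2.2⟩
  · intro e f hef
    simp only [Subtype.mk.injEq] at hef
    exact Subtype.ext (FF_inj hef)
  · rintro ⟨m, hm, hX, hl⟩
    obtain ⟨e, rfl⟩ := FF_surj m hm.1
    refine ⟨⟨e, ?_⟩, rfl⟩
    rw [Finset.mem_filter, BSys.mem_ball, PS_W]
    exact ⟨hX, (hfull_iff K h _).1 hm, (ell_iff K ℓ _).1 hl⟩

end bridge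

lemma lf_formula {ι : Type} (D : BSys ι) {h : ℕ} (hh : 2 ≤ h) (p : ι) :
    1 + D.lf h p = 1 + (D.N p - D.N p ^ ((1:ℝ)/h)) / (D.N p ^ 2 * (D.N p ^ ((1:ℝ)/h) - 1)) ∧
    1 + D.lf h p = (1 - (D.N p)⁻¹) * (1 + (D.N p)⁻¹ / (1 - D.N p ^ (-(1:ℝ)/h))) := by
  have hN := D.two_le p
  have hNp := D.N_pos p
  have hh0 : (0:ℝ) < h := by exact_mod_cast (show 0 < h by omega)
  set N := D.N p with hNd
  set u := N ^ (-(1:ℝ)/h) with hu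
  have hup : 0 < u := Real.rpow_pos_of_pos hNp _
  have hu1 : u < 1 := Real.rpow_lt_one_of_one_lt_of_neg (by linarith) (by
    rw [neg_div]; have : 0 < 1 / (h:ℝ) := by positivity
    linarith)
  have hq : N ^ ((1:ℝ)/h) = u⁻¹ := by
    rw [hu, neg_div, Real.rpow_neg hNp.le, inv_inv]
  have hun : u ^ h = N⁻¹ := by
    rw [hu, ← Real.rpow_natCast, ← Real.rpow_mul hNp.le, ← Real.rpow_neg_one]
    congr 1; field_simp
  have hg : D.lf h p * (u - 1) = N⁻¹ ^ 2 - N⁻¹ * u := by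
    unfold BSys.lf
    rw [← hNd, ← hu, geom_sum_Ico_mul u (by omega), mul_comm 2 h, pow_mul, pow_succ u h, hun]
  have hlf : D.lf h p = (N⁻¹ * u - N⁻¹ ^ 2) / (1 - u) := by
    rw [eq_div_iff (by linarith)]; linarith
  have h1u : 1 - u ≠ 0 := by linarith
  rw [hq, hlf]
  constructor
  · have : u⁻¹ - 1 = (1 - u) / u := by field_simp
    rw [this]
    field_simp
  · field_simp
    ring

end HF

open HF in
theorem HF.count_final (K : Type) [Field K] [NumberField K] (h : ℕ) (hh : 2 ≤ h) :
    ∃ C : ℝ, ∀ ℓ : Ideal (NumberField.RingOfIntegers K), ℓ.IsPrime → ℓ ≠ ⊥ →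
      ∀ x : ℝ, 2 ≤ x →
      |(Nat.card {m : Ideal (NumberField.RingOfIntegers K) //
          IsHFull K h m ∧ (Ideal.absNorm m : ℝ) ≤ x ∧ ¬ ℓ ∣ m} : ℝ) -
        kappa K * gammaH K h /
          (1 + (Ideal.absNorm ℓ : ℝ)⁻¹ / (1 - (Ideal.absNorm ℓ : ℝ) ^ (-(1 : ℝ)/h))) *
          x ^ ((1 : ℝ)/h)| ≤
      C * RNh K h x := by
  classical
  obtain ⟨A, hA, hL⟩ := landau K
  set n := Module.finrank ℚ K with hn
  have hn0 : n ≠ 0 := (Module.finrank_pos (R := ℚ) (M := K)).ne'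
  have hκ : 0 ≤ kappa K := by
    have := NumberField.Units.regulator_pos K
    unfold kappa; positivity
  have hI : ∀ X, 1 ≤ X → |(PS K).I X - kappa K * X| ≤ A * X ^ th n := by
    intro X hX
    rw [PS_I]
    exact hL X hX
  have hh0 : (2:ℝ) ≤ h := by exact_mod_cast hh
  have hcase : th n = 1 - 2 / ((n:ℝ) + 1) ∨ (th n < h / ((h:ℝ) + 1) ∧ 1 - 2 / ((n:ℝ) + 1) < h / ((h:ℝ) + 1)) := by
    by_cases h1 : n = 1
    · right
      rw [h1, th_one]
      constructor
      · rw [lt_div_iff₀ (by linarith)]; linarith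
      · norm_num; positivity
    · left; exact th_eq (by omega)
  obtain ⟨C, hC⟩ := (PS K).main hκ hA (th_pos hn0).le (th_lt hn0).le hI hh (R := RNh K h) (by
      intro hlt x
      unfold RNh
      rw [← hn]
      have : 1 - 2 / ((n:ℝ) + 1) < h / ((h:ℝ) + 1) := by
        rcases hcase with h1 | h1
        · rwa [← h1]
        · exact h1.2
      rw [if_neg (not_lt.2 this.le), if_neg this.ne']) (by
      intro heq x
      have h1 := hcase.resolve_right (fun h' => absurd heq h'.1.ne)
      unfold RNh
      rw [← hn, ← h1, heq, if_neg (lt_irrefl _), if_pos rfl]) (by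
      intro hlt x
      have h1 := hcase.resolve_right (fun h' => absurd h'.1 (not_lt.2 hlt.le))
      unfold RNh
      rw [← hn, ← h1, if_pos hlt])
  refine ⟨C, fun ℓ hℓ hℓ0 x hx => ?_⟩
  have key := hC ⟨ℓ, hℓ, hℓ0⟩ x hx
  have e1 : ∏' p, (1 + (PS K).lf h p) = gammaH K h := by
    unfold gammaH
    exact tprod_congr fun p => (lf_formula (PS K) hh p).1
  have e2 := (lf_formula (PS K) hh ⟨ℓ, hℓ, hℓ0⟩).2
  have e3 : (PS K).N ⟨ℓ, hℓ, hℓ0⟩ = Ideal.absNorm ℓ := rfl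
  have e4 := (PS K).lf_nonneg h ⟨ℓ, hℓ, hℓ0⟩
  have e5 := (PS K).two_le ⟨ℓ, hℓ, hℓ0⟩
  rw [← PS_count, e1, e2, e3] at key
  rw [e3] at e2 e5
  have e6 : 1 - (Ideal.absNorm ℓ : ℝ)⁻¹ ≠ 0 := by
    intro h'
    rw [h', zero_mul] at e2; linarith
  have e7 : kappa K * gammaH K h /
          (1 + (Ideal.absNorm ℓ : ℝ)⁻¹ / (1 - (Ideal.absNorm ℓ : ℝ) ^ (-(1 : ℝ)/h))) = kappa K * gammaH K h * ((1 - (Ideal.absNorm ℓ : ℝ)⁻¹) / ((1 - (Ideal.absNorm ℓ : ℝ)⁻¹) * (1 + (Ideal.absNorm ℓ : ℝ)⁻¹ / (1 - (Ideal.absNorm ℓ : ℝ) ^ (-(1 : ℝ)/h))))) := by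
    rw [div_mul_eq_div_div, div_self e6, mul_one_div]
  rw [e7]
  exact key

end HFU

/-- **Distribution of `h`-full ideals coprime to a fixed prime ideal `ℓ`**, uniformly
in `ℓ`:
`|N_{h,ℓ}(x)| = (κ γ_h / (1 + N(ℓ)^{-1}/(1 - N(ℓ)^{-1/h}))) x^{1/h} + O_h(R_{N_h}(x))`. -/
theorem count_hFull_ideals_coprime (h : ℕ) (hh : 2 ≤ h) :
    ∃ C : ℝ, ∀ ℓ : Ideal (NumberField.RingOfIntegers K), ℓ.IsPrime → ℓ ≠ ⊥ →
      ∀ x : ℝ, 2 ≤ x →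
      |(Nat.card {m : Ideal (NumberField.RingOfIntegers K) //
          IsHFull K h m ∧ (Ideal.absNorm m : ℝ) ≤ x ∧ ¬ ℓ ∣ m} : ℝ) -
        kappa K * gammaH K h /
          (1 + (Ideal.absNorm ℓ : ℝ)⁻¹ / (1 - (Ideal.absNorm ℓ : ℝ) ^ (-(1 : ℝ)/h))) *
          x ^ ((1 : ℝ)/h)| ≤
      C * RNh K h x := by
  exact HF.count_final K h hh

end
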